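/- Let d ≥ 2 and let P(x) = x_1^2 + … + x_d^2 ∈ F_q[x_1,…,x_d]. There exists an absolute constant c > 0 such that for every finite field F_q (of odd characteristic) and every set E ⊆ F_q^d with |E| ≥ q^{(d+1)/2}, there exists a subset E′ ⊆ E with |E′| ≥ c·|E| such that for every y ∈ E′ the pinned distance set satisfies |Δ_P(E,y)| > q/2. -/

import Mathlib

namespace PD

open Finset

set_option linter.unusedSectionVars false

section basics
variable {K : Type} [Field K] [Fintype K] [DecidableEq K]

noncomputable def psi (K : Type) [Field K] [Fintype K] : AddChar K ℂ :=
  AddChar.FiniteField.primitiveChar_to_Complex K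

lemma psi_prim : (psi K).IsPrimitive := AddChar.FiniteField.primitiveChar_to_Complex_isPrimitive K

lemma psi_sum (b : K) : ∑ s : K, psi K (s * b) = if b = 0 then (Fintype.card K : ℂ) else 0 := by
  have := AddChar.sum_mulShift (R' := ℂ) b (psi_prim (K := K))
  rw [this]; split_ifs <;> simp

noncomputable def eta (t : K) : ℂ := ((quadraticChar K t : ℤ) : ℂ)

noncomputable def gs (s : K) : ℂ := ∑ z : K, psi K (s * z ^ 2)

lemma two_ne (hK : ringChar K ≠ 2) : (2 : K) ≠ 0 := Ring.two_ne_zero hK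

lemma gs_zero : gs (0 : K) = Fintype.card K := by simp [gs]

lemma sum_sq_eq (hK : ringChar K ≠ 2) (f : K → ℂ) :
    ∑ z : K, f (z ^ 2) = ∑ t : K, (1 + eta t) * f t := by
  rw [← Finset.sum_fiberwise (s := (univ : Finset K)) (g := fun z => z ^ 2) (f := fun z => f (z^2))]
  apply Finset.sum_congr rfl
  intro t _
  have h1 : ∑ z ∈ univ.filter (fun z : K => z ^ 2 = t), f (z ^ 2) =
      ∑ z ∈ univ.filter (fun z : K => z ^ 2 = t), f t := by
    apply Finset.sum_congr rfl
    intro z hz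
    rw [(Finset.mem_filter.1 hz).2]
  rw [h1, Finset.sum_const, nsmul_eq_mul]
  congr 1
  have := quadraticChar_card_sqrts hK t
  have h2 : ({x : K | x ^ 2 = t}.toFinset) = univ.filter (fun z : K => z ^ 2 = t) := by
    ext; simp
  rw [h2] at this
  have h3 : (((univ.filter (fun z : K => z ^ 2 = t)).card : ℤ) : ℂ) = ((quadraticChar K t + 1 : ℤ) : ℂ) := by
    rw [this]
  rw [eta]
  push_cast at h3
  rw [h3]; ring

lemma eta_mul (a b : K) : eta (a * b) = eta a * eta b := by
  rw [eta, eta, eta, map_mul, Int.cast_mul]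

lemma eta_zero : eta (0 : K) = 0 := by simp [eta]

lemma eta_sq {a : K} (ha : a ≠ 0) : eta a * eta a = 1 := by
  have := quadraticChar_sq_one ha
  rw [eta, ← Int.cast_mul, ← sq, this]; simp

lemma eta_sum (hK : ringChar K ≠ 2) : ∑ t : K, eta t = 0 := by
  have := quadraticChar_sum_zero hK
  simp only [eta]
  exact_mod_cast congrArg (fun x : ℤ => (x : ℂ)) this

lemma gs_eq (hK : ringChar K ≠ 2) {s : K} (hs : s ≠ 0) : gs s = ∑ t : K, eta t * psi K (s * t) := by
  rw [gs, sum_sq_eq hK (fun t => psi K (s * t))]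
  simp only [add_mul, one_mul, Finset.sum_add_distrib]
  have : ∑ t : K, psi K (s * t) = 0 := by
    have := psi_sum s
    rw [if_neg hs] at this
    rw [← this]
    exact Finset.sum_congr rfl (fun t _ => by rw [mul_comm])
  rw [this, zero_add]

lemma gs_eta (hK : ringChar K ≠ 2) (s : K) {r : K} (hr : r ≠ 0) (hs : s ≠ 0) : gs (r * s) = eta r * gs s := by
  rw [gs_eq hK (mul_ne_zero hr hs), gs_eq hK hs, Finset.mul_sum]
  rw [← Fintype.sum_equiv (Equiv.mulLeft₀ r hr) (fun t => eta r * (eta (r * t) * psi K (s * (r * t))))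
    (fun t => eta r * (eta t * psi K (s * t))) (fun t => rfl)]
  apply Finset.sum_congr rfl
  intro t _
  rw [eta_mul, ← mul_assoc, ← mul_assoc, eta_sq hr, one_mul, show r * s * t = s * (r * t) by ring]

lemma gs_sq (hK : ringChar K ≠ 2) {s : K} (hs : s ≠ 0) :
    gs s ^ 2 = eta (-1 : K) * Fintype.card K := by
  have h1 : gs (1 : K) ^ 2 = eta (-1 : K) * Fintype.card K := by
    rw [gs_eq hK one_ne_zero]
    have h := gaussSum_sq (χ := (quadraticChar K).ringHomComp (Int.castRingHom ℂ))
      (by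
        intro h
        obtain ⟨a, ha⟩ := quadraticChar_exists_neg_one hK
        have h2 := congrArg (fun χ : MulChar K ℂ => χ a) h
        have ha0 : IsUnit a := by
          rw [isUnit_iff_ne_zero]; rintro rfl; simp at ha
        simp only [MulChar.ringHomComp_apply, ha, MulChar.one_apply ha0] at h2
        norm_num at h2)
      ((quadraticChar_isQuadratic K).comp _) (psi_prim (K := K))
    simpa [gaussSum, eta] using h
  have : gs s = eta s * gs (1 : K) := by
    have := gs_eta hK 1 hs one_ne_zero
    rwa [mul_one] at this
  rw [this, mul_pow, sq, eta_sq hs, one_mul, h1]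

lemma psi_add (a b : K) : psi K (a + b) = psi K a * psi K b := AddChar.map_add_eq_mul _ _ _

lemma psi_sum_prod {ι : Type} (s : Finset ι) (f : ι → K) :
    psi K (∑ i ∈ s, f i) = ∏ i ∈ s, psi K (f i) := by
  classical
  induction s using Finset.induction_on with
  | empty => simp
  | insert a s ha ih => rw [Finset.sum_insert ha, Finset.prod_insert ha, psi_add, ih]

variable {ι : Type} [Fintype ι] [DecidableEq ι]

lemma dot_comm' (x y : ι → K) : x ⬝ᵥ y = y ⬝ᵥ x := dotProduct_comm _ _

def qf (x : ι → K) : K := x ⬝ᵥ x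

lemma qf_add (x y : ι → K) : qf (x + y) = qf x + 2 * (x ⬝ᵥ y) + qf y := by
  simp only [qf, add_dotProduct, dotProduct_add, dotProduct_comm y x]; ring

lemma qf_sub (x y : ι → K) : qf (x - y) = qf x - 2 * (x ⬝ᵥ y) + qf y := by
  simp only [qf, sub_dotProduct, dotProduct_sub, dotProduct_comm y x]; ring

lemma qf_smul (a : K) (x : ι → K) : qf (a • x) = a ^ 2 * qf x := by
  simp only [qf, smul_dotProduct, dotProduct_smul, smul_eq_mul]; ring

lemma qf_neg (x : ι → K) : qf (-x) = qf x := by simp [qf]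

lemma vgauss0 (s : K) : ∑ x : ι → K, psi K (s * qf x) = gs s ^ (Fintype.card ι) := by
  rw [gs, ← Finset.card_univ (α := ι), ← Finset.prod_const, Finset.prod_univ_sum]
  simp only [Fintype.piFinset_univ]
  apply Finset.sum_congr rfl
  intro x _
  rw [qf, dotProduct, Finset.mul_sum, psi_sum_prod]
  simp only [sq]

lemma vgauss (hK : ringChar K ≠ 2) {s : K} (hs : s ≠ 0) (u : ι → K) :
    ∑ x : ι → K, psi K (s * qf x + u ⬝ᵥ x) = gs s ^ (Fintype.card ι) * psi K (- qf u / (4 * s)) := by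
  have h2 := two_ne hK
  rw [← vgauss0, Finset.sum_mul,
    ← Fintype.sum_equiv (Equiv.addRight ((1 / (2 * s)) • u)) (fun x : ι → K => psi K (s * qf (x + (1 / (2 * s)) • u)) * psi K (- qf u / (4 * s)))
    (fun x => psi K (s * qf x) * psi K (- qf u / (4 * s))) (fun t => rfl)]
  apply Finset.sum_congr rfl
  intro x _
  rw [← psi_add]
  congr 1
  rw [qf_add, qf_smul, dotProduct_smul, dotProduct_comm u x, smul_eq_mul]
  have h4 : (4 : K) ≠ 0 := by
    rw [show (4 : K) = 2 * 2 by norm_num]; exact mul_ne_zero h2 h2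
  field_simp
  ring

lemma vlin (u : ι → K) : ∑ x : ι → K, psi K (u ⬝ᵥ x) =
    if u = 0 then (Fintype.card K : ℂ) ^ (Fintype.card ι) else 0 := by
  split_ifs with h
  · simp [h]
  · obtain ⟨i, hi⟩ := Function.ne_iff.1 h
    have : ∑ x : ι → K, psi K (u ⬝ᵥ x) = ∏ j, ∑ z : K, psi K (u j * z) := by
      rw [Finset.prod_univ_sum]
      simp only [Fintype.piFinset_univ]
      apply Finset.sum_congr rfl
      intro x _
      rw [dotProduct, psi_sum_prod]
    rw [this]
    apply Finset.prod_eq_zero (Finset.mem_univ i)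
    have h3 := psi_sum (u i)
    rw [if_neg (by simpa using hi)] at h3
    rw [← h3]
    exact Finset.sum_congr rfl (fun t _ => by rw [mul_comm])

end basics
end PD


namespace PD
open Finset
set_option linter.unusedSectionVars false

section odd
variable {K : Type} [Field K] [Fintype K] [DecidableEq K]
variable {ι : Type} [Fintype ι] [DecidableEq ι]

noncomputable def ft (a : K → ℂ) (s : K) : ℂ := ∑ t, a t * psi K (-(s * t))

lemma cardK_ne : (Fintype.card K : ℂ) ≠ 0 := by
  exact_mod_cast (Fintype.card_pos (α := K)).ne'

lemma ft_inv (a : K → ℂ) (t : K) :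
    a t = (Fintype.card K : ℂ)⁻¹ * ∑ s, ft a s * psi K (s * t) := by
  have : ∑ s, ft a s * psi K (s * t) = ∑ t', a t' * ∑ s : K, psi K (s * (t - t')) := by
    simp only [ft, Finset.sum_mul, Finset.mul_sum]
    rw [Finset.sum_comm]
    refine Finset.sum_congr rfl fun t' _ => Finset.sum_congr rfl fun s _ => ?_
    rw [mul_assoc, ← psi_add]; congr 2; ring
  rw [this]
  simp only [psi_sum, sub_eq_zero]
  simp only [mul_ite, mul_zero, Finset.sum_ite_eq, Finset.mem_univ, if_true]
  have := cardK_ne (K := K)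
  field_simp

lemma ft_zero (a : K → ℂ) (h : ∑ t, a t = 0) : ft a 0 = 0 := by simp [ft, h]

lemma bil_expand {I : Type} [Fintype I] (c : I → ℂ) (p p' : I → K) (a a' : K → ℂ) :
    ∑ i, c i * (a (p i) * a' (p' i)) = (Fintype.card K : ℂ)⁻¹ * (Fintype.card K : ℂ)⁻¹ *
      ∑ s, ∑ s', ft a s * ft a' s' * ∑ i, c i * (psi K (s * p i) * psi K (s' * p' i)) := by
  have h : ∀ i, c i * (a (p i) * a' (p' i)) = (Fintype.card K : ℂ)⁻¹ * (Fintype.card K : ℂ)⁻¹ *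
      ∑ s, ∑ s', ft a s * ft a' s' * (c i * (psi K (s * p i) * psi K (s' * p' i))) := by
    intro i
    conv_lhs => rw [ft_inv a (p i), ft_inv a' (p' i)]
    rw [show ∀ q X Y c : ℂ, c * (q * X * (q * Y)) = q * q * (c * (X * Y)) by intros; ring,
      Finset.sum_mul_sum, Finset.mul_sum]
    congr 1
    refine Finset.sum_congr rfl fun s _ => ?_
    rw [Finset.mul_sum]
    refine Finset.sum_congr rfl fun s' _ => ?_
    ring
  rw [Finset.sum_congr rfl (fun i _ => h i), ← Finset.mul_sum, Finset.sum_comm]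
  congr 1
  refine Finset.sum_congr rfl fun s _ => ?_
  rw [Finset.sum_comm]
  refine Finset.sum_congr rfl fun s' _ => ?_
  rw [Finset.mul_sum]

lemma bil_ext {I J : Type} [Fintype I] [Fintype J] (c : I → ℂ) (p p' : I → K)
    (e : J → ℂ) (r r' : J → K) (a a' : K → ℂ) (ha : ∑ t, a t = 0) (ha' : ∑ t, a' t = 0)
    (h : ∀ s s' : K, s ≠ 0 → s' ≠ 0 → ∑ i, c i * (psi K (s * p i) * psi K (s' * p' i)) =
      ∑ j, e j * (psi K (s * r j) * psi K (s' * r' j))) :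
    ∑ i, c i * (a (p i) * a' (p' i)) = ∑ j, e j * (a (r j) * a' (r' j)) := by
  rw [bil_expand, bil_expand]
  congr 1
  refine Finset.sum_congr rfl fun s _ => Finset.sum_congr rfl fun s' _ => ?_
  by_cases hs : s = 0
  · rw [hs, ft_zero a ha]; simp
  by_cases hs' : s' = 0
  · rw [hs', ft_zero a' ha']; simp
  rw [h s s' hs hs']

lemma twopt (hK : ringChar K ≠ 2) (y y' : ι → K) (hy : y ≠ y') {s s' : K} (hs : s ≠ 0) :
    ∑ x : ι → K, psi K (s * qf (x - y)) * psi K (s' * qf (x - y')) =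
     if s + s' = 0 then 0 else gs (s + s') ^ (Fintype.card ι) * psi K (s * s' * qf (y - y') / (s + s')) := by
  have h2 := two_ne hK
  have h0 : ∀ x : ι → K, psi K (s * qf (x - y)) * psi K (s' * qf (x - y')) =
      psi K ((s + s') * qf x + ((-2 : K) • (s • y + s' • y')) ⬝ᵥ x) * psi K (s * qf y + s' * qf y') := by
    intro x
    rw [← psi_add, ← psi_add]; congr 1
    rw [qf_sub, qf_sub, smul_dotProduct, add_dotProduct, smul_dotProduct, smul_dotProduct,
      dotProduct_comm x y, dotProduct_comm x y']
    simp only [smul_eq_mul]; ring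
  rw [Finset.sum_congr rfl (fun x _ => h0 x), ← Finset.sum_mul]
  split_ifs with h
  · simp only [h, zero_mul, zero_add]
    rw [vlin, if_neg, zero_mul]
    intro h3
    rcases smul_eq_zero.1 h3 with h4 | h4
    · exact h2 (by simpa using h4)
    · have : s' = -s := by linear_combination h
      rw [this, neg_smul, ← sub_eq_add_neg, ← smul_sub] at h4
      rcases smul_eq_zero.1 h4 with h5 | h5
      · exact hs h5
      · exact hy (sub_eq_zero.1 h5)
  · rw [vgauss hK h, mul_assoc, ← psi_add]
    congr 2
    rw [qf_smul, qf_add, qf_smul, qf_smul, qf_sub, smul_dotProduct, dotProduct_smul]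
    simp only [smul_eq_mul]
    have h4 : (4 : K) ≠ 0 := by
      rw [show (4 : K) = 2 * 2 by norm_num]; exact mul_ne_zero h2 h2
    field_simp
    ring

lemma onept (hK : ringChar K ≠ 2) {r s s' : K} (hr : r ≠ 0) (hs : s ≠ 0) :
    ∑ u : K, psi K (s * (r * u ^ 2)) * psi K (s' * (r * (u - 1) ^ 2)) =
     if s + s' = 0 then 0 else eta r * gs (s + s') * psi K (s * s' * r / (s + s')) := by
  have h := twopt (ι := Unit) hK (0 : Unit → K) (1 : Unit → K) (by simp) (s := r * s) (s' := r * s')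
    (mul_ne_zero hr hs)
  rw [← Fintype.sum_equiv (Equiv.funUnique Unit K)
    (fun x : Unit → K => psi K (r * s * qf (x - 0)) * psi K (r * s' * qf (x - 1)))
    (fun u => psi K (s * (r * u ^ 2)) * psi K (s' * (r * (u - 1) ^ 2)))
    (fun x => by
      simp only [qf, dotProduct, Finset.univ_unique, Finset.sum_singleton, Equiv.funUnique_apply, Pi.sub_apply, Pi.zero_apply, Pi.one_apply]
      congr 2 <;> simp <;> ring), h]
  rw [← mul_add]
  by_cases h0 : s + s' = 0
  · simp [h0]
  · rw [if_neg (mul_ne_zero hr h0), if_neg h0, gs_eta hK _ hr h0]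
    simp only [Fintype.card_unit, pow_one]
    congr 2
    have : qf ((0 : Unit → K) - 1) = 1 := by simp [qf, dotProduct]
    rw [this]; field_simp

lemma gs_odd (hK : ringChar K ≠ 2) {s : K} (hs : s ≠ 0) (k : ℕ) :
    gs s ^ (2 * k + 1) = (eta (-1 : K) * Fintype.card K) ^ k * gs s := by
  rw [pow_succ, pow_mul, gs_sq hK hs]

lemma pair_noniso (hK : ringChar K ≠ 2) (k : ℕ) (hk : Fintype.card ι = 2 * k + 1)
    (y y' : ι → K) (hy : y ≠ y') (hr : qf (y - y') ≠ 0)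
    (a a' : K → ℂ) (ha : ∑ t, a t = 0) (ha' : ∑ t, a' t = 0) :
    ∑ x : ι → K, a (qf (x - y)) * a' (qf (x - y')) =
      (eta (-1 : K) * Fintype.card K) ^ k * eta (qf (y - y')) *
        ∑ u : K, a (qf (y - y') * u ^ 2) * a' (qf (y - y') * (u - 1) ^ 2) := by
  have := bil_ext (fun _ : ι → K => (1 : ℂ)) (fun x => qf (x - y)) (fun x => qf (x - y'))
    (fun _ : K => (eta (-1 : K) * Fintype.card K) ^ k * eta (qf (y - y')))
    (fun u => qf (y - y') * u ^ 2) (fun u => qf (y - y') * (u - 1) ^ 2) a a' ha ha' ?_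
  · simpa [← Finset.mul_sum] using this
  · intro s s' hs hs'
    simp only [one_mul, ← Finset.mul_sum]
    rw [twopt hK y y' hy hs, onept hK hr hs, hk]
    split_ifs with h
    · simp
    · rw [gs_odd hK h]
      have := eta_sq hr
      linear_combination (-(eta (-1 : K) * Fintype.card K) ^ k * gs (s + s') * psi K (s * s' * qf (y - y') / (s + s'))) * this

lemma pair_iso (hK : ringChar K ≠ 2) (k : ℕ) (hk : Fintype.card ι = 2 * k + 1)
    (y y' : ι → K) (hy : y ≠ y') (hr : qf (y - y') = 0)
    (a a' : K → ℂ) (ha : ∑ t, a t = 0) (ha' : ∑ t, a' t = 0) :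
    ∑ x : ι → K, a (qf (x - y)) * a' (qf (x - y')) =
      (eta (-1 : K) * Fintype.card K) ^ k * ∑ t : K, eta t * (a t * a' t) := by
  have := bil_ext (fun _ : ι → K => (1 : ℂ)) (fun x => qf (x - y)) (fun x => qf (x - y'))
    (fun t : K => (eta (-1 : K) * Fintype.card K) ^ k * eta t)
    (fun u => u) (fun u => u) a a' ha ha' ?_
  · rw [Finset.mul_sum]
    simpa [mul_assoc] using this
  · intro s s' hs hs'
    simp only [one_mul, mul_assoc, ← Finset.mul_sum]
    rw [twopt hK y y' hy hs, hk, hr]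
    simp only [← psi_add, ← add_mul]
    split_ifs with h
    · simp [h, eta_sum hK]
    · rw [gs_odd hK h, ← gs_eq hK h]
      simp [mul_assoc]
end odd
end PD


namespace PD
open Finset
set_option linter.unusedSectionVars false

section odd2
variable {K : Type} [Field K] [Fintype K] [DecidableEq K]
variable {ι : Type} [Fintype ι] [DecidableEq ι]

noncomputable def chi (t : K) : ℝ := ((quadraticChar K t : ℤ) : ℝ)

lemma eta_chi (t : K) : eta t = (chi t : ℂ) := by simp [eta, chi]

lemma chi_mul (a b : K) : chi (a * b) = chi a * chi b := by
  rw [chi, chi, chi, map_mul, Int.cast_mul]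

lemma chi_cases {t : K} (ht : t ≠ 0) : chi t = 1 ∨ chi t = -1 := by
  rcases quadraticChar_dichotomy ht with h | h <;> simp only [chi, h] <;> simp

lemma chi_zero : chi (0 : K) = 0 := by simp [chi]

lemma chi_abs (t : K) : |chi t| ≤ 1 := by
  by_cases h : t = 0
  · simp [h, chi_zero]
  · rcases chi_cases h with h | h <;> simp [h]

lemma chi_one_sq {t : K} (ht : t ≠ 0) (h : chi t = 1) : ∃ u : K, u ≠ 0 ∧ u ^ 2 = t := by
  have : quadraticChar K t = 1 := by
    have : ((quadraticChar K t : ℤ) : ℝ) = ((1 : ℤ) : ℝ) := by simpa [chi] using h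
    exact_mod_cast this
  obtain ⟨u, hu⟩ := (quadraticChar_one_iff_isSquare ht).1 this
  refine ⟨u, ?_, by rw [hu, sq]⟩
  rintro rfl; simp at hu; exact ht hu

lemma sum_le_card_sub_two {I : Type} [Fintype I] [DecidableEq I] (h : I → ℝ) (hh : ∀ i, h i ≤ 1) (i j : I) (hij : i ≠ j)
    (hi : h i ≤ 0) (hj : h j ≤ 0) : ∑ u, h u ≤ (Fintype.card I : ℝ) - 2 := by
  have : ∑ u, h u ≤ ∑ u, (1 - (if u = i then 1 else 0) - (if u = j then (1 : ℝ) else 0)) := by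
    apply Finset.sum_le_sum
    intro u _
    have := hh u
    split_ifs with h1 h2 h2
    · exact absurd (h1.symm.trans h2) hij
    · subst h1; linarith
    · subst h2; linarith
    · linarith
  rw [Finset.sum_sub_distrib, Finset.sum_sub_distrib] at this
  simp at this
  linarith

lemma pair_bound (hK : ringChar K ≠ 2) (k : ℕ) (hk : Fintype.card ι = 2 * k + 1)
    (y y' : ι → K) (hy : y ≠ y')
    (a a' : K → ℝ) (ha : ∑ t, a t = 0) (ha' : ∑ t, a' t = 0)
    (h1 : ∀ t, |a t| ≤ 1) (h1' : ∀ t, |a' t| ≤ 1)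
    (h0 : a 0 = 1) (h0' : a' 0 = 1) (hr : a (qf (y - y')) = 1) (hr' : a' (qf (y - y')) = 1)
    (t0 : K) (ht0 : t0 ≠ 0) (hchi : chi t0 = chi (-1 : K) ^ k) (hat : a t0 = 0) :
    ∑ x : ι → K, a (qf (x - y)) * a' (qf (x - y')) ≤ (Fintype.card K : ℝ) ^ k * ((Fintype.card K : ℝ) - 2) := by
  have hac : ∑ t, (a t : ℂ) = 0 := by rw [← Complex.ofReal_sum, ha]; simp
  have hac' : ∑ t, (a' t : ℂ) = 0 := by rw [← Complex.ofReal_sum, ha']; simp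
  have hab : ∀ s t, |a s * a' t| ≤ 1 := by
    intro s t
    rw [abs_mul]
    exact mul_le_one₀ (h1 s) (abs_nonneg _) (h1' t)
  have hab1 : ∀ s t, a s * a' t ≤ 1 := fun s t => (abs_le.1 (hab s t)).2
  have hab2 : ∀ s t, -(a s * a' t) ≤ 1 := fun s t => by linarith [(abs_le.1 (hab s t)).1]
  have hkap := chi_cases (K := K) (t := -1) (by simp)
  have hkap2 : chi (-1 : K) ^ k = 1 ∨ chi (-1 : K) ^ k = -1 := by
    rcases hkap with h | h
    · left; rw [h, one_pow]
    · rw [h]; exact neg_one_pow_eq_or ℝ k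
  have h2 := two_ne hK
  set r := qf (y - y') with hrdef
  set κ := chi (-1 : K) ^ k with hκ
  by_cases hr0 : r = 0
  · have h := pair_iso hK k hk y y' hy hr0 (fun t => (a t : ℂ)) (fun t => (a' t : ℂ)) hac hac'
    simp only [eta_chi] at h
    have hreal : ∑ x : ι → K, a (qf (x - y)) * a' (qf (x - y')) =
      (chi (-1 : K) * Fintype.card K) ^ k * ∑ t : K, chi t * (a t * a' t) := by
      apply Complex.ofReal_injective
      push_cast
      exact h
    rw [hreal, mul_pow, ← hκ, mul_comm κ, mul_assoc]
    apply mul_le_mul_of_nonneg_left _ (by positivity)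
    rw [Finset.mul_sum]
    apply sum_le_card_sub_two _ _ 0 t0 ht0.symm
    · simp [chi_zero]
    · simp [hat]
    · intro t
      have h3 := chi_abs t
      have : |κ * (chi t * (a t * a' t))| ≤ 1 := by
        rw [abs_mul, abs_mul]
        have hk1 : |κ| = 1 := by rcases hkap2 with h | h <;> simp [h]
        rw [hk1, one_mul]
        exact mul_le_one₀ h3 (abs_nonneg _) (hab t t)
      exact (abs_le.1 this).2
  · have h := pair_noniso hK k hk y y' hy hr0 (fun t => (a t : ℂ)) (fun t => (a' t : ℂ)) hac hac'
    simp only [eta_chi] at h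
    rw [← hrdef] at h
    have hreal : ∑ x : ι → K, a (qf (x - y)) * a' (qf (x - y')) =
      (chi (-1 : K) * Fintype.card K) ^ k * chi r * ∑ u : K, a (r * u ^ 2) * a' (r * (u - 1) ^ 2) := by
      apply Complex.ofReal_injective
      push_cast
      exact h
    rw [hreal, mul_pow, ← hκ, show ∀ Q S c : ℝ, κ * Q * c * S = Q * (κ * c * S) by intros; ring]
    apply mul_le_mul_of_nonneg_left _ (by positivity)
    rw [Finset.mul_sum]
    have hkk : κ * κ = 1 := by rcases hkap2 with h | h <;> simp [h]
    have hcr := chi_cases hr0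
    have hprod : κ * chi r = 1 ∨ κ * chi r = -1 := by
      rcases hkap2 with h | h <;> rcases hcr with h' | h' <;> simp [h, h']
    rcases hprod with hp | hp
    · simp only [hp, one_mul]
      have hd0 : t0 / r ≠ 0 := div_ne_zero ht0 hr0
      have : chi (t0 / r) = 1 := by
        have e1 : chi t0 = chi (t0 / r) * chi r := by rw [← chi_mul, div_mul_cancel₀ _ hr0]
        have e2 : chi (t0 / r) * (κ * chi r) = κ * κ := by rw [← hchi, e1]; ring
        rw [hp, hkk, mul_one] at e2
        exact e2
      obtain ⟨u, hu0, hu⟩ := chi_one_sq hd0 this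
      have hru : r * u ^ 2 = t0 := by rw [hu]; field_simp
      apply sum_le_card_sub_two _ _ u (-u)
      · intro h3
        have : (2 : K) * u = 0 := by linear_combination h3
        rcases mul_eq_zero.1 this with h | h
        · exact h2 h
        · exact hu0 h
      · rw [hru, hat, zero_mul]
      · rw [neg_sq, hru, hat, zero_mul]
      · intro u; exact hab1 _ _
    · simp only [hp]
      apply sum_le_card_sub_two _ _ (0 : K) 1 zero_ne_one
      · simp [h0, hr']
      · simp [h0', hr]
      · intro u; have := hab2 (r * u ^ 2) (r * (u - 1) ^ 2); linarith

lemma exists_a (hK : ringChar K ≠ 2) (D : Finset K) (h0 : (0 : K) ∈ D) (hD : 2 * D.card ≤ Fintype.card K)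
    (κ : ℝ) (hκ : κ = 1 ∨ κ = -1) : ∃ a : K → ℝ, ∑ t, a t = 0 ∧ (∀ t, |a t| ≤ 1) ∧ (∀ t ∈ D, a t = 1) ∧
      ∃ t0, t0 ≠ 0 ∧ chi t0 = κ ∧ a t0 = 0 := by
  have hodd : Fintype.card K % 2 = 1 := FiniteField.odd_card_of_char_ne_two hK
  obtain ⟨m, hm⟩ : ∃ m, Fintype.card K = 2 * m + 1 := ⟨Fintype.card K / 2, by omega⟩
  -- counting
  have hex : ∃ t0, t0 ∉ D ∧ chi t0 = κ := by
    by_contra hcon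
    push Not at hcon
    have hsum : ∑ t : K, chi t = 0 := by
      have := quadraticChar_sum_zero hK
      simp only [chi]
      exact_mod_cast congrArg (fun x : ℤ => (x : ℝ)) this
    have hle : ∑ t : K, κ * chi t ≤ ∑ t : K, ((if t ∈ D then 2 else 0) - (if t = 0 then 1 else 0) - 1 : ℝ) := by
      apply Finset.sum_le_sum
      intro t _
      by_cases ht0 : t = 0
      · subst ht0; simp [h0, chi_zero]; norm_num
      by_cases ht : t ∈ D
      · simp only [ht, ht0, if_true, if_false]
        rcases hκ with h | h <;> rcases chi_cases ht0 with h' | h' <;> rw [h, h'] <;> norm_num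
      · have hne := hcon t ht
        simp only [ht, ht0, if_false]
        rcases hκ with h | h <;> rcases chi_cases ht0 with h' | h' <;> rw [h, h']
        · exact absurd (h'.trans h.symm) hne
        · norm_num
        · norm_num
        · exact absurd (h'.trans h.symm) hne
    rw [← Finset.mul_sum, hsum, mul_zero, Finset.sum_sub_distrib, Finset.sum_sub_distrib] at hle
    simp at hle
    rw [hm] at hle hD
    have : (D.card : ℝ) ≤ m := by exact_mod_cast (by omega : D.card ≤ m)
    push_cast at hle
    linarith
  obtain ⟨t0, ht0D, ht0⟩ := hex
  have hsub : D ⊆ univ.erase t0 := by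
    intro t ht; simp; rintro rfl; exact ht0D ht
  obtain ⟨D', hDD', hD'e, hD'c⟩ := Finset.exists_subsuperset_card_eq (n := m) hsub (by omega)
    (by rw [Finset.card_erase_of_mem (Finset.mem_univ _), Finset.card_univ]; omega)
  have ht0D' : t0 ∉ D' := fun h => by simpa using hD'e h
  refine ⟨fun t => (if t ∈ D' then 2 else 0) + (if t = t0 then 1 else 0) - 1, ?_, ?_, ?_, t0, ?_, ht0, ?_⟩
  · rw [Finset.sum_sub_distrib, Finset.sum_add_distrib]
    simp [hD'c, hm]; ring
  · intro t
    by_cases h : t = t0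
    · subst h; simp [ht0D']
    · by_cases h' : t ∈ D' <;> simp [h, h'] <;> norm_num
  · intro t ht
    have : t ≠ t0 := by rintro rfl; exact ht0D ht
    simp [hDD' ht, this]; norm_num
  · rintro rfl; exact ht0D h0
  · simp [ht0D']

theorem odd_main (hK : ringChar K ≠ 2) (k : ℕ) (hk : Fintype.card ι = 2 * k + 1)
    (E B : Finset (ι → K)) (hBE : B ⊆ E)
    (hB : ∀ y ∈ B, 2 * (E.image (fun x => qf (x - y))).card ≤ Fintype.card K) :
    (E.card : ℝ) * (B.card : ℝ) ^ 2 ≤ B.card * (Fintype.card K : ℝ) ^ (2 * k + 1) +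
      B.card * (B.card - 1) * ((Fintype.card K : ℝ) ^ k * ((Fintype.card K : ℝ) - 2)) := by
  have hkap2 : chi (-1 : K) ^ k = 1 ∨ chi (-1 : K) ^ k = -1 := by
    rcases chi_cases (K := K) (t := -1) (by simp) with h | h
    · left; rw [h, one_pow]
    · rw [h]; exact neg_one_pow_eq_or ℝ k
  have hq0 : ∀ z : ι → K, qf (z - z) = 0 := by intro z; simp [qf]
  have : ∀ y : ι → K, ∃ a : K → ℝ, y ∈ B → (∑ t, a t = 0 ∧ (∀ t, |a t| ≤ 1) ∧
      (∀ t ∈ E.image (fun x => qf (x - y)), a t = 1) ∧ ∃ t0, t0 ≠ 0 ∧ chi t0 = chi (-1 : K) ^ k ∧ a t0 = 0) := by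
    intro y
    by_cases hy : y ∈ B
    · obtain ⟨a, ha⟩ := exists_a hK (E.image (fun x => qf (x - y)))
        (by rw [Finset.mem_image]; exact ⟨y, hBE hy, hq0 y⟩) (hB y hy) _ hkap2
      exact ⟨a, fun _ => ha⟩
    · exact ⟨0, fun h => absurd h hy⟩
  choose a ha using this
  have key : ∑ x : ι → K, (∑ y ∈ B, a y (qf (x - y))) ^ 2 ≤ B.card * (Fintype.card K : ℝ) ^ (2 * k + 1) +
      B.card * (B.card - 1) * ((Fintype.card K : ℝ) ^ k * ((Fintype.card K : ℝ) - 2)) := by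
    have e : ∑ x : ι → K, (∑ y ∈ B, a y (qf (x - y))) ^ 2 =
        ∑ y ∈ B, ∑ y' ∈ B, ∑ x : ι → K, a y (qf (x - y)) * a y' (qf (x - y')) := by
      simp only [sq, Finset.sum_mul_sum]
      rw [Finset.sum_comm]
      refine Finset.sum_congr rfl fun y _ => ?_
      rw [Finset.sum_comm]
    rw [e]
    have hb : ∀ y ∈ B, ∀ y' ∈ B, ∑ x : ι → K, a y (qf (x - y)) * a y' (qf (x - y')) ≤
        (if y = y' then (Fintype.card K : ℝ) ^ (2 * k + 1) - ((Fintype.card K : ℝ) ^ k * ((Fintype.card K : ℝ) - 2)) else 0)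
          + ((Fintype.card K : ℝ) ^ k * ((Fintype.card K : ℝ) - 2)) := by
      intro y hy y' hy'
      obtain ⟨h1, h2, h3, t0, h4, h5, h6⟩ := ha y hy
      obtain ⟨h1', h2', h3', -⟩ := ha y' hy'
      split_ifs with hyy
      · subst hyy
        rw [sub_add_cancel]
        have : ∑ x : ι → K, a y (qf (x - y)) * a y (qf (x - y)) ≤ ∑ x : ι → K, (1 : ℝ) := by
          apply Finset.sum_le_sum
          intro x _
          rw [← sq, ← sq_abs]
          exact pow_le_one₀ (abs_nonneg _) (h2 _)
        refine this.trans (le_of_eq ?_)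
        simp [hk]
      · rw [zero_add]
        refine pair_bound hK k hk y y' hyy (a y) (a y') h1 h1' h2 h2' (h3 _ ?_) (h3' _ ?_) (h3 _ ?_) (h3' _ ?_) t0 h4 h5 h6
        · exact Finset.mem_image.2 ⟨y, hBE hy, hq0 y⟩
        · exact Finset.mem_image.2 ⟨y', hBE hy', hq0 y'⟩
        · exact Finset.mem_image.2 ⟨y', hBE hy', by rw [← qf_neg, neg_sub]⟩
        · exact Finset.mem_image.2 ⟨y, hBE hy, rfl⟩
    refine (Finset.sum_le_sum fun y hy => Finset.sum_le_sum fun y' hy' => hb y hy y' hy').trans (le_of_eq ?_)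
    simp only [Finset.sum_add_distrib, Finset.sum_ite_eq, Finset.sum_const, nsmul_eq_mul]
    rw [Finset.sum_ite_mem, Finset.inter_self, Finset.sum_const, nsmul_eq_mul]
    ring
  refine le_trans ?_ key
  have h1 : ∑ x ∈ E, (∑ y ∈ B, a y (qf (x - y))) ^ 2 = E.card * (B.card : ℝ) ^ 2 := by
    have : ∀ x ∈ E, (∑ y ∈ B, a y (qf (x - y))) ^ 2 = (B.card : ℝ) ^ 2 := by
      intro x hx
      have : ∑ y ∈ B, a y (qf (x - y)) = ∑ y ∈ B, (1 : ℝ) := by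
        refine Finset.sum_congr rfl fun y hy => ?_
        exact (ha y hy).2.2.1 _ (Finset.mem_image_of_mem _ hx)
      rw [this]; simp
    rw [Finset.sum_congr rfl this]; simp
  rw [← h1]
  apply Finset.sum_le_univ_sum_of_nonneg
  intro x; positivity

end odd2
end PD


namespace PD
open Finset
set_option linter.unusedSectionVars false

section iso
variable {K : Type} [Field K] [Fintype K] [DecidableEq K]
variable {ι : Type} [Fintype ι] [DecidableEq ι]

noncomputable def hh (b : K) : ℂ := ∑ l ∈ univ.erase (0 : K), psi K (l * b)

lemma hh_eq (b : K) : hh b = (if b = 0 then (Fintype.card K : ℂ) else 0) - 1 := by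
  rw [hh, ← psi_sum, ← Finset.add_sum_erase univ _ (Finset.mem_univ (0 : K))]
  simp

lemma sgauss (hK : ringChar K ≠ 2) {s : K} (hs : s ≠ 0) (u : K) :
    ∑ x : K, psi K (s * x ^ 2 + u * x) = gs s * psi K (- u ^ 2 / (4 * s)) := by
  have h := vgauss (ι := Unit) hK hs (fun _ => u)
  rw [← Fintype.sum_equiv (Equiv.funUnique Unit K)
    (fun x : Unit → K => psi K (s * qf x + (fun _ => u) ⬝ᵥ x))
    (fun x => psi K (s * x ^ 2 + u * x))
    (fun x => by simp [qf, dotProduct, sq]), h]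
  simp [qf, dotProduct, sq]

lemma slin (u : K) : ∑ x : K, psi K (u * x) = if u = 0 then (Fintype.card K : ℂ) else 0 := by
  rw [← psi_sum]
  exact Finset.sum_congr rfl fun x _ => by rw [mul_comm]

lemma iso_ident (hK : ringChar K ≠ 2) (k : ℕ) (hk : Fintype.card ι = 2 * k) {t : K} (ht : t ≠ 0)
    (x x' : ι → K) (hx : qf x = t) (hx' : qf x' = t) :
    ∑ p : (ι → K) × K, (if qf p.1 - t * p.2 ^ 2 = 0 then (1 : ℂ) else 0) *
      (hh (x ⬝ᵥ p.1 - t * p.2) * hh (x' ⬝ᵥ p.1 - t * p.2)) =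
      if x = x' then ((Fintype.card K : ℂ) - 1) * (Fintype.card K : ℂ) ^ (2 * k) else 0 := by
  have h2 := two_ne hK
  have h4 : (4 : K) ≠ 0 := by
    rw [show (4 : K) = 2 * 2 by norm_num]; exact mul_ne_zero h2 h2
  have hq := cardK_ne (K := K)
  have step1 : (Fintype.card K : ℂ) * ∑ p : (ι → K) × K, (if qf p.1 - t * p.2 ^ 2 = 0 then (1 : ℂ) else 0) *
      (hh (x ⬝ᵥ p.1 - t * p.2) * hh (x' ⬝ᵥ p.1 - t * p.2)) =
      ∑ s : K, ∑ l ∈ univ.erase (0 : K), ∑ l' ∈ univ.erase (0 : K),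
        (∑ z : ι → K, psi K (s * qf z + (l • x + l' • x') ⬝ᵥ z)) *
        (∑ w : K, psi K ((-(s * t)) * w ^ 2 + (-(t * (l + l'))) * w)) := by
    have e1 : ∀ p : (ι → K) × K, (Fintype.card K : ℂ) * ((if qf p.1 - t * p.2 ^ 2 = 0 then (1 : ℂ) else 0) *
      (hh (x ⬝ᵥ p.1 - t * p.2) * hh (x' ⬝ᵥ p.1 - t * p.2))) =
      ∑ s : K, ∑ l ∈ univ.erase (0 : K), ∑ l' ∈ univ.erase (0 : K),
        psi K (s * qf p.1 + (l • x + l' • x') ⬝ᵥ p.1) * psi K ((-(s * t)) * p.2 ^ 2 + (-(t * (l + l'))) * p.2) := by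
      intro p
      have : (Fintype.card K : ℂ) * (if qf p.1 - t * p.2 ^ 2 = 0 then (1 : ℂ) else 0) =
          ∑ s : K, psi K (s * (qf p.1 - t * p.2 ^ 2)) := by
        rw [psi_sum]; split_ifs <;> simp
      rw [← mul_assoc, this, hh, hh, Finset.sum_mul_sum, Finset.sum_mul]
      refine Finset.sum_congr rfl fun s _ => ?_
      rw [Finset.mul_sum]
      refine Finset.sum_congr rfl fun l _ => ?_
      rw [Finset.mul_sum]
      refine Finset.sum_congr rfl fun l' _ => ?_
      rw [← psi_add, ← psi_add, ← psi_add]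
      congr 1
      rw [add_dotProduct, smul_dotProduct, smul_dotProduct]
      simp only [smul_eq_mul]; ring
    rw [Finset.mul_sum, Finset.sum_congr rfl (fun p _ => e1 p), Finset.sum_comm]
    refine Finset.sum_congr rfl fun s _ => ?_
    rw [Finset.sum_comm]
    refine Finset.sum_congr rfl fun l _ => ?_
    rw [Finset.sum_comm]
    refine Finset.sum_congr rfl fun l' _ => ?_
    rw [Fintype.sum_prod_type, Finset.sum_mul_sum]
  have step2 : ∀ s : K, s ≠ 0 → ∑ l ∈ univ.erase (0 : K), ∑ l' ∈ univ.erase (0 : K),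
        (∑ z : ι → K, psi K (s * qf z + (l • x + l' • x') ⬝ᵥ z)) *
        (∑ w : K, psi K ((-(s * t)) * w ^ 2 + (-(t * (l + l'))) * w)) =
      eta s * ((eta (-1 : K) * Fintype.card K) ^ k * gs (-t) *
        ∑ l ∈ univ.erase (0 : K), ((if x ⬝ᵥ x' - t = 0 then (Fintype.card K : ℂ) else 0) - 1)) := by
    intro s hs
    rw [Finset.mul_sum, Finset.mul_sum]
    refine Finset.sum_congr rfl fun l hl => ?_
    have hl0 : l ≠ 0 := (Finset.mem_erase.1 hl).1
    have hst : -(s * t) ≠ 0 := neg_ne_zero.2 (mul_ne_zero hs ht)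
    have e2 : ∀ l' : K, (∑ z : ι → K, psi K (s * qf z + (l • x + l' • x') ⬝ᵥ z)) *
        (∑ w : K, psi K ((-(s * t)) * w ^ 2 + (-(t * (l + l'))) * w)) =
        eta s * ((eta (-1 : K) * Fintype.card K) ^ k * gs (-t)) * psi K (l' * (-(l * (x ⬝ᵥ x' - t)) / (2 * s))) := by
      intro l'
      rw [vgauss hK hs, sgauss hK hst, hk, pow_mul, gs_sq hK hs, show -(s * t) = s * (-t) by ring,
        gs_eta hK _ hs (neg_ne_zero.2 ht)]
      have : psi K (-qf (l • x + l' • x') / (4 * s)) * psi K (-(-(t * (l + l'))) ^ 2 / (4 * (s * -t))) =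
          psi K (l' * (-(l * (x ⬝ᵥ x' - t)) / (2 * s))) := by
        rw [← psi_add]
        congr 1
        rw [qf_add, qf_smul, qf_smul, hx, hx', smul_dotProduct, dotProduct_smul]
        simp only [smul_eq_mul]
        field_simp
        ring
      rw [← this]; ring
    rw [Finset.sum_congr rfl (fun l' _ => e2 l'), ← Finset.mul_sum]
    have e3 : ∑ l' ∈ univ.erase (0 : K), psi K (l' * (-(l * (x ⬝ᵥ x' - t)) / (2 * s))) =
        (if x ⬝ᵥ x' - t = 0 then (Fintype.card K : ℂ) else 0) - 1 := by
      have := hh_eq (-(l * (x ⬝ᵥ x' - t)) / (2 * s))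
      rw [hh] at this
      rw [this]
      congr 1
      by_cases hb : x ⬝ᵥ x' - t = 0
      · simp [hb]
      · rw [if_neg hb, if_neg]
        exact div_ne_zero (neg_ne_zero.2 (mul_ne_zero hl0 hb)) (mul_ne_zero h2 hs)
    rw [e3]; ring
  have step3 : ∑ l ∈ univ.erase (0 : K), ∑ l' ∈ univ.erase (0 : K),
        (∑ z : ι → K, psi K ((0 : K) * qf z + (l • x + l' • x') ⬝ᵥ z)) *
        (∑ w : K, psi K ((-((0 : K) * t)) * w ^ 2 + (-(t * (l + l'))) * w)) =
        if x = x' then ((Fintype.card K : ℂ) - 1) * (Fintype.card K : ℂ) ^ (2 * k) * Fintype.card K else 0 := by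
    simp only [zero_mul, zero_add, neg_zero]
    have e4 : ∀ l ∈ univ.erase (0 : K), ∑ l' ∈ univ.erase (0 : K), (∑ z : ι → K, psi K ((l • x + l' • x') ⬝ᵥ z)) *
        (∑ w : K, psi K ((-(t * (l + l'))) * w)) =
        if x = x' then (Fintype.card K : ℂ) ^ (2 * k) * Fintype.card K else 0 := by
      intro l hl
      have hl0 : l ≠ 0 := (Finset.mem_erase.1 hl).1
      rw [Finset.sum_eq_single (-l)]
      · rw [vlin, slin, hk]
        have : l • x + (-l) • x' = l • (x - x') := by rw [smul_sub, neg_smul, sub_eq_add_neg]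
        rw [this]
        simp only [smul_eq_zero, hl0, false_or, sub_eq_zero, add_neg_cancel, mul_zero, neg_zero, if_true]
        split_ifs <;> simp
      · intro l' _ hll
        rw [slin, if_neg, mul_zero]
        rw [neg_eq_zero]
        refine mul_ne_zero ht fun h => hll ?_
        linear_combination h
      · intro h; exact absurd (Finset.mem_erase.2 ⟨neg_ne_zero.2 hl0, Finset.mem_univ _⟩) h
    rw [Finset.sum_congr rfl e4, Finset.sum_const, Finset.card_erase_of_mem (Finset.mem_univ _), Finset.card_univ,
      nsmul_eq_mul, Nat.cast_sub Fintype.card_pos]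
    split_ifs
    · push_cast; ring
    · simp
  have step4 : ∑ s ∈ univ.erase (0 : K), eta s = 0 := by
    have := eta_sum hK
    rw [← Finset.add_sum_erase univ _ (Finset.mem_univ (0 : K)), eta_zero, zero_add] at this
    exact this
  apply mul_left_cancel₀ hq
  rw [step1, ← Finset.add_sum_erase univ _ (Finset.mem_univ (0 : K)), step3,
    Finset.sum_congr rfl (fun s hs => step2 s (Finset.mem_erase.1 hs).1), ← Finset.sum_mul, step4, zero_mul, add_zero]
  split_ifs
  · ring
  · simp

noncomputable def hr (b : K) : ℝ := (if b = 0 then (Fintype.card K : ℝ) else 0) - 1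

lemma hr_hh (b : K) : ((hr b : ℝ) : ℂ) = hh b := by
  rw [hh_eq, hr]; split_ifs <;> simp

lemma iso_ident_real (hK : ringChar K ≠ 2) (k : ℕ) (hk : Fintype.card ι = 2 * k) {t : K} (ht : t ≠ 0)
    (x x' : ι → K) (hx : qf x = t) (hx' : qf x' = t) :
    ∑ p : (ι → K) × K, (if qf p.1 - t * p.2 ^ 2 = 0 then (1 : ℝ) else 0) *
      (hr (x ⬝ᵥ p.1 - t * p.2) * hr (x' ⬝ᵥ p.1 - t * p.2)) =
      if x = x' then ((Fintype.card K : ℝ) - 1) * (Fintype.card K : ℝ) ^ (2 * k) else 0 := by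
  have := iso_ident hK k hk ht x x' hx hx'
  simp only [← hr_hh] at this
  apply Complex.ofReal_injective
  push_cast
  simpa [apply_ite] using this

lemma iso_bound (hK : ringChar K ≠ 2) (k : ℕ) (hk : Fintype.card ι = 2 * k) {t : K} (ht : t ≠ 0)
    (A : Finset (ι → K)) (hA : ∀ x ∈ A, qf x = t) :
    (Fintype.card K : ℝ) * ∑ x ∈ A, ∑ x' ∈ A, (if qf (x - x') = 0 then (1 : ℝ) else 0) ≤
      (A.card : ℝ) ^ 2 + (Fintype.card K : ℝ) ^ k * A.card := by
  have h2 := two_ne hK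
  set q : ℝ := (Fintype.card K : ℝ) with hq
  have hq1 : 1 < q := by
    rw [hq]; exact_mod_cast Fintype.one_lt_card (α := K)
  set G : (ι → K) × K → ℝ := fun p => ∑ x ∈ A, hr (x ⬝ᵥ p.1 - t * p.2) with hG
  have hGsum : ∑ p : (ι → K) × K, (if qf p.1 - t * p.2 ^ 2 = 0 then (1 : ℝ) else 0) * G p ^ 2 =
      (q - 1) * q ^ (2 * k) * A.card := by
    have e1 : ∀ p, (if qf p.1 - t * p.2 ^ 2 = 0 then (1 : ℝ) else 0) * G p ^ 2 =
        ∑ x ∈ A, ∑ x' ∈ A, (if qf p.1 - t * p.2 ^ 2 = 0 then (1 : ℝ) else 0) *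
          (hr (x ⬝ᵥ p.1 - t * p.2) * hr (x' ⬝ᵥ p.1 - t * p.2)) := by
      intro p
      rw [sq (G p)]
      simp only [hG]
      rw [Finset.sum_mul_sum, Finset.mul_sum]
      refine Finset.sum_congr rfl fun x _ => ?_
      rw [Finset.mul_sum]
    rw [Finset.sum_congr rfl (fun p _ => e1 p), Finset.sum_comm]
    have e2 : ∀ x ∈ A, ∑ p : (ι → K) × K, ∑ x' ∈ A, (if qf p.1 - t * p.2 ^ 2 = 0 then (1 : ℝ) else 0) *
          (hr (x ⬝ᵥ p.1 - t * p.2) * hr (x' ⬝ᵥ p.1 - t * p.2)) = (q - 1) * q ^ (2 * k) := by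
      intro x hx
      rw [Finset.sum_comm, Finset.sum_congr rfl (fun x' hx' => iso_ident_real hK k hk ht x x' (hA x hx) (hA x' hx')),
        Finset.sum_ite_eq, if_pos hx]
    rw [Finset.sum_congr rfl e2, Finset.sum_const, nsmul_eq_mul]; ring
  -- restrict
  have hres : ∑ p ∈ A ×ˢ univ.erase (0 : K), G (p.1, 1) ^ 2 ≤ (q - 1) * q ^ (2 * k) * A.card := by
    rw [← hGsum]
    have hinj : Set.InjOn (fun p : (ι → K) × K => (p.2 • p.1, p.2)) (A ×ˢ univ.erase (0 : K) : Finset _) := by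
      intro p hp p' hp' h
      simp only [Finset.coe_product, Set.mem_prod, Finset.mem_coe, Finset.mem_erase] at hp hp'
      simp only [Prod.mk.injEq] at h
      obtain ⟨h1, h3⟩ := h
      rw [h3] at h1
      have := smul_right_injective (ι → K) hp'.2.1 h1
      exact Prod.ext this h3
    calc ∑ p ∈ A ×ˢ univ.erase (0 : K), G (p.1, 1) ^ 2
        = ∑ p ∈ A ×ˢ univ.erase (0 : K), (fun p : (ι → K) × K => (if qf p.1 - t * p.2 ^ 2 = 0 then (1 : ℝ) else 0) * G p ^ 2) ((fun p : (ι → K) × K => (p.2 • p.1, p.2)) p) := by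
          refine Finset.sum_congr rfl fun p hp => ?_
          obtain ⟨hp1, hp2⟩ := Finset.mem_product.1 hp
          have hp0 : p.2 ≠ 0 := (Finset.mem_erase.1 hp2).1
          have : qf (p.2 • p.1) - t * p.2 ^ 2 = 0 := by rw [qf_smul, hA _ hp1]; ring
          simp only [this, if_true, one_mul]
          congr 1
          simp only [hG]
          refine Finset.sum_congr rfl fun x _ => ?_
          rw [hr, hr, dotProduct_smul, smul_eq_mul, show p.2 * x ⬝ᵥ p.1 - t * p.2 = p.2 * (x ⬝ᵥ p.1 - t * 1) by ring]
          simp only [mul_eq_zero, hp0, false_or]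
      _ = ∑ p ∈ (A ×ˢ univ.erase (0 : K)).image (fun p : (ι → K) × K => (p.2 • p.1, p.2)), (if qf p.1 - t * p.2 ^ 2 = 0 then (1 : ℝ) else 0) * G p ^ 2 := by
          rw [Finset.sum_image hinj]
      _ ≤ _ := by
          apply Finset.sum_le_univ_sum_of_nonneg
          intro p
          split_ifs <;> positivity
  rw [Finset.sum_product] at hres
  simp only [Finset.sum_const, nsmul_eq_mul, Finset.card_erase_of_mem (Finset.mem_univ (0 : K)), Finset.card_univ] at hres
  rw [← Finset.mul_sum, Nat.cast_sub Fintype.card_pos, Nat.cast_one, ← hq, mul_assoc] at hres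
  have hres2 : ∑ x ∈ A, G (x, 1) ^ 2 ≤ q ^ (2 * k) * A.card := le_of_mul_le_mul_left hres (by linarith)
  have hcs : (∑ x ∈ A, G (x, 1)) ^ 2 ≤ A.card * ∑ x ∈ A, G (x, 1) ^ 2 := sq_sum_le_card_mul_sum_sq
  have hcs2 : (∑ x ∈ A, G (x, 1)) ^ 2 ≤ (q ^ k * A.card) ^ 2 := by
    calc _ ≤ _ := hcs
      _ ≤ A.card * (q ^ (2 * k) * A.card) := by gcongr
      _ = _ := by ring
  have hle := abs_le_of_sq_le_sq' hcs2 (by positivity)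
  have hval : ∑ x ∈ A, G (x, 1) = q * ∑ x ∈ A, ∑ x' ∈ A, (if qf (x - x') = 0 then (1 : ℝ) else 0) - (A.card : ℝ) ^ 2 := by
    have : ∀ x ∈ A, G (x, 1) = q * ∑ x' ∈ A, (if qf (x - x') = 0 then (1 : ℝ) else 0) - A.card := by
      intro x hx
      simp only [hG, hr]
      rw [Finset.sum_sub_distrib, Finset.mul_sum]
      simp only [Finset.sum_const, nsmul_eq_mul, mul_one]
      congr 1
      refine Finset.sum_congr rfl fun x' hx' => ?_
      have e : qf (x - x') = -2 * (x' ⬝ᵥ x - t) := by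
        rw [qf_sub, hA x hx, hA x' hx', dotProduct_comm x x']; ring
      rw [e]
      simp [h2, hq]
    rw [Finset.sum_congr rfl this, Finset.sum_sub_distrib, ← Finset.mul_sum]
    simp [sq]
  linarith [hle.2]
end iso
end PD


namespace PD
open Finset
set_option linter.unusedSectionVars false

section facts
variable {K : Type} [Field K] [Fintype K] [DecidableEq K]
variable {ι : Type} [Fintype ι] [DecidableEq ι]

noncomputable def ind (p : Prop) [Decidable p] : ℝ := if p then 1 else 0

lemma ind_nonneg (p : Prop) [Decidable p] : 0 ≤ ind p := by unfold ind; split_ifs <;> norm_num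
lemma ind_le_one (p : Prop) [Decidable p] : ind p ≤ 1 := by unfold ind; split_ifs <;> norm_num
lemma ind_true {p : Prop} [Decidable p] (h : p) : ind p = 1 := by simp [ind, h]
lemma ind_false {p : Prop} [Decidable p] (h : ¬ p) : ind p = 0 := by simp [ind, h]
lemma ind_congr {p r : Prop} [Decidable p] [Decidable r] (h : p ↔ r) : ind p = ind r := by
  unfold ind; simp [h]
lemma ind_mono {p r : Prop} [Decidable p] [Decidable r] (h : p → r) : ind p ≤ ind r := by
  by_cases hp : p
  · rw [ind_true hp, ind_true (h hp)]
  · rw [ind_false hp]; exact ind_nonneg _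

lemma sum_ind {α : Type} (s : Finset α) (p : α → Prop) [DecidablePred p] :
    ∑ x ∈ s, ind (p x) = ((s.filter p).card : ℝ) := by
  simp [ind]

/-- the field size as a real number -/
noncomputable def qq (K : Type) [Fintype K] : ℝ := (Fintype.card K : ℝ)

lemma qq_gt_one : 1 < qq K := by
  unfold qq; exact_mod_cast Fintype.one_lt_card (α := K)

lemma qq_pos : 0 < qq K := lt_trans one_pos qq_gt_one

lemma card_V : ((Fintype.card (ι → K) : ℕ) : ℝ) = qq K ^ (Fintype.card ι) := by
  simp [qq]

lemma hyper_card {u : ι → K} (hu : u ≠ 0) (c : K) :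
    ∑ y : ι → K, ind (u ⬝ᵥ y = c) = qq K ^ (Fintype.card ι) / qq K := by
  obtain ⟨i, hi⟩ := Function.ne_iff.1 hu
  have hi : u i ≠ 0 := by simpa using hi
  have hshift : ∀ c : K, ∑ y : ι → K, ind (u ⬝ᵥ y = c) = ∑ y : ι → K, ind (u ⬝ᵥ y = 0) := by
    intro c
    refine Fintype.sum_equiv (Equiv.addRight (-(Pi.single i (c / u i)))) _ _ fun y => ?_
    apply ind_congr
    simp only [Equiv.coe_addRight, dotProduct_add, dotProduct_neg, dotProduct_single]
    rw [mul_div_cancel₀ _ hi, ← sub_eq_add_neg, sub_eq_zero]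
  have htot : ∑ c : K, ∑ y : ι → K, ind (u ⬝ᵥ y = c) = qq K ^ (Fintype.card ι) := by
    rw [Finset.sum_comm, ← card_V]
    simp [ind]
  rw [Finset.sum_congr rfl (fun c _ => hshift c)] at htot
  simp only [Finset.sum_const, Finset.card_univ, nsmul_eq_mul] at htot
  rw [hshift c, ← htot]
  have := qq_pos (K := K)
  unfold qq at *
  field_simp

lemma dist_iff (hK : ringChar K ≠ 2) (x x' y : ι → K) :
    qf (x - y) = qf (x' - y) ↔ (x - x') ⬝ᵥ y = (qf x - qf x') / 2 := by
  have h2 := two_ne hK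
  rw [qf_sub, qf_sub, sub_dotProduct, eq_div_iff h2]
  constructor <;> intro h <;> linear_combination -h

lemma pair_card (hK : ringChar K ≠ 2) (x x' : ι → K) :
    ∑ y : ι → K, ind (qf (x - y) = qf (x' - y)) =
      if x = x' then qq K ^ (Fintype.card ι) else qq K ^ (Fintype.card ι) / qq K := by
  split_ifs with h
  · subst h; rw [← card_V]; simp [ind]
  · rw [← hyper_card (sub_ne_zero.2 h) ((qf x - qf x') / 2)]
    exact Finset.sum_congr rfl fun y _ => ind_congr (dist_iff hK x x' y)

noncomputable def nu (E : Finset (ι → K)) (y : ι → K) (t : K) : ℝ := ∑ x ∈ E, ind (qf (x - y) = t)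

noncomputable def SS (E : Finset (ι → K)) (y : ι → K) : ℝ :=
  ∑ x ∈ E, ∑ x' ∈ E, ind (qf (x - y) = qf (x' - y))

lemma nu_nonneg (E : Finset (ι → K)) (y : ι → K) (t : K) : 0 ≤ nu E y t :=
  Finset.sum_nonneg fun _ _ => ind_nonneg _

lemma nu_card (E : Finset (ι → K)) (y : ι → K) (t : K) :
    nu E y t = ((E.filter (fun x => qf (x - y) = t)).card : ℝ) := sum_ind _ _

lemma nu_sum (E : Finset (ι → K)) (y : ι → K) : ∑ t, nu E y t = E.card := by
  unfold nu; rw [Finset.sum_comm]; simp [ind]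

/-- fibering pairs over the common value -/
lemma pair_fiber (E : Finset (ι → K)) (y : ι → K) (g : (ι → K) → (ι → K) → ℝ) :
    ∑ x ∈ E, ∑ x' ∈ E, ind (qf (x - y) = qf (x' - y)) * g x x' =
      ∑ t, ∑ x ∈ E.filter (fun x => qf (x - y) = t), ∑ x' ∈ E.filter (fun x => qf (x - y) = t), g x x' := by
  rw [← Finset.sum_fiberwise E (fun x => qf (x - y))]
  refine Finset.sum_congr rfl fun t _ => Finset.sum_congr rfl fun x hx => ?_
  rw [Finset.sum_filter]
  refine Finset.sum_congr rfl fun x' _ => ?_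
  rw [(Finset.mem_filter.1 hx).2]
  by_cases h : qf (x' - y) = t
  · rw [if_pos h, ind_true h.symm, one_mul]
  · rw [if_neg h, ind_false (fun h' => h h'.symm), zero_mul]

lemma SS_eq (E : Finset (ι → K)) (y : ι → K) : SS E y = ∑ t, nu E y t ^ 2 := by
  have := pair_fiber E y (fun _ _ => 1)
  simp only [mul_one] at this
  rw [SS, this]
  refine Finset.sum_congr rfl fun t _ => ?_
  rw [nu_card]; simp [sq]

lemma var_eq (E : Finset (ι → K)) (y : ι → K) :
    ∑ t, (nu E y t - E.card / qq K) ^ 2 = SS E y - (E.card : ℝ) ^ 2 / qq K := by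
  have hq := qq_pos (K := K)
  have : ∀ t, (nu E y t - E.card / qq K) ^ 2 = nu E y t ^ 2 - 2 * (E.card / qq K) * nu E y t + (E.card / qq K) ^ 2 := by
    intro t; ring
  rw [Finset.sum_congr rfl (fun t _ => this t), Finset.sum_add_distrib, Finset.sum_sub_distrib, ← SS_eq,
    ← Finset.mul_sum, nu_sum]
  simp only [Finset.sum_const, Finset.card_univ, nsmul_eq_mul]
  change _ + qq K * _ = _
  field_simp
  ring

lemma SS_ge (E : Finset (ι → K)) (y : ι → K) : (E.card : ℝ) ^ 2 / qq K ≤ SS E y := by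
  have := var_eq E y
  have h2 : 0 ≤ ∑ t, (nu E y t - E.card / qq K) ^ 2 := Finset.sum_nonneg fun _ _ => sq_nonneg _
  linarith

lemma SS_total (hK : ringChar K ≠ 2) (E : Finset (ι → K)) :
    ∑ y, SS E y = E.card * qq K ^ (Fintype.card ι) + E.card * (E.card - 1) * (qq K ^ (Fintype.card ι) / qq K) := by
  unfold SS
  rw [Finset.sum_comm]
  have : ∀ x ∈ E, ∑ y : ι → K, ∑ x' ∈ E, ind (qf (x - y) = qf (x' - y)) =
      qq K ^ (Fintype.card ι) + (E.card - 1) * (qq K ^ (Fintype.card ι) / qq K) := by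
    intro x hx
    rw [Finset.sum_comm, Finset.sum_congr rfl (fun x' _ => pair_card hK x x'),
      ← Finset.add_sum_erase E _ hx, if_pos rfl]
    congr 1
    rw [Finset.sum_congr rfl (fun x' hx' => if_neg (Finset.mem_erase.1 hx').1.symm)]
    rw [Finset.sum_const, Finset.card_erase_of_mem hx, nsmul_eq_mul, Nat.cast_sub (Finset.card_pos.2 ⟨x, hx⟩)]
    simp
  rw [Finset.sum_congr rfl this, Finset.sum_const, nsmul_eq_mul]; ring

lemma SS_sum_le (hK : ringChar K ≠ 2) (E : Finset (ι → K)) :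
    ∑ y ∈ E, SS E y ≤ (E.card : ℝ) ^ 3 / qq K + E.card * (qq K ^ (Fintype.card ι) - qq K ^ (Fintype.card ι) / qq K) := by
  have hq := qq_pos (K := K)
  have h1 := SS_total hK E
  have h2 : ∑ y ∈ E, (SS E y - (E.card : ℝ) ^ 2 / qq K) ≤ ∑ y, (SS E y - (E.card : ℝ) ^ 2 / qq K) :=
    Finset.sum_le_univ_sum_of_nonneg fun y => sub_nonneg.2 (SS_ge E y)
  rw [Finset.sum_sub_distrib, Finset.sum_sub_distrib, h1] at h2
  simp only [Finset.sum_const, nsmul_eq_mul, Finset.card_univ, card_V] at h2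
  have : (E.card : ℝ) ^ 3 / qq K = E.card * ((E.card : ℝ) ^ 2 / qq K) := by ring
  rw [this]
  have e : qq K ^ Fintype.card ι * ((E.card : ℝ) ^ 2 / qq K) = (E.card : ℝ) ^ 2 * (qq K ^ Fintype.card ι / qq K) := by ring
  rw [e] at h2
  linarith

/-- every point of `E` is bad -/
def AllBad (E : Finset (ι → K)) : Prop :=
  ∀ y ∈ E, 2 * (E.image (fun x => qf (x - y))).card ≤ Fintype.card K

lemma nu_supp (E : Finset (ι → K)) (y : ι → K) (t : K) (h : t ∉ E.image (fun x => qf (x - y))) : nu E y t = 0 := by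
  unfold nu
  refine Finset.sum_eq_zero fun x hx => ind_false fun hh => h ?_
  rw [← hh]; exact Finset.mem_image_of_mem _ hx

lemma bad_sum (E : Finset (ι → K)) (hE : AllBad E) (y : ι → K) (hy : y ∈ E) :
    2 * ((E.card : ℝ) - nu E y 0) ^ 2 ≤ qq K * ∑ t ∈ univ.erase (0 : K), nu E y t ^ 2 := by
  set D := E.image (fun x => qf (x - y)) with hD
  have h1 : (E.card : ℝ) - nu E y 0 = ∑ t ∈ D.erase 0, nu E y t := by
    rw [← nu_sum E y, ← Finset.add_sum_erase univ _ (Finset.mem_univ (0 : K)), add_sub_cancel_left]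
    symm
    apply Finset.sum_subset
    · exact Finset.erase_subset_erase _ (Finset.subset_univ _)
    · intro t ht ht'
      apply nu_supp
      intro h
      exact ht' (Finset.mem_erase.2 ⟨(Finset.mem_erase.1 ht).1, h⟩)
  have h2 : (∑ t ∈ D.erase 0, nu E y t) ^ 2 ≤ (D.erase 0).card * ∑ t ∈ D.erase 0, nu E y t ^ 2 :=
    sq_sum_le_card_mul_sum_sq
  have h3 : ∑ t ∈ D.erase 0, nu E y t ^ 2 ≤ ∑ t ∈ univ.erase (0 : K), nu E y t ^ 2 := by
    apply Finset.sum_le_sum_of_subset_of_nonneg (Finset.erase_subset_erase _ (Finset.subset_univ _))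
    intros; positivity
  have h4 : 2 * ((D.erase 0).card : ℝ) ≤ qq K := by
    have := hE y hy
    rw [← hD] at this
    have h5 : (D.erase 0).card ≤ D.card := Finset.card_erase_le
    unfold qq
    exact_mod_cast (by omega : 2 * (D.erase 0).card ≤ Fintype.card K)
  have h6 : 0 ≤ ∑ t ∈ D.erase 0, nu E y t ^ 2 := Finset.sum_nonneg fun _ _ => sq_nonneg _
  rw [h1]
  calc _ ≤ 2 * ((D.erase 0).card * ∑ t ∈ D.erase 0, nu E y t ^ 2) := by linarith
    _ = (2 * (D.erase 0).card) * ∑ t ∈ D.erase 0, nu E y t ^ 2 := by ring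
    _ ≤ qq K * ∑ t ∈ D.erase 0, nu E y t ^ 2 := by gcongr
    _ ≤ _ := by have := qq_pos (K := K); gcongr

lemma bad_SS (E : Finset (ι → K)) (hE : AllBad E) (y : ι → K) (hy : y ∈ E) :
    2 * (E.card : ℝ) ^ 2 / qq K ≤ SS E y := by
  set D := E.image (fun x => qf (x - y)) with hD
  have h1 : (E.card : ℝ) = ∑ t ∈ D, nu E y t := by
    rw [← nu_sum E y]
    symm
    apply Finset.sum_subset (Finset.subset_univ _)
    intro t _ ht'
    exact nu_supp _ _ _ ht'
  have h2 : (∑ t ∈ D, nu E y t) ^ 2 ≤ D.card * ∑ t ∈ D, nu E y t ^ 2 :=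
    sq_sum_le_card_mul_sum_sq
  have h3 : ∑ t ∈ D, nu E y t ^ 2 ≤ SS E y := by
    rw [SS_eq]
    apply Finset.sum_le_sum_of_subset_of_nonneg (Finset.subset_univ _)
    intros; positivity
  have h4 : 2 * (D.card : ℝ) ≤ qq K := by
    unfold qq
    exact_mod_cast hE y hy
  have h6 : 0 ≤ ∑ t ∈ D, nu E y t ^ 2 := Finset.sum_nonneg fun _ _ => sq_nonneg _
  have hq := qq_pos (K := K)
  rw [div_le_iff₀ hq, h1]
  calc _ ≤ 2 * (D.card * ∑ t ∈ D, nu E y t ^ 2) := by linarith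
    _ = (2 * D.card) * ∑ t ∈ D, nu E y t ^ 2 := by ring
    _ ≤ qq K * ∑ t ∈ D, nu E y t ^ 2 := by gcongr
    _ ≤ SS E y * qq K := by rw [mul_comm]; gcongr

lemma card_upper (hK : ringChar K ≠ 2) (E : Finset (ι → K)) (hE : AllBad E) :
    (E.card : ℝ) ^ 2 ≤ qq K ^ (Fintype.card ι) * (qq K - 1) := by
  have hq := qq_pos (K := K)
  by_cases h0 : E.card = 0
  · rw [h0]; have := qq_gt_one (K := K)
    have : 0 ≤ qq K ^ (Fintype.card ι) * (qq K - 1) := mul_nonneg (by positivity) (by linarith)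
    simpa using this
  have hn : (0 : ℝ) < E.card := by exact_mod_cast Nat.pos_of_ne_zero h0
  have h1 := SS_sum_le hK E
  have h2 : ∑ y ∈ E, 2 * (E.card : ℝ) ^ 2 / qq K ≤ ∑ y ∈ E, SS E y := Finset.sum_le_sum fun y hy => bad_SS E hE y hy
  rw [Finset.sum_const, nsmul_eq_mul] at h2
  have h3 := h2.trans h1
  have h4 : (E.card : ℝ) * ((E.card : ℝ) ^ 2 / qq K) ≤ E.card * (qq K ^ (Fintype.card ι) - qq K ^ (Fintype.card ι) / qq K) := by
    have e1 : (E.card : ℝ) * (2 * (E.card : ℝ) ^ 2 / qq K) = 2 * ((E.card : ℝ) * ((E.card : ℝ) ^ 2 / qq K)) := by ring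
    have e2 : (E.card : ℝ) ^ 3 / qq K = (E.card : ℝ) * ((E.card : ℝ) ^ 2 / qq K) := by ring
    rw [e1, e2] at h3; linarith
  have h5 := le_of_mul_le_mul_left h4 hn
  rw [div_le_iff₀ hq] at h5
  calc _ ≤ _ := h5
    _ = _ := by field_simp

lemma nu_zero_sum (hK : ringChar K ≠ 2) (k : ℕ) (hk : Fintype.card ι = 2 * k) (E : Finset (ι → K)) :
    ∑ y ∈ E, nu E y 0 ≤ (E.card : ℝ) ^ 2 / qq K + E.card * qq K ^ k := by
  have hq := qq_pos (K := K)
  have h1 : ∑ y ∈ E, (nu E y 0 - E.card / qq K) ^ 2 ≤ E.card * qq K ^ (2 * k) := by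
    have e1 : ∑ y ∈ E, (nu E y 0 - E.card / qq K) ^ 2 ≤ ∑ y : ι → K, (SS E y - (E.card : ℝ) ^ 2 / qq K) := by
      calc _ ≤ ∑ y : ι → K, (nu E y 0 - E.card / qq K) ^ 2 :=
            Finset.sum_le_univ_sum_of_nonneg fun y => sq_nonneg _
        _ ≤ _ := by
            refine Finset.sum_le_sum fun y _ => ?_
            rw [← var_eq]
            exact Finset.single_le_sum (f := fun t => (nu E y t - E.card / qq K) ^ 2) (fun t _ => sq_nonneg _) (Finset.mem_univ 0)
    rw [Finset.sum_sub_distrib, SS_total hK E] at e1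
    simp only [Finset.sum_const, nsmul_eq_mul, Finset.card_univ, card_V] at e1
    rw [hk] at e1
    have : 0 ≤ E.card * (qq K ^ (2 * k) / qq K) := by positivity
    have e : qq K ^ (2 * k) * ((E.card : ℝ) ^ 2 / qq K) = (E.card : ℝ) ^ 2 * (qq K ^ (2 * k) / qq K) := by ring
    rw [e] at e1
    linarith
  have h2 : (∑ y ∈ E, (nu E y 0 - E.card / qq K)) ^ 2 ≤ E.card * ∑ y ∈ E, (nu E y 0 - E.card / qq K) ^ 2 :=
    sq_sum_le_card_mul_sum_sq
  have h3 : (∑ y ∈ E, (nu E y 0 - E.card / qq K)) ^ 2 ≤ (E.card * qq K ^ k) ^ 2 := by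
    calc _ ≤ _ := h2
      _ ≤ E.card * (E.card * qq K ^ (2 * k)) := by gcongr
      _ = _ := by ring
  have h4 := (abs_le_of_sq_le_sq' h3 (by positivity)).2
  rw [Finset.sum_sub_distrib, Finset.sum_const, nsmul_eq_mul] at h4
  have : (E.card : ℝ) ^ 2 / qq K = E.card * (E.card / qq K) := by ring
  rw [this]; linarith

noncomputable def T1 (E : Finset (ι → K)) : ℝ :=
  ∑ y ∈ E, ∑ x ∈ E, ∑ x' ∈ E, ind (qf (x - y) = qf (x' - y)) * ind (qf (x - x') ≠ 0)

lemma iso_bound' (hK : ringChar K ≠ 2) (k : ℕ) (hk : Fintype.card ι = 2 * k) {t : K} (ht : t ≠ 0)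
    (y : ι → K) (E : Finset (ι → K)) :
    nu E y t ^ 2 - nu E y t ^ 2 / qq K - qq K ^ k / qq K * nu E y t ≤
    ∑ x ∈ E.filter (fun x => qf (x - y) = t), ∑ x' ∈ E.filter (fun x => qf (x - y) = t), ind (qf (x - x') ≠ 0) := by
  have hq := qq_pos (K := K)
  set A := E.filter (fun x => qf (x - y) = t) with hA
  have h := iso_bound hK k hk ht (A.image (fun x => x - y)) (by
    intro x hx
    obtain ⟨z, hz, rfl⟩ := Finset.mem_image.1 hx
    exact (Finset.mem_filter.1 hz).2)
  have hinj : Set.InjOn (fun x : ι → K => x - y) A := fun a _ b _ h => sub_left_injective h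
  rw [Finset.card_image_of_injOn hinj, Finset.sum_image hinj] at h
  simp only [Finset.sum_image hinj, sub_sub_sub_cancel_right] at h
  change qq K * _ ≤ _ + qq K ^ k * _ at h
  have e : ∀ x x' : ι → K, ind (qf (x - x') ≠ 0) = 1 - (if qf (x - x') = 0 then (1 : ℝ) else 0) := by
    intro x x'; unfold ind; by_cases h : qf (x - x') = 0 <;> simp [h]
  simp only [e, Finset.sum_sub_distrib, Finset.sum_const, nsmul_eq_mul, mul_one]
  rw [nu_card, ← hA]
  set I := ∑ x ∈ A, ∑ x' ∈ A, (if qf (x - x') = 0 then (1 : ℝ) else 0)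
  have h2 : I ≤ ((A.card : ℝ) ^ 2 + qq K ^ k * A.card) / qq K := by
    rw [le_div_iff₀ hq]; linarith
  have e3 : ((A.card : ℝ) ^ 2 + qq K ^ k * A.card) / qq K = (A.card : ℝ) ^ 2 / qq K + qq K ^ k / qq K * A.card := by ring
  rw [e3] at h2
  linarith [sq (A.card : ℝ)]

/-- Stage A -/
lemma stageA (hK : ringChar K ≠ 2) (k : ℕ) (hk : Fintype.card ι = 2 * k) (E : Finset (ι → K)) (hE : AllBad E)
    (hn : qq K * qq K ^ (2 * k) ≤ 2 * (E.card : ℝ) ^ 2) (e1 : ℝ) (he0 : 0 < e1) (he1 : e1 ≤ 1)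
    (hq1 : 289 ≤ qq K * e1 ^ 2) :
    (2 - e1) * (E.card : ℝ) ^ 3 / qq K ≤ T1 E := by
  have hq := qq_pos (K := K)
  set n : ℝ := (E.card : ℝ) with hnd
  have hn0 : 0 ≤ n := by positivity
  set X : ℝ := ∑ y ∈ E, ∑ t ∈ univ.erase (0 : K), nu E y t ^ 2 with hX
  have hT : X - X / qq K - qq K ^ k / qq K * n ^ 2 ≤ T1 E := by
    have : ∀ y ∈ E, ∑ t ∈ univ.erase (0 : K), (nu E y t ^ 2 - nu E y t ^ 2 / qq K - qq K ^ k / qq K * nu E y t) ≤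
        ∑ x ∈ E, ∑ x' ∈ E, ind (qf (x - y) = qf (x' - y)) * ind (qf (x - x') ≠ 0) := by
      intro y _
      rw [pair_fiber]
      refine (Finset.sum_le_sum fun t ht => iso_bound' hK k hk (Finset.mem_erase.1 ht).1 y E).trans ?_
      apply Finset.sum_le_sum_of_subset_of_nonneg (Finset.erase_subset _ _)
      intros
      exact Finset.sum_nonneg fun _ _ => Finset.sum_nonneg fun _ _ => ind_nonneg _
    refine le_trans ?_ (Finset.sum_le_sum this)
    simp only [Finset.sum_sub_distrib, ← Finset.mul_sum, ← Finset.sum_div]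
    rw [← hX]
    have h3 : ∑ y ∈ E, ∑ t ∈ univ.erase (0 : K), nu E y t ≤ n ^ 2 := by
      have : ∀ y ∈ E, ∑ t ∈ univ.erase (0 : K), nu E y t ≤ n := by
        intro y _
        rw [hnd, ← nu_sum E y]
        exact Finset.sum_le_sum_of_subset_of_nonneg (Finset.erase_subset _ _) fun t _ _ => nu_nonneg _ _ _
      refine (Finset.sum_le_sum this).trans (le_of_eq ?_)
      rw [Finset.sum_const, nsmul_eq_mul, ← hnd]; ring
    have h4 : qq K ^ k / qq K * ∑ y ∈ E, ∑ t ∈ univ.erase (0 : K), nu E y t ≤ qq K ^ k / qq K * n ^ 2 := by gcongr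
    linarith
  have hXlow : 2 * n ^ 3 - 4 * n * (n ^ 2 / qq K + n * qq K ^ k) ≤ qq K * X := by
    rw [hX, Finset.mul_sum]
    have : ∀ y ∈ E, 2 * n ^ 2 - 4 * n * nu E y 0 ≤ qq K * ∑ t ∈ univ.erase (0 : K), nu E y t ^ 2 := by
      intro y hy
      refine le_trans ?_ (bad_sum E hE y hy)
      rw [← hnd]
      nlinarith [sq_nonneg (nu E y 0)]
    refine le_trans ?_ (Finset.sum_le_sum this)
    rw [Finset.sum_sub_distrib, Finset.sum_const, nsmul_eq_mul, ← Finset.mul_sum]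
    have h5 := nu_zero_sum hK k hk E
    have : 4 * n * ∑ y ∈ E, nu E y 0 ≤ 4 * n * (n ^ 2 / qq K + n * qq K ^ k) := by gcongr
    rw [← hnd]
    nlinarith
  have hQD : qq K ^ (2 * k) ≤ 2 * n ^ 2 / qq K := by
    rw [le_div_iff₀ hq]; linarith
  have hXup : X ≤ 3 * n ^ 3 / qq K := by
    have h6 := SS_sum_le hK E
    have h7 : X ≤ ∑ y ∈ E, SS E y := by
      rw [hX]
      refine Finset.sum_le_sum fun y _ => ?_
      rw [SS_eq]
      exact Finset.sum_le_sum_of_subset_of_nonneg (Finset.erase_subset _ _) fun t _ _ => sq_nonneg _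
    rw [hk, ← hnd] at h6
    have h8 : 0 ≤ n * (qq K ^ (2 * k) / qq K) := by positivity
    have h9 : n * qq K ^ (2 * k) ≤ n * (2 * n ^ 2 / qq K) := by gcongr
    have h10 : n * (2 * n ^ 2 / qq K) + n ^ 3 / qq K = 3 * n ^ 3 / qq K := by ring
    nlinarith
  have hqk : qq K ^ k ≤ 2 / 17 * e1 * n := by
    apply abs_le_of_sq_le_sq' _ (by positivity) |>.2
    have : (qq K ^ k) ^ 2 = qq K ^ (2 * k) := by ring
    rw [this]
    refine hQD.trans ?_
    rw [div_le_iff₀ hq]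
    nlinarith [mul_le_mul_of_nonneg_right hq1 (sq_nonneg n)]
  -- combine: multiply by q
  have hq289 : 289 ≤ qq K * e1 := by nlinarith
  have hinv : n ^ 3 / qq K ≤ e1 / 289 * n ^ 3 := by
    rw [div_le_iff₀ hq]
    have : 0 ≤ n ^ 3 := by positivity
    nlinarith
  have hfin : (2 - e1) * n ^ 3 ≤ qq K * (X - X / qq K - qq K ^ k / qq K * n ^ 2) := by
    have e : qq K * (X - X / qq K - qq K ^ k / qq K * n ^ 2) = qq K * X - X - qq K ^ k * n ^ 2 := by
      field_simp
    rw [e]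
    have a1 : 4 * n * (n ^ 2 / qq K) = 4 * (n ^ 3 / qq K) := by ring
    have a2 : 3 * n ^ 3 / qq K = 3 * (n ^ 3 / qq K) := by ring
    have a3 : qq K ^ k * n ^ 2 ≤ 2 / 17 * e1 * n * n ^ 2 := by gcongr
    rw [a2] at hXup
    have a4 : 4 * n * (n ^ 2 / qq K + n * qq K ^ k) = 4 * (n ^ 3 / qq K) + 4 * (qq K ^ k * n ^ 2) := by ring
    rw [a4] at hXlow
    have a5 : 2 / 17 * e1 * n * n ^ 2 = 2 / 17 * (e1 * n ^ 3) := by ring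
    have a6 : e1 / 289 * n ^ 3 = 1 / 289 * (e1 * n ^ 3) := by ring
    have a7 : 0 ≤ e1 * n ^ 3 := by positivity
    nlinarith
  refine le_trans ?_ hT
  rw [div_le_iff₀ hq]
  linarith
end facts
end PD


namespace PD
open Finset
set_option linter.unusedSectionVars false

section stageB
variable {K : Type} [Field K] [Fintype K] [DecidableEq K]
variable {ι : Type} [Fintype ι] [DecidableEq ι]

noncomputable def ff (E : Finset (ι → K)) (v : ι → K) (c : K) : ℝ := ∑ y ∈ E, ind (v ⬝ᵥ y = c)

def rfl' (v : ι → K) (c : K) (z : ι → K) : ι → K := z - (2 * (v ⬝ᵥ z - c) / qf v) • v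

noncomputable def mm (E : Finset (ι → K)) (v : ι → K) (c : K) : ℝ :=
  ∑ x ∈ E, ind (v ⬝ᵥ x ≠ c ∧ rfl' v c x ∈ E)

lemma ind_mul (p : Prop) [Decidable p] (a : ℝ) : ind p * a = if p then a else 0 := by
  unfold ind; split_ifs <;> simp

lemma qf_rfl (v : ι → K) (hv : qf v ≠ 0) (c : K) (z : ι → K) :
    qf z - qf (rfl' v c z) = 2 * (2 * (v ⬝ᵥ z - c) / qf v) * c := by
  rw [rfl', qf_sub, dotProduct_smul, qf_smul, dotProduct_comm z v]
  simp only [smul_eq_mul]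
  field_simp
  ring

lemma transfer (hK : ringChar K ≠ 2) (E : Finset (ι → K)) (F : (ι → K) → K → (ι → K) → ℝ) :
    ∑ v ∈ univ.filter (fun v : ι → K => qf v ≠ 0), ∑ c : K, ∑ x ∈ E,
      ind (v ⬝ᵥ x ≠ c ∧ rfl' v c x ∈ E) * F v c x =
    ∑ x ∈ E, ∑ x' ∈ E, ind (qf (x - x') ≠ 0) * ∑ l ∈ univ.erase (0 : K),
      F (l • (x - x')) (l * ((qf x - qf x') / 2)) x := by
  have h2 := two_ne hK
  have hL : ∑ v ∈ univ.filter (fun v : ι → K => qf v ≠ 0), ∑ c : K, ∑ x ∈ E,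
      ind (v ⬝ᵥ x ≠ c ∧ rfl' v c x ∈ E) * F v c x =
      ∑ p ∈ (univ.filter (fun v : ι → K => qf v ≠ 0) ×ˢ (univ : Finset K) ×ˢ E).filter
        (fun p => p.1 ⬝ᵥ p.2.2 ≠ p.2.1 ∧ rfl' p.1 p.2.1 p.2.2 ∈ E), F p.1 p.2.1 p.2.2 := by
    rw [Finset.sum_filter (s := (univ.filter (fun v : ι → K => qf v ≠ 0) ×ˢ (univ : Finset K) ×ˢ E)), Finset.sum_product]
    refine Finset.sum_congr rfl fun v _ => ?_
    rw [Finset.sum_product]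
    simp only [ind_mul]
  have hR : ∑ x ∈ E, ∑ x' ∈ E, ind (qf (x - x') ≠ 0) * ∑ l ∈ univ.erase (0 : K),
      F (l • (x - x')) (l * ((qf x - qf x') / 2)) x =
      ∑ p ∈ (E ×ˢ E ×ˢ univ.erase (0 : K)).filter (fun p => qf (p.1 - p.2.1) ≠ 0),
        F (p.2.2 • (p.1 - p.2.1)) (p.2.2 * ((qf p.1 - qf p.2.1) / 2)) p.1 := by
    rw [Finset.sum_filter, Finset.sum_product]
    refine Finset.sum_congr rfl fun v _ => ?_
    rw [Finset.sum_product]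
    refine Finset.sum_congr rfl fun v _ => ?_
    rw [ind_mul]
    split_ifs <;> simp
  rw [hL, hR]
  refine Finset.sum_bij' (fun p _ => (p.2.2, rfl' p.1 p.2.1 p.2.2, (2 * (p.1 ⬝ᵥ p.2.2 - p.2.1) / qf p.1)⁻¹))
    (fun p _ => (p.2.2 • (p.1 - p.2.1), p.2.2 * ((qf p.1 - qf p.2.1) / 2), p.1)) ?_ ?_ ?_ ?_ ?_
  · rintro ⟨v, c, x⟩ hp
    simp only [Finset.mem_filter, Finset.mem_product, Finset.mem_univ, true_and] at hp
    obtain ⟨⟨hv, hx⟩, hne, hE⟩ := hp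
    have hmu : 2 * (v ⬝ᵥ x - c) / qf v ≠ 0 := div_ne_zero (mul_ne_zero h2 (sub_ne_zero.2 hne)) hv
    simp only [Finset.mem_filter, Finset.mem_product, Finset.mem_erase, Finset.mem_univ, and_true]
    refine ⟨⟨hx, hE, inv_ne_zero hmu⟩, ?_⟩
    rw [rfl', sub_sub_cancel, qf_smul]
    exact mul_ne_zero (pow_ne_zero 2 hmu) hv
  · rintro ⟨x, x', l⟩ hp
    simp only [Finset.mem_filter, Finset.mem_product, Finset.mem_erase, Finset.mem_univ, and_true] at hp
    obtain ⟨⟨hx, hx', hl⟩, hq⟩ := hp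
    simp only [Finset.mem_filter, Finset.mem_product, Finset.mem_univ, true_and]
    have key : (l • (x - x')) ⬝ᵥ x - l * ((qf x - qf x') / 2) = l * qf (x - x') / 2 := by
      rw [smul_dotProduct, sub_dotProduct, qf_sub, smul_eq_mul, dotProduct_comm x' x]
      change l * (qf x - _) - _ = _
      field_simp; ring
    refine ⟨⟨?_, hx⟩, ?_, ?_⟩
    · rw [qf_smul]; exact mul_ne_zero (pow_ne_zero 2 hl) hq
    · rw [← sub_ne_zero, key]
      exact div_ne_zero (mul_ne_zero hl hq) h2
    · rw [rfl', key, qf_smul, smul_smul]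
      have : 2 * (l * qf (x - x') / 2) / (l ^ 2 * qf (x - x')) * l = 1 := by field_simp
      rw [this, one_smul, sub_sub_cancel]; exact hx'
  · rintro ⟨v, c, x⟩ hp
    simp only [Finset.mem_filter, Finset.mem_product, Finset.mem_univ, true_and] at hp
    obtain ⟨⟨hv, hx⟩, hne, hE⟩ := hp
    have hmu : 2 * (v ⬝ᵥ x - c) / qf v ≠ 0 := div_ne_zero (mul_ne_zero h2 (sub_ne_zero.2 hne)) hv
    simp only [Prod.mk.injEq, and_true]
    constructor
    · rw [rfl', sub_sub_cancel, smul_smul, inv_mul_cancel₀ hmu, one_smul]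
    · rw [qf_rfl v hv]
      field_simp
  · rintro ⟨x, x', l⟩ hp
    simp only [Finset.mem_filter, Finset.mem_product, Finset.mem_erase, Finset.mem_univ, and_true] at hp
    obtain ⟨⟨hx, hx', hl⟩, hq⟩ := hp
    have key : (l • (x - x')) ⬝ᵥ x - l * ((qf x - qf x') / 2) = l * qf (x - x') / 2 := by
      rw [smul_dotProduct, sub_dotProduct, qf_sub, smul_eq_mul, dotProduct_comm x' x]
      change l * (qf x - _) - _ = _
      field_simp; ring
    simp only [Prod.mk.injEq, true_and]
    have e : 2 * (l * qf (x - x') / 2) / (l ^ 2 * qf (x - x')) = l⁻¹ := by field_simp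
    constructor
    · rw [rfl', key, qf_smul, smul_smul, e, inv_mul_cancel₀ hl, one_smul, sub_sub_cancel]
    · rw [key, qf_smul, e, inv_inv]
  · rintro ⟨v, c, x⟩ hp
    simp only [Finset.mem_filter, Finset.mem_product, Finset.mem_univ, true_and] at hp
    obtain ⟨⟨hv, hx⟩, hne, hE⟩ := hp
    have hmu : 2 * (v ⬝ᵥ x - c) / qf v ≠ 0 := div_ne_zero (mul_ne_zero h2 (sub_ne_zero.2 hne)) hv
    congr 1
    · simp only []
      rw [rfl', sub_sub_cancel, smul_smul, inv_mul_cancel₀ hmu, one_smul]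
    · rw [qf_rfl v hv]
      field_simp

lemma mm_nonneg (E : Finset (ι → K)) (v : ι → K) (c : K) : 0 ≤ mm E v c :=
  Finset.sum_nonneg fun _ _ => ind_nonneg _

lemma mm_le (E : Finset (ι → K)) (v : ι → K) (c : K) : mm E v c ≤ E.card := by
  refine (Finset.sum_le_sum fun _ _ => ind_le_one _).trans ?_
  simp

lemma ff_nonneg (E : Finset (ι → K)) (v : ι → K) (c : K) : 0 ≤ ff E v c :=
  Finset.sum_nonneg fun _ _ => ind_nonneg _

/-- noniso directions -/
def Om (K : Type) [Field K] [Fintype K] [DecidableEq K] (ι : Type) [Fintype ι] [DecidableEq ι] :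
    Finset (ι → K) := univ.filter (fun v : ι → K => qf v ≠ 0)

lemma transfer2 (hK : ringChar K ≠ 2) (E : Finset (ι → K)) (G : (ι → K) → K → ℝ) :
    ∑ v ∈ Om K ι, ∑ c : K, mm E v c * G v c =
    ∑ x ∈ E, ∑ x' ∈ E, ind (qf (x - x') ≠ 0) * ∑ l ∈ univ.erase (0 : K),
      G (l • (x - x')) (l * ((qf x - qf x') / 2)) := by
  rw [← transfer hK E (fun v c _ => G v c)]
  unfold Om
  refine Finset.sum_congr rfl fun v _ => Finset.sum_congr rfl fun c _ => ?_
  rw [mm, Finset.sum_mul]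

lemma card_erase_K : ((univ.erase (0 : K)).card : ℝ) = qq K - 1 := by
  rw [Finset.card_erase_of_mem (Finset.mem_univ _), Finset.card_univ, Nat.cast_sub Fintype.card_pos]
  simp [qq]

/-- scale invariant version -/
lemma transfer3 (hK : ringChar K ≠ 2) (E : Finset (ι → K)) (G : (ι → K) → K → ℝ)
    (hG : ∀ (l : K), l ≠ 0 → ∀ v c, G (l • v) (l * c) = G v c) :
    ∑ v ∈ Om K ι, ∑ c : K, mm E v c * G v c =
    (qq K - 1) * ∑ x ∈ E, ∑ x' ∈ E, ind (qf (x - x') ≠ 0) * G (x - x') ((qf x - qf x') / 2) := by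
  rw [transfer2 hK, Finset.mul_sum]
  refine Finset.sum_congr rfl fun x _ => ?_
  rw [Finset.mul_sum]
  refine Finset.sum_congr rfl fun x' _ => ?_
  rw [Finset.sum_congr rfl (fun l hl => hG l (Finset.mem_erase.1 hl).1 _ _), Finset.sum_const, nsmul_eq_mul,
    card_erase_K]
  ring

lemma ff_scale (E : Finset (ι → K)) (l : K) (hl : l ≠ 0) (v : ι → K) (c : K) :
    ff E (l • v) (l * c) = ff E v c := by
  unfold ff
  refine Finset.sum_congr rfl fun y _ => ind_congr ?_
  rw [smul_dotProduct, smul_eq_mul]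
  exact mul_right_inj' hl

lemma rfl_scale (l : K) (hl : l ≠ 0) (v : ι → K) (c : K) (z : ι → K) :
    rfl' (l • v) (l * c) z = rfl' v c z := by
  unfold rfl'
  rw [smul_dotProduct, smul_eq_mul, qf_smul, smul_smul]
  congr 2
  by_cases h : qf v = 0
  · simp [h]
  · field_simp

lemma mm_scale (E : Finset (ι → K)) (l : K) (hl : l ≠ 0) (v : ι → K) (c : K) :
    mm E (l • v) (l * c) = mm E v c := by
  unfold mm
  refine Finset.sum_congr rfl fun y _ => ind_congr ?_
  rw [rfl_scale l hl, smul_dotProduct, smul_eq_mul, Ne, mul_right_inj' hl]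

lemma sum_mm (hK : ringChar K ≠ 2) (E : Finset (ι → K)) :
    ∑ v ∈ Om K ι, ∑ c : K, mm E v c ≤ (qq K - 1) * (E.card : ℝ) ^ 2 := by
  have h := transfer3 hK E (fun _ _ => 1) (by simp)
  simp only [mul_one] at h
  rw [h]
  have hq := qq_gt_one (K := K)
  apply mul_le_mul_of_nonneg_left _ (by linarith)
  refine (Finset.sum_le_sum fun _ _ => Finset.sum_le_sum fun _ _ => ind_le_one _).trans (le_of_eq ?_)
  simp [sq]

lemma sum_mm_ff (hK : ringChar K ≠ 2) (E : Finset (ι → K)) :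
    ∑ v ∈ Om K ι, ∑ c : K, mm E v c * ff E v c = (qq K - 1) * T1 E := by
  rw [transfer3 hK E (fun v c => ff E v c) (fun l hl v c => ff_scale E l hl v c), T1]
  congr 1
  symm
  rw [Finset.sum_comm]
  refine Finset.sum_congr rfl fun x _ => ?_
  rw [Finset.sum_comm]
  refine Finset.sum_congr rfl fun x' _ => ?_
  rw [ff, Finset.mul_sum]
  refine Finset.sum_congr rfl fun y _ => ?_
  rw [mul_comm]; congr 1
  exact ind_congr (dist_iff hK x x' y)

/-- Fact 2 -/
lemma fact2 (E : Finset (ι → K)) :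
    ∑ v ∈ univ.erase (0 : ι → K), ∑ c : K, (ff E v c - E.card / qq K) ^ 2 ≤
      (qq K - 1) * (qq K ^ (Fintype.card ι) / qq K) * E.card := by
  have hq := qq_gt_one (K := K)
  have hq0 := qq_pos (K := K)
  set n : ℝ := (E.card : ℝ) with hn
  set Q := qq K ^ (Fintype.card ι) with hQ
  have e1 : ∀ v : ι → K, ∑ c : K, (ff E v c - n / qq K) ^ 2 =
      (∑ x ∈ E, ∑ x' ∈ E, ind ((x - x') ⬝ᵥ v = 0)) - n ^ 2 / qq K := by
    intro v
    have a1 : ∑ c : K, ff E v c = n := by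
      unfold ff; rw [Finset.sum_comm]; simp [ind, hn]
    have a2 : ∑ c : K, ff E v c ^ 2 = ∑ x ∈ E, ∑ x' ∈ E, ind ((x - x') ⬝ᵥ v = 0) := by
      have b : ∀ c, ff E v c ^ 2 = ∑ x ∈ E, ∑ x' ∈ E, ind (v ⬝ᵥ x = c) * ind (v ⬝ᵥ x' = c) := by
        intro c; rw [ff, sq, Finset.sum_mul_sum]
      rw [Finset.sum_congr rfl (fun c _ => b c), Finset.sum_comm]
      refine Finset.sum_congr rfl fun x _ => ?_
      rw [Finset.sum_comm]
      refine Finset.sum_congr rfl fun x' _ => ?_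
      simp only [ind_mul]
      rw [Finset.sum_ite_eq, if_pos (Finset.mem_univ _)]
      apply ind_congr
      rw [sub_dotProduct, sub_eq_zero, dotProduct_comm x v, dotProduct_comm x' v]
      exact eq_comm
    have : ∀ c, (ff E v c - n / qq K) ^ 2 = ff E v c ^ 2 - 2 * (n / qq K) * ff E v c + (n / qq K) ^ 2 := by
      intro t; ring
    rw [Finset.sum_congr rfl (fun t _ => this t), Finset.sum_add_distrib, Finset.sum_sub_distrib, a2,
      ← Finset.mul_sum, a1]
    simp only [Finset.sum_const, Finset.card_univ, nsmul_eq_mul]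
    change _ + qq K * _ = _
    field_simp
    ring
  have e2 : ∀ x x' : ι → K, ∑ v : ι → K, ind ((x - x') ⬝ᵥ v = 0) = if x = x' then Q else Q / qq K := by
    intro x x'
    split_ifs with h
    · subst h; rw [hQ, ← card_V]; simp [ind]
    · rw [hyper_card (sub_ne_zero.2 h)]
  have e3 : ∑ v : ι → K, ∑ x ∈ E, ∑ x' ∈ E, ind ((x - x') ⬝ᵥ v = 0) = n * Q + n * (n - 1) * (Q / qq K) := by
    rw [Finset.sum_comm]
    have : ∀ x ∈ E, ∑ v : ι → K, ∑ x' ∈ E, ind ((x - x') ⬝ᵥ v = 0) = Q + (n - 1) * (Q / qq K) := by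
      intro x hx
      rw [Finset.sum_comm, Finset.sum_congr rfl (fun x' _ => e2 x x'),
        ← Finset.add_sum_erase E _ hx, if_pos rfl]
      congr 1
      rw [Finset.sum_congr rfl (fun x' hx' => if_neg (Finset.mem_erase.1 hx').1.symm)]
      rw [Finset.sum_const, Finset.card_erase_of_mem hx, nsmul_eq_mul, Nat.cast_sub (Finset.card_pos.2 ⟨x, hx⟩)]
      simp [hn]
    rw [Finset.sum_congr rfl this, Finset.sum_const, nsmul_eq_mul]; ring
  have e4 : ∑ v : ι → K, ∑ c : K, (ff E v c - n / qq K) ^ 2 = n * Q - n * (Q / qq K) := by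
    rw [Finset.sum_congr rfl (fun v _ => e1 v), Finset.sum_sub_distrib, e3]
    simp only [Finset.sum_const, nsmul_eq_mul, Finset.card_univ, card_V]
    rw [← hQ]; field_simp; ring
  calc _ ≤ ∑ v : ι → K, ∑ c : K, (ff E v c - n / qq K) ^ 2 := by
        apply Finset.sum_le_sum_of_subset_of_nonneg (Finset.erase_subset _ _)
        intros; exact Finset.sum_nonneg fun _ _ => sq_nonneg _
    _ = _ := by rw [e4]; field_simp

end stageB
end PD


namespace PD
open Finset
set_option linter.unusedSectionVars false

section stageB2
variable {K : Type} [Field K] [Fintype K] [DecidableEq K]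
variable {ι : Type} [Fintype ι] [DecidableEq ι]

lemma Om_sub : Om K ι ⊆ univ.erase (0 : ι → K) := by
  intro v hv
  simp only [Om, Finset.mem_filter, Finset.mem_univ, true_and] at hv
  simp only [Finset.mem_erase, Finset.mem_univ, and_true]
  rintro rfl
  apply hv; simp [qf]

lemma B1 (hK : ringChar K ≠ 2) (E : Finset (ι → K)) (η : ℝ)
    (hT : (2 - η ^ 2 / 4) * (E.card : ℝ) ^ 3 / qq K ≤ T1 E)
    (hn : qq K * qq K ^ (Fintype.card ι) ≤ (1 + η ^ 2 / 2) * (E.card : ℝ) ^ 2) :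
    ∑ v ∈ Om K ι, ∑ c : K, (ff E v c - E.card / qq K - mm E v c / qq K) ^ 2 +
    ∑ v ∈ (univ.erase (0 : ι → K)) \ Om K ι, ∑ c : K, (ff E v c - E.card / qq K) ^ 2 +
    (1 / qq K ^ 2) * ∑ v ∈ Om K ι, ∑ c : K, mm E v c * (E.card - mm E v c) ≤
      (qq K - 1) * η ^ 2 * (E.card : ℝ) ^ 3 / qq K ^ 2 := by
  have hq := qq_gt_one (K := K)
  have hq0 := qq_pos (K := K)
  have f2 := fact2 E
  have s1 := sum_mm hK E
  have s2 := sum_mm_ff hK E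
  set n : ℝ := (E.card : ℝ) with hnn
  have hn0 : 0 ≤ n := by positivity
  set q := qq K
  set QD := q ^ (Fintype.card ι)
  set M := ∑ v ∈ Om K ι, ∑ c : K, mm E v c with hM
  rw [← Finset.sum_sdiff (Om_sub (K := K) (ι := ι))] at f2
  have key : ∑ v ∈ Om K ι, ∑ c : K, (ff E v c - n / q - mm E v c / q) ^ 2 +
     (1 / q ^ 2) * ∑ v ∈ Om K ι, ∑ c : K, mm E v c * (n - mm E v c) =
     ∑ v ∈ Om K ι, ∑ c : K, (ff E v c - n / q) ^ 2 + (3 * n / q ^ 2) * M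
       - 2 / q * ∑ v ∈ Om K ι, ∑ c : K, mm E v c * ff E v c := by
    rw [hM]
    simp only [Finset.mul_sum, ← Finset.sum_add_distrib, ← Finset.sum_sub_distrib]
    refine Finset.sum_congr rfl fun v _ => Finset.sum_congr rfl fun c _ => ?_
    field_simp
    ring
  rw [s2] at key
  have h1 : (3 * n / q ^ 2) * M ≤ (3 * n / q ^ 2) * ((q - 1) * n ^ 2) :=
    mul_le_mul_of_nonneg_left s1 (by positivity)
  have h2 : 2 / q * ((q - 1) * ((2 - η ^ 2 / 4) * n ^ 3 / q)) ≤ 2 / q * ((q - 1) * T1 E) := by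
    apply mul_le_mul_of_nonneg_left _ (by positivity)
    exact mul_le_mul_of_nonneg_left hT (by linarith)
  have h3 : (q - 1) * (QD / q) * n ≤ (q - 1) * ((1 + η ^ 2 / 2) * n ^ 3 / q ^ 2) := by
    rw [mul_assoc]
    apply mul_le_mul_of_nonneg_left _ (by linarith)
    rw [div_mul_eq_mul_div, div_le_div_iff₀ hq0 (by positivity)]
    have := mul_le_mul_of_nonneg_left hn (mul_nonneg hn0 hq0.le)
    nlinarith [this]
  have h4 : (3 * n / q ^ 2) * ((q - 1) * n ^ 2) - 2 / q * ((q - 1) * ((2 - η ^ 2 / 4) * n ^ 3 / q))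
    + (q - 1) * ((1 + η ^ 2 / 2) * n ^ 3 / q ^ 2) = (q - 1) * η ^ 2 * n ^ 3 / q ^ 2 := by
    field_simp
    ring
  linarith

def HH (E : Finset (ι → K)) (η : ℝ) (v : ι → K) (c : K) : Prop :=
  qf v ≠ 0 ∧ (1 - η) * (E.card : ℝ) ≤ mm E v c

noncomputable instance (E : Finset (ι → K)) (η : ℝ) (v : ι → K) (c : K) : Decidable (HH E η v c) :=
  Classical.dec _

lemma HH_scale (E : Finset (ι → K)) (η : ℝ) (l : K) (hl : l ≠ 0) (v : ι → K) (c : K) :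
    HH E η (l • v) (l * c) ↔ HH E η v c := by
  unfold HH
  rw [mm_scale E l hl, qf_smul, Ne, mul_eq_zero, not_or]
  simp [hl]

lemma B2 (hK : ringChar K ≠ 2) (E : Finset (ι → K)) (η : ℝ) (h0 : 0 < η)
    (hT : (2 - η ^ 2 / 4) * (E.card : ℝ) ^ 3 / qq K ≤ T1 E)
    (hn : qq K * qq K ^ (Fintype.card ι) ≤ (1 + η ^ 2 / 2) * (E.card : ℝ) ^ 2) :
    ∑ v ∈ Om K ι, ∑ c : K, mm E v c * (ff E v c * (1 - ind (HH E η v c))) ≤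
      (qq K - 1) * (3 * η * (E.card : ℝ) ^ 3 / qq K) := by
  have hq := qq_gt_one (K := K)
  have hq0 := qq_pos (K := K)
  have b1 := B1 hK E η hT hn
  have s1 := sum_mm hK E
  by_cases hn00 : (E.card : ℝ) = 0
  · have : ∀ v c, mm E v c = 0 := fun v c => le_antisymm (hn00 ▸ mm_le E v c) (mm_nonneg E v c)
    simp [this, hn00]
  set n : ℝ := (E.card : ℝ) with hnn
  have hn0 : 0 < n := lt_of_le_of_ne (by positivity) (Ne.symm hn00)
  set q := qq K
  set A := ∑ v ∈ Om K ι, ∑ c : K, (ff E v c - n / q - mm E v c / q) ^ 2 with hA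
  set W := ∑ v ∈ Om K ι, ∑ c : K, mm E v c * (n - mm E v c) with hW
  set M := ∑ v ∈ Om K ι, ∑ c : K, mm E v c with hM
  have hI : 0 ≤ ∑ v ∈ (univ.erase (0 : ι → K)) \ Om K ι, ∑ c : K, (ff E v c - n / q) ^ 2 :=
    Finset.sum_nonneg fun _ _ => Finset.sum_nonneg fun _ _ => sq_nonneg _
  have hA0 : 0 ≤ A := Finset.sum_nonneg fun _ _ => Finset.sum_nonneg fun _ _ => sq_nonneg _
  have pt : ∑ v ∈ Om K ι, ∑ c : K, mm E v c * (ff E v c * (1 - ind (HH E η v c))) ≤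
      2 / (η * q) * W + (η * n / (2 * q)) * M + q / (2 * η) * A := by
    rw [hW, hM, hA]
    simp only [Finset.mul_sum, ← Finset.sum_add_distrib]
    refine Finset.sum_le_sum fun v hv => Finset.sum_le_sum fun c _ => ?_
    simp only [Om, Finset.mem_filter, Finset.mem_univ, true_and] at hv
    have hm0 := mm_nonneg E v c
    have hm1 : mm E v c ≤ n := mm_le E v c
    set m := mm E v c with hm
    set f := ff E v c with hf
    have hW0 : 0 ≤ m * (n - m) := mul_nonneg hm0 (by linarith)
    by_cases hH : HH E η v c
    · rw [ind_true hH]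
      simp only [sub_self, mul_zero]
      positivity
    · rw [ind_false hH, sub_zero, mul_one]
      have hlt : m ≤ (1 - η) * n := by
        by_contra hc
        exact hH ⟨hv, (not_le.1 hc).le⟩
      have e : m * f = m * n / q + m * m / q + m * (f - n / q - m / q) := by field_simp; ring
      have g1 : m * (η * n) ≤ m * (n - m) := mul_le_mul_of_nonneg_left (by linarith) hm0
      have g2 : m * n / q + m * m / q ≤ 2 / (η * q) * (m * (n - m)) := by
        have : m * m ≤ m * n := mul_le_mul_of_nonneg_left hm1 hm0
        rw [← add_div, div_mul_eq_mul_div, div_le_div_iff₀ hq0 (by positivity)]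
        have := mul_le_mul_of_nonneg_right g1 hq0.le
        nlinarith [mul_pos h0 hq0]
      have g3 : m * (f - n / q - m / q) ≤ η * n / (2 * q) * m + q / (2 * η) * (f - n / q - m / q) ^ 2 := by
        set t := f - n / q - m / q
        have k1 : m * t ≤ η / (2 * q) * m ^ 2 + q / (2 * η) * t ^ 2 := by
          have : η / (2 * q) * m ^ 2 + q / (2 * η) * t ^ 2 - m * t = (η * m - q * t) ^ 2 / (2 * q * η) := by
            field_simp; ring
          have : 0 ≤ (η * m - q * t) ^ 2 / (2 * q * η) := by positivity
          linarith
        have k2 : η / (2 * q) * m ^ 2 ≤ η * n / (2 * q) * m := by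
          have : η / (2 * q) * m ^ 2 = η / (2 * q) * (m * m) := by ring
          rw [this]
          have : η * n / (2 * q) * m = η / (2 * q) * (n * m) := by ring
          rw [this]
          apply mul_le_mul_of_nonneg_left _ (by positivity)
          exact mul_le_mul_of_nonneg_right hm1 hm0
        linarith
      linarith
  have c1 : (η * n / (2 * q)) * M ≤ (η * n / (2 * q)) * ((q - 1) * n ^ 2) :=
    mul_le_mul_of_nonneg_left s1 (by positivity)
  have c2 : 2 * q / η * (A + 1 / q ^ 2 * W) ≤ 2 * q / η * ((q - 1) * η ^ 2 * n ^ 3 / q ^ 2) :=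
    mul_le_mul_of_nonneg_left (by linarith) (by positivity)
  have c3 : 2 * q / η * (A + 1 / q ^ 2 * W) = 2 / (η * q) * W + q / (2 * η) * A + (3 / 2) * (q / η * A) := by
    field_simp; ring
  have c4 : 0 ≤ q / η * A := by positivity
  have c5 : (η * n / (2 * q)) * ((q - 1) * n ^ 2) + 2 * q / η * ((q - 1) * η ^ 2 * n ^ 3 / q ^ 2)
     + (q - 1) * (η * n ^ 3 / (2 * q)) = (q - 1) * (3 * η * n ^ 3 / q) := by
    field_simp; ring
  have c6 : 0 ≤ (q - 1) * (η * n ^ 3 / (2 * q)) := mul_nonneg (by linarith) (by positivity)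
  linarith

noncomputable def rich (E : Finset (ι → K)) (y : ι → K) : ℝ :=
  ∑ v ∈ univ.erase (0 : ι → K), ind (4 * (E.card : ℝ) / qq K ≤ ff E v (v ⬝ᵥ y)) * ff E v (v ⬝ᵥ y)

noncomputable def badS (E : Finset (ι → K)) (η : ℝ) (y : ι → K) : ℝ :=
  ∑ x ∈ E, ∑ x' ∈ E, ind (qf (x - y) = qf (x' - y)) * (1 - ind (HH E η (x - x') ((qf x - qf x') / 2)))

noncomputable def goodS (E : Finset (ι → K)) (η : ℝ) (y : ι → K) : ℝ :=
  ∑ x ∈ E, ∑ x' ∈ E, ind (qf (x - y) = qf (x' - y)) * ind (HH E η (x - x') ((qf x - qf x') / 2))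

lemma good_add_bad (E : Finset (ι → K)) (η : ℝ) (y : ι → K) : goodS E η y + badS E η y = SS E y := by
  unfold goodS badS SS
  simp only [← Finset.sum_add_distrib]
  refine Finset.sum_congr rfl fun v _ => Finset.sum_congr rfl fun c _ => ?_
  ring

lemma rich_nonneg (E : Finset (ι → K)) (y : ι → K) : 0 ≤ rich E y :=
  Finset.sum_nonneg fun _ _ => mul_nonneg (ind_nonneg _) (ff_nonneg _ _ _)

lemma badS_nonneg (E : Finset (ι → K)) (η : ℝ) (y : ι → K) : 0 ≤ badS E η y :=
  Finset.sum_nonneg fun _ _ => Finset.sum_nonneg fun _ _ =>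
    mul_nonneg (ind_nonneg _) (sub_nonneg.2 (ind_le_one _))

lemma rich_sum (hK : ringChar K ≠ 2) (E : Finset (ι → K)) (η : ℝ)
    (hT : (2 - η ^ 2 / 4) * (E.card : ℝ) ^ 3 / qq K ≤ T1 E)
    (hn : qq K * qq K ^ (Fintype.card ι) ≤ (1 + η ^ 2 / 2) * (E.card : ℝ) ^ 2) :
    ∑ y ∈ E, rich E y ≤ 4 * (qq K - 1) * η ^ 2 * (E.card : ℝ) ^ 3 / qq K ^ 2 := by
  have hq := qq_gt_one (K := K)
  have hq0 := qq_pos (K := K)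
  have b1 := B1 hK E η hT hn
  have e1 : ∑ y ∈ E, rich E y = ∑ v ∈ univ.erase (0 : ι → K), ∑ c : K,
      ind (4 * (E.card : ℝ) / qq K ≤ ff E v c) * ff E v c ^ 2 := by
    unfold rich
    rw [Finset.sum_comm]
    refine Finset.sum_congr rfl fun v _ => ?_
    have : ∀ c, ind (4 * (E.card : ℝ) / qq K ≤ ff E v c) * ff E v c ^ 2 =
      ∑ y ∈ E, if v ⬝ᵥ y = c then ind (4 * (E.card : ℝ) / qq K ≤ ff E v c) * ff E v c else 0 := by
      intro c
      have e : ∀ a : ℝ, a * ff E v c = ∑ y ∈ E, if v ⬝ᵥ y = c then a else 0 := by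
        intro a
        rw [ff, Finset.mul_sum]
        refine Finset.sum_congr rfl fun y _ => ?_
        rw [mul_comm, ind_mul]
      rw [← e]; ring
    rw [Finset.sum_congr rfl fun c _ => this c, Finset.sum_comm]
    refine Finset.sum_congr rfl fun y _ => ?_
    rw [Finset.sum_ite_eq, if_pos (Finset.mem_univ _)]
  rw [e1, ← Finset.sum_sdiff (Om_sub (K := K) (ι := ι))]
  set n : ℝ := (E.card : ℝ) with hnn
  have hn0 : 0 ≤ n := by positivity
  set q := qq K
  have hW0 : 0 ≤ 1 / q ^ 2 * ∑ v ∈ Om K ι, ∑ c : K, mm E v c * (n - mm E v c) := by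
    apply mul_nonneg (by positivity)
    exact Finset.sum_nonneg fun _ _ => Finset.sum_nonneg fun _ _ => mul_nonneg (mm_nonneg _ _ _)
      (sub_nonneg.2 (mm_le _ _ _))
  have p1 : ∑ v ∈ Om K ι, ∑ c : K, ind (4 * n / q ≤ ff E v c) * ff E v c ^ 2 ≤
      4 * ∑ v ∈ Om K ι, ∑ c : K, (ff E v c - n / q - mm E v c / q) ^ 2 := by
    simp only [Finset.mul_sum]
    refine Finset.sum_le_sum fun v hv => Finset.sum_le_sum fun c _ => ?_
    rw [ind_mul]
    split_ifs with h
    · have hm : mm E v c / q ≤ n / q := by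
        have := mm_le E v c; gcongr
      have h' : 4 * (n / q) ≤ ff E v c := by rw [← mul_div_assoc]; exact h
      have : 0 ≤ n / q := by positivity
      nlinarith
    · positivity
  have p2 : ∑ v ∈ (univ.erase (0 : ι → K)) \ Om K ι, ∑ c : K, ind (4 * n / q ≤ ff E v c) * ff E v c ^ 2 ≤
      4 * ∑ v ∈ (univ.erase (0 : ι → K)) \ Om K ι, ∑ c : K, (ff E v c - n / q) ^ 2 := by
    simp only [Finset.mul_sum]
    refine Finset.sum_le_sum fun v hv => Finset.sum_le_sum fun c _ => ?_
    rw [ind_mul]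
    split_ifs with h
    · have h' : 4 * (n / q) ≤ ff E v c := by rw [← mul_div_assoc]; exact h
      have : 0 ≤ n / q := by positivity
      nlinarith
    · positivity
  have : 4 * (q - 1) * η ^ 2 * n ^ 3 / q ^ 2 = 4 * ((q - 1) * η ^ 2 * n ^ 3 / q ^ 2) := by ring
  rw [this]
  linarith

lemma good_sum (hK : ringChar K ≠ 2) (E : Finset (ι → K)) (η : ℝ) (h0 : 0 < η)
    (hT : (2 - η ^ 2 / 4) * (E.card : ℝ) ^ 3 / qq K ≤ T1 E)
    (hn : qq K * qq K ^ (Fintype.card ι) ≤ (1 + η ^ 2 / 2) * (E.card : ℝ) ^ 2) :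
    T1 E - 3 * η * (E.card : ℝ) ^ 3 / qq K ≤ ∑ y ∈ E, goodS E η y := by
  have hq := qq_gt_one (K := K)
  have b2 := B2 hK E η h0 hT hn
  have s2 := sum_mm_ff hK E
  have t := transfer3 hK E (fun v c => ff E v c * ind (HH E η v c)) (by
    intro l hl v c
    rw [ff_scale E l hl, ind_congr (HH_scale E η l hl v c)])
  have e : ∑ y ∈ E, goodS E η y = ∑ x ∈ E, ∑ x' ∈ E, ind (qf (x - x') ≠ 0) *
      (ff E (x - x') ((qf x - qf x') / 2) * ind (HH E η (x - x') ((qf x - qf x') / 2))) := by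
    unfold goodS
    rw [Finset.sum_comm]
    refine Finset.sum_congr rfl fun x _ => ?_
    rw [Finset.sum_comm]
    refine Finset.sum_congr rfl fun x' _ => ?_
    by_cases h : HH E η (x - x') ((qf x - qf x') / 2)
    · rw [ind_true h, ind_true h.1, mul_one, one_mul, ff]
      refine Finset.sum_congr rfl fun y _ => ?_
      rw [mul_one]
      exact ind_congr (dist_iff hK x x' y)
    · rw [ind_false h]; simp
  rw [← e] at t
  have d : ∑ v ∈ Om K ι, ∑ c : K, mm E v c * (ff E v c * (1 - ind (HH E η v c))) =
     ∑ v ∈ Om K ι, ∑ c : K, mm E v c * ff E v c -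
     ∑ v ∈ Om K ι, ∑ c : K, mm E v c * (ff E v c * ind (HH E η v c)) := by
    simp only [← Finset.sum_sub_distrib]
    refine Finset.sum_congr rfl fun v _ => Finset.sum_congr rfl fun c _ => ?_
    ring
  rw [d, s2, t, ← mul_sub] at b2
  have := le_of_mul_le_mul_left b2 (by linarith)
  linarith

noncomputable def VV (E : Finset (ι → K)) (η : ℝ) (y : ι → K) : Finset (ι → K) :=
  univ.filter fun v => HH E η v (v ⬝ᵥ y)

lemma good_VV (hK : ringChar K ≠ 2) (E : Finset (ι → K)) (η : ℝ) (y : ι → K) :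
    (qq K - 1) * goodS E η y = ∑ v ∈ VV E η y, mm E v (v ⬝ᵥ y) := by
  have t := transfer3 hK E (fun v c => ind (v ⬝ᵥ y = c) * ind (HH E η v c)) (by
    intro l hl v c
    rw [ind_congr (HH_scale E η l hl v c)]
    congr 1
    apply ind_congr
    rw [smul_dotProduct, smul_eq_mul, mul_right_inj' hl])
  have e : goodS E η y = ∑ x ∈ E, ∑ x' ∈ E, ind (qf (x - x') ≠ 0) *
      (ind ((x - x') ⬝ᵥ y = ((qf x - qf x') / 2)) * ind (HH E η (x - x') ((qf x - qf x') / 2))) := by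
    unfold goodS
    refine Finset.sum_congr rfl fun x _ => Finset.sum_congr rfl fun x' _ => ?_
    rw [ind_congr (dist_iff hK x x' y)]
    by_cases h : HH E η (x - x') ((qf x - qf x') / 2)
    · rw [ind_true h, ind_true h.1]; ring
    · rw [ind_false h]; simp
  rw [e, ← t]
  have : ∑ v ∈ VV E η y, mm E v (v ⬝ᵥ y) = ∑ v ∈ Om K ι, ind (HH E η v (v ⬝ᵥ y)) * mm E v (v ⬝ᵥ y) := by
    simp only [ind_mul]
    rw [← Finset.sum_filter]
    apply Finset.sum_congr _ (fun _ _ => rfl)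
    ext v
    simp only [VV, Om, Finset.mem_filter, Finset.mem_univ, true_and]
    exact ⟨fun h => ⟨h.1, h⟩, fun h => h.2⟩
  rw [this]
  refine Finset.sum_congr rfl fun v _ => ?_
  have : ∀ c, mm E v c * (ind (v ⬝ᵥ y = c) * ind (HH E η v c)) =
    if v ⬝ᵥ y = c then mm E v c * ind (HH E η v c) else 0 := by
    intro c; rw [mul_left_comm, ind_mul]
  rw [Finset.sum_congr rfl fun c _ => this c, Finset.sum_ite_eq, if_pos (Finset.mem_univ _), mul_comm]

set_option maxHeartbeats 2000000 in
lemma pin (hK : ringChar K ≠ 2) (E : Finset (ι → K)) (hE : AllBad E) (hne : E.Nonempty) (η : ℝ) (h0 : 0 < η)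
    (h1 : η ≤ 1 / 100)
    (hT : (2 - η ^ 2 / 4) * (E.card : ℝ) ^ 3 / qq K ≤ T1 E)
    (hn : qq K * qq K ^ (Fintype.card ι) ≤ (1 + η ^ 2 / 2) * (E.card : ℝ) ^ 2) :
    ∃ y ∈ E, badS E η y ≤ 40 * η * (E.card : ℝ) ^ 2 / qq K ∧
      rich E y ≤ 40 * (qq K - 1) * η ^ 2 * (E.card : ℝ) ^ 2 / qq K ^ 2 ∧
      (E.card : ℝ) / 2 ≤ (VV E η y).card ∧ ((VV E η y).card : ℝ) ≤ 20 * E.card := by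
  have hq := qq_gt_one (K := K)
  have hq2 : 2 ≤ qq K := by
    unfold qq at hq ⊢
    have : 1 < Fintype.card K := by exact_mod_cast hq
    exact_mod_cast this
  have hq0 := qq_pos (K := K)
  have gs := good_sum hK E η h0 hT hn
  have rs := rich_sum hK E η hT hn
  have ss := SS_sum_le hK E
  have hbad := bad_SS E hE
  have n0 : (0 : ℝ) < E.card := by exact_mod_cast hne.card_pos
  set n : ℝ := (E.card : ℝ) with hnn
  set q := qq K
  set QD := q ^ (Fintype.card ι)
  have hQD0 : 0 ≤ QD := by positivity
  have sb : ∑ y ∈ E, goodS E η y + ∑ y ∈ E, badS E η y = ∑ y ∈ E, SS E y := by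
    rw [← Finset.sum_add_distrib]
    exact Finset.sum_congr rfl fun y _ => good_add_bad E η y
  have hQn : n * (QD - QD / q) ≤ (1 + η ^ 2 / 2) * n ^ 3 / q := by
    rw [le_div_iff₀ hq0]
    have : n * (QD - QD / q) * q = n * (q * QD) - n * QD := by field_simp
    rw [this]
    nlinarith [mul_le_mul_of_nonneg_left hn n0.le, mul_nonneg n0.le hQD0]
  have hη2 : η ^ 2 ≤ η / 100 := by nlinarith
  have X0 : 0 < n ^ 3 / q := by positivity
  have S1 : ∑ y ∈ E, SS E y ≤ 3 * (n ^ 3 / q) := by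
    have : (1 + η ^ 2 / 2) * n ^ 3 / q = (1 + η ^ 2 / 2) * (n ^ 3 / q) := by ring
    nlinarith
  have S2 : ∑ y ∈ E, badS E η y ≤ 4 * η * (n ^ 3 / q) := by
    have a1 : (1 + η ^ 2 / 2) * n ^ 3 / q = (1 + η ^ 2 / 2) * (n ^ 3 / q) := by ring
    have a2 : (2 - η ^ 2 / 4) * n ^ 3 / q = (2 - η ^ 2 / 4) * (n ^ 3 / q) := by ring
    have a3 : 3 * η * n ^ 3 / q = 3 * η * (n ^ 3 / q) := by ring
    rw [a1] at hQn
    rw [a2] at hT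
    rw [a3] at gs
    nlinarith
  obtain ⟨y, hy, c1, c2, c3⟩ : ∃ y ∈ E, SS E y ≤ 10 * n ^ 2 / q ∧ badS E η y ≤ 40 * η * n ^ 2 / q ∧
      rich E y ≤ 40 * (q - 1) * η ^ 2 * n ^ 2 / q ^ 2 := by
    by_contra hcon
    push Not at hcon
    have hN : 0 < q - 1 := by linarith
    have : ∑ y ∈ E, (1 : ℝ) ≤ ∑ y ∈ E, (q / (10 * n ^ 2) * SS E y + q / (40 * η * n ^ 2) * badS E η y +
        q ^ 2 / (40 * (q - 1) * η ^ 2 * n ^ 2) * rich E y) := by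
      refine Finset.sum_le_sum fun y hy => ?_
      have u1 : 0 ≤ SS E y := Finset.sum_nonneg fun _ _ => Finset.sum_nonneg fun _ _ => ind_nonneg _
      have u2 := badS_nonneg E η y
      have u3 := rich_nonneg E y
      have w1 : 0 ≤ q / (10 * n ^ 2) * SS E y := by positivity
      have w2 : 0 ≤ q / (40 * η * n ^ 2) * badS E η y := by positivity
      have w3 : 0 ≤ q ^ 2 / (40 * (q - 1) * η ^ 2 * n ^ 2) * rich E y := by positivity
      by_cases k1 : SS E y ≤ 10 * n ^ 2 / q
      · by_cases k2 : badS E η y ≤ 40 * η * n ^ 2 / q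
        · have k3 := hcon y hy k1 k2
          have := mul_le_mul_of_nonneg_left k3.le (show 0 ≤ q ^ 2 / (40 * (q - 1) * η ^ 2 * n ^ 2) by positivity)
          have e : q ^ 2 / (40 * (q - 1) * η ^ 2 * n ^ 2) * (40 * (q - 1) * η ^ 2 * n ^ 2 / q ^ 2) = 1 := by
            field_simp
          linarith
        · have := mul_le_mul_of_nonneg_left (not_le.1 k2).le (show 0 ≤ q / (40 * η * n ^ 2) by positivity)
          have e : q / (40 * η * n ^ 2) * (40 * η * n ^ 2 / q) = 1 := by field_simp
          linarith
      · have := mul_le_mul_of_nonneg_left (not_le.1 k1).le (show 0 ≤ q / (10 * n ^ 2) by positivity)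
        have e : q / (10 * n ^ 2) * (10 * n ^ 2 / q) = 1 := by field_simp
        linarith
    simp only [Finset.sum_add_distrib, ← Finset.mul_sum, Finset.sum_const, nsmul_eq_mul, mul_one] at this
    have z1 := mul_le_mul_of_nonneg_left S1 (show 0 ≤ q / (10 * n ^ 2) by positivity)
    have z2 := mul_le_mul_of_nonneg_left S2 (show 0 ≤ q / (40 * η * n ^ 2) by positivity)
    have z3 := mul_le_mul_of_nonneg_left rs (show 0 ≤ q ^ 2 / (40 * (q - 1) * η ^ 2 * n ^ 2) by positivity)
    have r1 : q / (10 * n ^ 2) * (3 * (n ^ 3 / q)) = 3 / 10 * n := by field_simp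
    have r2 : q / (40 * η * n ^ 2) * (4 * η * (n ^ 3 / q)) = 1 / 10 * n := by field_simp; norm_num
    have r3 : q ^ 2 / (40 * (q - 1) * η ^ 2 * n ^ 2) * (4 * (q - 1) * η ^ 2 * n ^ 3 / q ^ 2) = 1 / 10 * n := by
      field_simp; norm_num
    linarith
  refine ⟨y, hy, c2, c3, ?_, ?_⟩
  · have g := good_add_bad E η y
    have b := hbad y hy
    have gv := good_VV hK E η y
    have u : ∑ v ∈ VV E η y, mm E v (v ⬝ᵥ y) ≤ (VV E η y).card * n := by
      refine (Finset.sum_le_sum fun v _ => mm_le E v _).trans ?_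
      simp [hnn]
    have : (3 / 2) * (n ^ 2 / q) ≤ goodS E η y := by
      have a1 : 2 * n ^ 2 / q = 2 * (n ^ 2 / q) := by ring
      have a2 : 40 * η * n ^ 2 / q = 40 * η * (n ^ 2 / q) := by ring
      have : 0 < n ^ 2 / q := by positivity
      rw [a1] at b; rw [a2] at c2
      nlinarith
    have k := mul_le_mul_of_nonneg_left this (show 0 ≤ q - 1 by linarith)
    have k2 : (q - 1) * ((3 / 2) * (n ^ 2 / q)) ≤ (VV E η y).card * n := by linarith
    have k3 : n * n / 2 ≤ (q - 1) * ((3 / 2) * (n ^ 2 / q)) := by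
      have : (q - 1) * ((3 / 2) * (n ^ 2 / q)) = ((q - 1) * (3 / 2)) * n ^ 2 / q := by ring
      rw [this, div_le_div_iff₀ (by norm_num) hq0]
      nlinarith [mul_pos n0 n0]
    have k4 : (n / 2) * n ≤ (VV E η y).card * n := by linarith
    exact le_of_mul_le_mul_right k4 n0
  · have g := good_add_bad E η y
    have b := badS_nonneg E η y
    have gv := good_VV hK E η y
    have l : (VV E η y).card * ((1 - η) * n) ≤ ∑ v ∈ VV E η y, mm E v (v ⬝ᵥ y) := by
      rw [← nsmul_eq_mul, ← Finset.sum_const]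
      refine Finset.sum_le_sum fun v hv => ?_
      simp only [VV, Finset.mem_filter, Finset.mem_univ, true_and] at hv
      exact hv.2
    have k := mul_le_mul_of_nonneg_left (show goodS E η y ≤ 10 * n ^ 2 / q by linarith) (show 0 ≤ q - 1 by linarith)
    have k3 : (q - 1) * (10 * n ^ 2 / q) ≤ 10 * n ^ 2 := by
      rw [← mul_div_assoc, div_le_iff₀ hq0]; nlinarith [mul_pos n0 n0]
    have k4 : (VV E η y).card * (n / 2) ≤ (VV E η y).card * ((1 - η) * n) := by
      apply mul_le_mul_of_nonneg_left _ (by positivity)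
      nlinarith
    have k5 : (VV E η y).card * n ≤ (20 * n) * n := by nlinarith
    exact le_of_mul_le_mul_right k5 n0

end stageB2
end PD


namespace PD
open Finset
set_option linter.unusedSectionVars false

section stageC
variable {K : Type} [Field K] [Fintype K] [DecidableEq K]
variable {ι : Type} [Fintype ι] [DecidableEq ι]

/-- coefficient of reflection -/
def co (y v z : ι → K) : K := 2 * (v ⬝ᵥ z - v ⬝ᵥ y) / qf v

/-- reflection in the hyperplane through y perpendicular to v -/
def RR (y v z : ι → K) : ι → K := z - co y v z • v

lemma RR_eq (y v z : ι → K) : RR y v z = rfl' v (v ⬝ᵥ y) z := rfl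

lemma co_RR (y v z : ι → K) (hv : qf v ≠ 0) : co y v (RR y v z) = - co y v z := by
  unfold RR co
  rw [dotProduct_sub, dotProduct_smul]
  change 2 * (v ⬝ᵥ z - (_ / qf v) * qf v - v ⬝ᵥ y) / qf v = _
  field_simp
  ring

lemma RR_RR (y v z : ι → K) (hv : qf v ≠ 0) : RR y v (RR y v z) = z := by
  have h := co_RR y v z hv
  rw [RR, h, RR]
  simp

lemma co_ne (hK : ringChar K ≠ 2) (y v z : ι → K) (hv : qf v ≠ 0) : co y v z ≠ 0 ↔ v ⬝ᵥ z ≠ v ⬝ᵥ y := by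
  have h2 := two_ne hK
  unfold co
  rw [Ne, div_eq_zero_iff, mul_eq_zero, sub_eq_zero]
  simp [hv, h2]

lemma qf_RR (y v z : ι → K) (hv : qf v ≠ 0) : qf (RR y v z - y) = qf (z - y) := by
  have : RR y v z - y = (z - y) - co y v z • v := by unfold RR; abel
  rw [this, qf_sub, dotProduct_smul, qf_smul, dotProduct_comm (z - y) v, dotProduct_sub]
  unfold co
  simp only [smul_eq_mul]
  field_simp
  ring

lemma refl_count (hK : ringChar K ≠ 2) (S : Finset (ι → K)) (hS : ∀ v ∈ S, qf v ≠ 0) (z y : ι → K) (p : (ι → K) → Prop)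
    [DecidablePred p] :
    ∑ v ∈ S, ind (v ⬝ᵥ z ≠ v ⬝ᵥ y ∧ p (RR y v z)) ≤ (qq K - 1) * ∑ x' : ι → K, ind (p x') := by
  rw [sum_ind, sum_ind, ← card_erase_K (K := K)]
  rw [← Nat.cast_mul, ← Finset.card_product]
  norm_cast
  apply Finset.card_le_card_of_injOn (fun v => ((co y v z)⁻¹, RR y v z))
  · intro v hv
    simp only [Finset.coe_filter, Set.mem_ofPred_eq] at hv
    obtain ⟨hvS, hne, hp⟩ := hv
    have := (co_ne hK y v z (hS v hvS)).2 hne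
    simp [hp, this]
  · intro v hv v' hv' heq
    simp only [Finset.coe_filter, Set.mem_ofPred_eq] at hv hv'
    have h1 := (co_ne hK y v z (hS v hv.1)).2 hv.2.1
    simp only [Prod.mk.injEq, inv_inj] at heq
    obtain ⟨e1, e2⟩ := heq
    unfold RR at e2
    rw [← e1, sub_right_inj] at e2
    exact smul_right_injective _ h1 e2

lemma VV_mem {E : Finset (ι → K)} {η : ℝ} {y v : ι → K} : v ∈ VV E η y ↔ HH E η v (v ⬝ᵥ y) := by
  simp [VV]

lemma ind_not (p : Prop) [Decidable p] : ind (¬ p) = 1 - ind p := by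
  unfold ind; split_ifs <;> simp

lemma E1 (E : Finset (ι → K)) (η : ℝ) (y v : ι → K) (hv : v ∈ VV E η y) :
    ∑ x ∈ E, ind (¬ (v ⬝ᵥ x ≠ v ⬝ᵥ y ∧ RR y v x ∈ E)) ≤ η * E.card := by
  have h := (VV_mem.1 hv).2
  simp only [ind_not, Finset.sum_sub_distrib, Finset.sum_const, nsmul_eq_mul, mul_one]
  have : ∑ x ∈ E, ind (v ⬝ᵥ x ≠ v ⬝ᵥ y ∧ RR y v x ∈ E) = mm E v (v ⬝ᵥ y) := rfl
  rw [this]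
  linarith

lemma refl_sum (E : Finset (ι → K)) (y v : ι → K) (hv : qf v ≠ 0) (p : (ι → K) → Prop) [DecidablePred p] :
    ∑ x ∈ E, ind (RR y v x ∈ E ∧ p (RR y v x)) ≤ ∑ x ∈ E, ind (p x) := by
  rw [sum_ind, sum_ind]
  norm_cast
  apply Finset.card_le_card_of_injOn (fun x => RR y v x)
  · intro x hx
    simp only [Finset.coe_filter, Set.mem_ofPred_eq] at hx ⊢
    exact hx.2
  · intro x _ x' _ h
    have := congrArg (RR y v) h
    simpa only [RR_RR y v _ hv] using this

lemma E2 (E : Finset (ι → K)) (η : ℝ) (y v v2 : ι → K) (hv : v ∈ VV E η y) (hv2 : qf v2 ≠ 0) :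
    ∑ x ∈ E, ind (RR y v2 x ∈ E ∧ ¬ (v ⬝ᵥ (RR y v2 x) ≠ v ⬝ᵥ y ∧ RR y v (RR y v2 x) ∈ E)) ≤ η * E.card :=
  (refl_sum E y v2 hv2 (fun z => ¬ (v ⬝ᵥ z ≠ v ⬝ᵥ y ∧ RR y v z ∈ E))).trans (E1 E η y v hv)

lemma E3 (hK : ringChar K ≠ 2) (E : Finset (ι → K)) (η : ℝ) (y v2 : ι → K) (hv2 : qf v2 ≠ 0) :
    ∑ v ∈ VV E η y, ∑ x ∈ E, ind (v ⬝ᵥ (RR y v2 x) ≠ v ⬝ᵥ y ∧ (RR y v (RR y v2 x) ∈ E ∧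
      qf (RR y v (RR y v2 x) - y) = qf (x - y) ∧ x - RR y v (RR y v2 x) ∉ VV E η y)) ≤
      (qq K - 1) * badS E η y := by
  rw [Finset.sum_comm, badS, Finset.mul_sum]
  refine Finset.sum_le_sum fun x hx => ?_
  refine (refl_count hK (VV E η y) (fun v hv => (VV_mem.1 hv).1) (RR y v2 x) y
    (fun x' => x' ∈ E ∧ qf (x' - y) = qf (x - y) ∧ x - x' ∉ VV E η y)).trans ?_
  apply mul_le_mul_of_nonneg_left _ (by have := qq_gt_one (K := K); linarith)
  have : ∀ x', ind (x' ∈ E ∧ qf (x' - y) = qf (x - y) ∧ x - x' ∉ VV E η y) =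
      if x' ∈ E then ind (qf (x' - y) = qf (x - y) ∧ x - x' ∉ VV E η y) else 0 := by
    intro x'; unfold ind; split_ifs <;> simp_all
  rw [Finset.sum_congr rfl fun x' _ => this x', ← Finset.sum_filter, Finset.filter_mem_eq_inter, Finset.univ_inter]
  refine Finset.sum_le_sum fun x' _ => ?_
  rw [ind_mul]
  split_ifs with h
  · rw [← ind_not]
    apply ind_mono
    rintro ⟨-, h2⟩ h3
    apply h2
    rw [VV_mem, (dist_iff hK x x' y).1 h]
    exact h3
  · rw [ind_false]
    rintro ⟨h1, -⟩
    exact h h1.symm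

lemma scale_count (hK : ringChar K ≠ 2) (U : Finset (ι → K)) (hU : ∀ l : K, l ≠ 0 → ∀ v ∈ U, l • v ∈ U)
    (hQ : ∀ v ∈ U, qf v ≠ 0) (x y : ι → K) :
    (qq K - 1) * ∑ x' : ι → K, ind (qf (x' - y) = qf (x - y) ∧ x - x' ∈ U) ≤ U.card := by
  have h2 := two_ne hK
  rw [sum_ind, ← card_erase_K (K := K), ← Nat.cast_mul, ← Finset.card_product]
  norm_cast
  have key : ∀ x', qf (x' - y) = qf (x - y) → qf (x - x') = 2 * ((x - x') ⬝ᵥ (x - y)) := by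
    intro x' h
    have e : x' - y = (x - y) - (x - x') := by abel
    rw [e, qf_sub (x - y), dotProduct_comm] at h
    linear_combination h
  apply Finset.card_le_card_of_injOn (fun p => p.1 • (x - p.2))
  · rintro ⟨l, x'⟩ h
    simp only [Finset.coe_product, Set.mem_prod, Finset.mem_coe, Finset.mem_erase, Finset.mem_filter] at h
    exact hU l h.1.1 _ h.2.2.2
  · rintro ⟨l, x'⟩ h ⟨l2, x2⟩ hh heq
    simp only [Finset.coe_product, Set.mem_prod, Finset.mem_coe, Finset.mem_erase, Finset.mem_filter] at h hh
    simp only at heq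
    have k1 := key x' h.2.2.1
    have k2 := key x2 hh.2.2.1
    have q1 := hQ _ h.2.2.2
    have q2 := hQ _ hh.2.2.2
    have e1 := congrArg qf heq
    rw [qf_smul, qf_smul] at e1
    have e2 := congrArg (fun t => t ⬝ᵥ (x - y)) heq
    simp only [smul_dotProduct, smul_eq_mul] at e2
    have e3 : l * qf (x - x') = l2 * qf (x - x2) := by rw [k1, k2]; linear_combination 2 * e2
    have hl : l = l2 := by
      have : (l - l2) * (l2 * qf (x - x2)) = 0 := by linear_combination e1 - l * e3
      rcases mul_eq_zero.1 this with h' | h'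
      · exact sub_eq_zero.1 h'
      · exact absurd h' (mul_ne_zero hh.1.1 q2)
    subst hl
    have := smul_right_injective _ h.1.1 heq
    simp only [sub_right_inj] at this
    rw [this]

lemma E4 (hK : ringChar K ≠ 2) (E : Finset (ι → K)) (V U : Finset (ι → K)) (hV : ∀ v ∈ V, qf v ≠ 0)
    (hU : ∀ l : K, l ≠ 0 → ∀ v ∈ U, l • v ∈ U)
    (hQ : ∀ v ∈ U, qf v ≠ 0) (y v2 : ι → K) :
    ∑ v ∈ V, ∑ x ∈ E, ind (v ⬝ᵥ (RR y v2 x) ≠ v ⬝ᵥ y ∧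
      (qf (RR y v (RR y v2 x) - y) = qf (x - y) ∧ x - RR y v (RR y v2 x) ∈ U)) ≤
      E.card * U.card := by
  rw [Finset.sum_comm]
  refine (Finset.sum_le_sum fun x hx => (refl_count hK V hV (RR y v2 x) y
    (fun x' => qf (x' - y) = qf (x - y) ∧ x - x' ∈ U)).trans (scale_count hK U hU hQ x y)).trans ?_
  simp

/-- the perpendicular vector -/
def uu (y v1 v2 x : ι → K) : ι → K :=
  (2 * co y v2 x / qf v1) • v1 +
    (- (4 * co y v2 x * (v1 ⬝ᵥ v2) / (qf v1 * qf v2)) - 2 * co y v1 (RR y v2 x) / qf v2) • v2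

lemma uu_dot (y v1 v2 x x' : ι → K) (h1 : qf v1 ≠ 0) (h2 : qf v2 ≠ 0) :
    uu y v1 v2 x ⬝ᵥ x' - uu y v1 v2 x ⬝ᵥ y =
      co y v2 x * co y v1 (RR y v2 x') - co y v1 (RR y v2 x) * co y v2 x' := by
  have e : co y v1 (RR y v2 x') = 2 * (v1 ⬝ᵥ x' - co y v2 x' * (v1 ⬝ᵥ v2) - v1 ⬝ᵥ y) / qf v1 := by
    rw [co, RR, dotProduct_sub, dotProduct_smul]; rfl
  rw [e]
  have e2 : co y v2 x' = 2 * (v2 ⬝ᵥ x' - v2 ⬝ᵥ y) / qf v2 := rfl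
  rw [uu]
  generalize co y v1 (RR y v2 x) = A
  generalize co y v2 x = B
  rw [e2]
  simp only [add_dotProduct, smul_dotProduct, smul_eq_mul]
  field_simp
  ring

def indep (v1 v2 : ι → K) : Prop := ∀ c1 c2 : K, c1 • v1 + c2 • v2 = 0 → c1 = 0 ∧ c2 = 0

instance (v1 v2 : ι → K) : Decidable (indep v1 v2) := by unfold indep; infer_instance

noncomputable def richp (E : Finset (ι → K)) (y u : ι → K) : ℝ :=
  ind (u ≠ 0 ∧ 4 * (E.card : ℝ) / qq K ≤ ff E u (u ⬝ᵥ y)) * ff E u (u ⬝ᵥ y)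

lemma richp_nonneg (E : Finset (ι → K)) (y u : ι → K) : 0 ≤ richp E y u :=
  mul_nonneg (ind_nonneg _) (ff_nonneg _ _ _)

lemma richp_sum (E : Finset (ι → K)) (y : ι → K) : ∑ u, richp E y u = rich E y := by
  rw [rich]
  rw [← Finset.sum_erase (s := univ) (a := (0 : ι → K)) (f := richp E y)]
  · refine Finset.sum_congr rfl fun u hu => ?_
    unfold richp
    congr 1
    apply ind_congr
    simp [(Finset.mem_erase.1 hu).1]
  · unfold richp
    rw [ind_false (by simp)]; simp

lemma E5a (hK : ringChar K ≠ 2) (E : Finset (ι → K)) (y v1 v2 : ι → K) (h1 : qf v1 ≠ 0) (h2 : qf v2 ≠ 0)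
    (hi : indep v1 v2) :
    (qq K - 1) * ∑ x ∈ E, ind (co y v2 x ≠ 0 ∧
      4 * (E.card : ℝ) / qq K ≤ ff E (uu y v1 v2 x) (uu y v1 v2 x ⬝ᵥ y)) ≤
    ∑ c1 ∈ univ.erase (0 : K), ∑ c2 : K, richp E y (c1 • v1 + c2 • v2) := by
  have k2 := two_ne hK
  rw [← card_erase_K (K := K), ← nsmul_eq_mul, ← Finset.sum_const]
  refine Finset.sum_le_sum fun c1 hc1 => ?_
  have hc1 : c1 ≠ 0 := (Finset.mem_erase.1 hc1).1
  have : ∀ c2 : K, richp E y (c1 • v1 + c2 • v2) = ∑ x ∈ E,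
      ind (c1 • v1 + c2 • v2 ≠ 0 ∧ 4 * (E.card : ℝ) / qq K ≤ ff E (c1 • v1 + c2 • v2) ((c1 • v1 + c2 • v2) ⬝ᵥ y)) *
      ind ((c1 • v1 + c2 • v2) ⬝ᵥ x = (c1 • v1 + c2 • v2) ⬝ᵥ y) := by
    intro c2
    rw [← Finset.mul_sum]; rfl
  rw [Finset.sum_congr rfl fun c2 _ => this c2, Finset.sum_comm]
  refine Finset.sum_le_sum fun x hx => ?_
  by_cases h : co y v2 x ≠ 0 ∧ 4 * (E.card : ℝ) / qq K ≤ ff E (uu y v1 v2 x) (uu y v1 v2 x ⬝ᵥ y)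
  · rw [ind_true h]
    have ha : 2 * co y v2 x / qf v1 ≠ 0 := div_ne_zero (mul_ne_zero k2 h.1) h1
    set a := 2 * co y v2 x / qf v1 with haa
    set b := (- (4 * co y v2 x * (v1 ⬝ᵥ v2) / (qf v1 * qf v2)) - 2 * co y v1 (RR y v2 x) / qf v2) with hb
    have hu : uu y v1 v2 x = a • v1 + b • v2 := rfl
    have hl : c1 / a ≠ 0 := div_ne_zero hc1 ha
    have hu' : c1 • v1 + (c1 / a * b) • v2 = (c1 / a) • uu y v1 v2 x := by
      rw [hu, smul_add, smul_smul, smul_smul, div_mul_cancel₀ _ ha]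
    have := Finset.single_le_sum (f := fun c2 => ind (c1 • v1 + c2 • v2 ≠ 0 ∧ 4 * (E.card : ℝ) / qq K ≤ ff E (c1 • v1 + c2 • v2) ((c1 • v1 + c2 • v2) ⬝ᵥ y)) *
      ind ((c1 • v1 + c2 • v2) ⬝ᵥ x = (c1 • v1 + c2 • v2) ⬝ᵥ y)) (s := univ)
      (fun _ _ => mul_nonneg (ind_nonneg _) (ind_nonneg _)) (Finset.mem_univ (c1 / a * b))
    refine le_trans (le_of_eq ?_) this
    rw [ind_true, ind_true, one_mul]
    · rw [hu', smul_dotProduct, smul_dotProduct]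
      have := uu_dot y v1 v2 x x h1 h2
      rw [mul_comm, sub_self, sub_eq_zero] at this
      rw [this]
    · constructor
      · intro h0
        exact hc1 (hi _ _ h0).1
      · rw [hu', smul_dotProduct, smul_eq_mul, ff_scale E _ hl]
        exact h.2
  · rw [ind_false h]
    exact Finset.sum_nonneg fun _ _ => mul_nonneg (ind_nonneg _) (ind_nonneg _)

lemma E5 (hK : ringChar K ≠ 2) (E : Finset (ι → K)) (V : Finset (ι → K)) (hV : ∀ v ∈ V, qf v ≠ 0) (y : ι → K) :
    ∑ v2 ∈ V, ∑ v1 ∈ V, ∑ x ∈ E, ind (indep v1 v2 ∧ (co y v2 x ≠ 0 ∧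
      4 * (E.card : ℝ) / qq K ≤ ff E (uu y v1 v2 x) (uu y v1 v2 x ⬝ᵥ y))) ≤ V.card * (qq K * rich E y) := by
  have hq := qq_gt_one (K := K)
  have hN : 0 < qq K - 1 := by linarith
  rw [← nsmul_eq_mul, ← Finset.sum_const]
  refine Finset.sum_le_sum fun v2 hv2 => ?_
  have a : ∀ v1 ∈ V, (qq K - 1) * ∑ x ∈ E, ind (indep v1 v2 ∧ (co y v2 x ≠ 0 ∧
      4 * (E.card : ℝ) / qq K ≤ ff E (uu y v1 v2 x) (uu y v1 v2 x ⬝ᵥ y))) ≤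
      ∑ c1 ∈ univ.erase (0 : K), ∑ c2 : K, richp E y (c1 • v1 + c2 • v2) := by
    intro v1 hv1
    by_cases hi : indep v1 v2
    · simpa only [hi, true_and] using E5a hK E y v1 v2 (hV v1 hv1) (hV v2 hv2) hi
    · simp only [hi, false_and]
      simp only [ind, if_false, Finset.sum_const_zero, mul_zero]
      exact Finset.sum_nonneg fun _ _ => Finset.sum_nonneg fun _ _ => richp_nonneg _ _ _
  have b := Finset.sum_le_sum a
  rw [← Finset.mul_sum] at b
  have c : ∑ v1 ∈ V, ∑ c1 ∈ univ.erase (0 : K), ∑ c2 : K, richp E y (c1 • v1 + c2 • v2) ≤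
      (qq K - 1) * (qq K * rich E y) := by
    rw [Finset.sum_comm, ← card_erase_K (K := K), ← nsmul_eq_mul, ← Finset.sum_const]
    refine Finset.sum_le_sum fun c1 hc1 => ?_
    have hc1 : c1 ≠ 0 := (Finset.mem_erase.1 hc1).1
    rw [Finset.sum_comm]
    have : qq K * rich E y = ∑ c2 : K, rich E y := by simp [qq]
    rw [this]
    refine Finset.sum_le_sum fun c2 _ => ?_
    rw [← richp_sum]
    have inj : Function.Injective (fun v1 : ι → K => c1 • v1 + c2 • v2) := by
      intro v v' h
      simp only [add_left_inj] at h
      exact smul_right_injective _ hc1 h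
    rw [← Finset.sum_image (f := fun u => richp E y u) (g := fun v1 : ι → K => c1 • v1 + c2 • v2) (s := V) inj.injOn]
    exact Finset.sum_le_sum_of_subset_of_nonneg (Finset.subset_univ _) fun _ _ _ => richp_nonneg _ _ _
  exact le_of_mul_le_mul_left (b.trans c) hN

/-- points of a finset in the span -/
def sp (V : Finset (ι → K)) (v1 v2 : ι → K) : Finset (ι → K) :=
  V.filter fun p => ∃ c1 c2 : K, p = c1 • v1 + c2 • v2

lemma pair_span (hK : ringChar K ≠ 2) (E G V' : Finset (ι → K)) (hV' : ∀ l : K, l ≠ 0 → ∀ v ∈ V', l • v ∈ V')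
    (y v1 v2 : ι → K) (h1 : qf v1 ≠ 0) (h2 : qf v2 ≠ 0) (hi : indep v1 v2) (hGE : G ⊆ E)
    (hG1 : ∀ x ∈ G, co y v2 x ≠ 0) (hG3 : ∀ x ∈ G, x - RR y v1 (RR y v2 x) ∈ V')
    (hG4 : ∀ x ∈ G, ff E (uu y v1 v2 x) (uu y v1 v2 x ⬝ᵥ y) < 4 * E.card / qq K) :
    (qq K - 1) * G.card ≤ (4 * E.card / qq K) * (sp V' v1 v2).card := by
  have hw : ∀ x, x - RR y v1 (RR y v2 x) = co y v1 (RR y v2 x) • v1 + co y v2 x • v2 := by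
    intro x
    rw [RR]
    nth_rw 1 [RR]
    abel
  rw [← card_erase_K (K := K), ← Nat.cast_mul, ← Finset.card_product]
  have hmap : ∀ p ∈ (univ.erase (0 : K)) ×ˢ G, p.1 • (p.2 - RR y v1 (RR y v2 p.2)) ∈ sp V' v1 v2 := by
    rintro ⟨l, x⟩ hp
    simp only [Finset.mem_product, Finset.mem_erase] at hp
    simp only [sp, Finset.mem_filter]
    refine ⟨hV' l hp.1.1 _ (hG3 x hp.2), l * co y v1 (RR y v2 x), l * co y v2 x, ?_⟩
    rw [hw, smul_add, smul_smul, smul_smul]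
  rw [Finset.card_eq_sum_card_fiberwise hmap]
  push_cast
  rw [mul_comm, ← nsmul_eq_mul, ← Finset.sum_const]
  refine Finset.sum_le_sum fun p hp => ?_
  by_cases hne : (((univ.erase (0 : K)) ×ˢ G).filter fun a => a.1 • (a.2 - RR y v1 (RR y v2 a.2)) = p).Nonempty
  · obtain ⟨⟨l0, x0⟩, h0⟩ := hne
    simp only [Finset.mem_filter, Finset.mem_product, Finset.mem_erase] at h0
    obtain ⟨⟨⟨hl0, -⟩, hx0⟩, hp0⟩ := h0
    refine le_trans ?_ (hG4 x0 hx0).le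
    rw [ff, sum_ind]
    norm_cast
    have co_eq : ∀ l x, l • (x - RR y v1 (RR y v2 x)) = p → l * co y v1 (RR y v2 x) = l0 * co y v1 (RR y v2 x0) ∧
        l * co y v2 x = l0 * co y v2 x0 := by
      intro l x hx
      rw [← hp0, hw, hw, smul_add, smul_add, smul_smul, smul_smul, smul_smul, smul_smul] at hx
      have := hi (l * co y v1 (RR y v2 x) - l0 * co y v1 (RR y v2 x0)) (l * co y v2 x - l0 * co y v2 x0) (by
        rw [sub_smul, sub_smul]
        rw [← sub_eq_zero] at hx
        rw [← hx]; abel)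
      exact ⟨sub_eq_zero.1 this.1, sub_eq_zero.1 this.2⟩
    apply Finset.card_le_card_of_injOn (fun a => a.2)
    · rintro ⟨l, x⟩ ha
      simp only [Finset.coe_filter, Finset.mem_product, Finset.mem_erase, Set.mem_ofPred_eq] at ha ⊢
      refine ⟨hGE ha.1.2, ?_⟩
      obtain ⟨c1, c2⟩ := co_eq l x ha.2
      rw [← sub_eq_zero, uu_dot y v1 v2 x0 x h1 h2]
      have hl := ha.1.1.1
      have : l * (l0 * (co y v2 x0 * co y v1 (RR y v2 x) - co y v1 (RR y v2 x0) * co y v2 x)) = 0 := by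
        linear_combination (l0 * co y v2 x0) * c1 - (l0 * co y v1 (RR y v2 x0)) * c2
      exact ((mul_eq_zero.1 ((mul_eq_zero.1 this).resolve_left hl)).resolve_left hl0)
    · rintro ⟨l, x⟩ ha ⟨l', x'⟩ ha' hxx
      simp only [Finset.coe_filter, Finset.mem_product, Finset.mem_erase, Set.mem_ofPred_eq] at ha ha' hxx
      subst hxx
      have e1 := (co_eq l x ha.2).2
      have e2 := (co_eq l' x ha'.2).2
      rw [← e2] at e1
      rw [mul_right_cancel₀ (hG1 x ha.1.2) e1]
  · rw [Finset.not_nonempty_iff_eq_empty.1 hne]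
    simp only [Finset.card_empty, Nat.cast_zero]
    have := qq_pos (K := K)
    positivity

end stageC
end PD


namespace PD
open Finset
set_option linter.unusedSectionVars false

section stageC2
variable {K : Type} [Field K] [Fintype K] [DecidableEq K]
variable {ι : Type} [Fintype ι] [DecidableEq ι]

lemma VV_scale (E : Finset (ι → K)) (η : ℝ) (y : ι → K) (l : K) (hl : l ≠ 0) (v : ι → K) (hv : v ∈ VV E η y) :
    l • v ∈ VV E η y := by
  rw [VV_mem] at hv ⊢
  rw [smul_dotProduct, smul_eq_mul, HH_scale E η l hl]
  exact hv

lemma dep_count (V : Finset (ι → K)) (v2 : ι → K) (h2 : v2 ≠ 0) :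
    ∑ v1 ∈ V, ind (¬ indep v1 v2) ≤ qq K := by
  rw [sum_ind, qq, ← Finset.card_univ]
  norm_cast
  refine le_trans (Finset.card_le_card (t := (univ : Finset K).image (fun l => l • v2)) ?_) Finset.card_image_le
  intro v1 hv1
  obtain ⟨-, h⟩ := Finset.mem_filter.1 hv1
  unfold indep at h
  push Not at h
  obtain ⟨c1, c2, h0, hc⟩ := h
  have hc1 : c1 ≠ 0 := by
    intro h1
    apply hc h1
    rw [h1, zero_smul, zero_add] at h0
    exact (smul_eq_zero.1 h0).resolve_right h2
  simp only [Finset.mem_image, Finset.mem_univ, true_and]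
  refine ⟨- (c1⁻¹ * c2), ?_⟩
  rw [neg_smul, mul_smul, eq_neg_of_add_eq_zero_right h0, smul_neg, neg_neg, smul_smul, inv_mul_cancel₀ hc1, one_smul]

set_option maxHeartbeats 1000000 in
lemma small_pt (hK : ringChar K ≠ 2) (E V V' : Finset (ι → K)) (hV' : ∀ l : K, l ≠ 0 → ∀ v ∈ V', l • v ∈ V')
    (hn : (0 : ℝ) < E.card)
    (y v1 v2 : ι → K) (h1 : qf v1 ≠ 0) (h2 : qf v2 ≠ 0) (hsub : V' ⊆ V) :
    ind (((sp V' v1 v2).card : ℝ) < qq K ^ 2 / 16) ≤ ind (¬ indep v1 v2) + (2 / (E.card : ℝ)) *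
     (∑ x ∈ E, ind (¬ (v2 ⬝ᵥ x ≠ v2 ⬝ᵥ y ∧ RR y v2 x ∈ E)) +
      ∑ x ∈ E, ind (RR y v2 x ∈ E ∧ ¬ (v1 ⬝ᵥ (RR y v2 x) ≠ v1 ⬝ᵥ y ∧ RR y v1 (RR y v2 x) ∈ E)) +
      ∑ x ∈ E, ind (v1 ⬝ᵥ (RR y v2 x) ≠ v1 ⬝ᵥ y ∧ (RR y v1 (RR y v2 x) ∈ E ∧
        qf (RR y v1 (RR y v2 x) - y) = qf (x - y) ∧ x - RR y v1 (RR y v2 x) ∉ V)) +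
      ∑ x ∈ E, ind (v1 ⬝ᵥ (RR y v2 x) ≠ v1 ⬝ᵥ y ∧
        (qf (RR y v1 (RR y v2 x) - y) = qf (x - y) ∧ x - RR y v1 (RR y v2 x) ∈ V \ V')) +
      ∑ x ∈ E, ind (indep v1 v2 ∧ (co y v2 x ≠ 0 ∧
        4 * (E.card : ℝ) / qq K ≤ ff E (uu y v1 v2 x) (uu y v1 v2 x ⬝ᵥ y)))) := by
  have hq := qq_gt_one (K := K)
  have hq2 : 2 ≤ qq K := by
    unfold qq at hq ⊢
    have : 1 < Fintype.card K := by exact_mod_cast hq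
    exact_mod_cast this
  have hq0 := qq_pos (K := K)
  have nn : ∀ p : (ι → K) → Prop, ∀ [DecidablePred p], 0 ≤ ∑ x ∈ E, ind (p x) := fun p _ =>
    Finset.sum_nonneg fun _ _ => ind_nonneg _
  set n : ℝ := (E.card : ℝ) with hnn
  set q := qq K
  by_cases hi : indep v1 v2
  swap
  · have a1 := ind_le_one (((sp V' v1 v2).card : ℝ) < q ^ 2 / 16)
    rw [ind_true hi]
    refine a1.trans (le_add_of_nonneg_right ?_)
    apply mul_nonneg (by positivity)
    have := nn (fun x => ¬ (v2 ⬝ᵥ x ≠ v2 ⬝ᵥ y ∧ RR y v2 x ∈ E))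
    refine add_nonneg (add_nonneg (add_nonneg (add_nonneg ?_ ?_) ?_) ?_) ?_ <;>
      exact Finset.sum_nonneg fun _ _ => ind_nonneg _
  by_cases hs : ((sp V' v1 v2).card : ℝ) < q ^ 2 / 16
  swap
  · rw [ind_false hs, ind_false (not_not.2 hi)]
    rw [zero_add]
    apply mul_nonneg (by positivity)
    refine add_nonneg (add_nonneg (add_nonneg (add_nonneg ?_ ?_) ?_) ?_) ?_ <;>
      exact Finset.sum_nonneg fun _ _ => ind_nonneg _
  rw [ind_true hs, ind_false (not_not.2 hi), zero_add]
  let P : (ι → K) → Prop := fun x => co y v2 x ≠ 0 ∧ x - RR y v1 (RR y v2 x) ∈ V' ∧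
    ff E (uu y v1 v2 x) (uu y v1 v2 x ⬝ᵥ y) < 4 * n / q
  have hdec : DecidablePred P := fun _ => Classical.dec _
  have hG := pair_span hK E (E.filter P) V' hV' y v1 v2 h1 h2 hi (Finset.filter_subset _ _)
    (fun x hx => ((Finset.mem_filter.1 hx).2).1) (fun x hx => ((Finset.mem_filter.1 hx).2).2.1)
    (fun x hx => ((Finset.mem_filter.1 hx).2).2.2)
  have hsmall : ((E.filter P).card : ℝ) ≤ n / 2 := by
    by_contra hc
    have hc := not_le.1 hc
    have a1 : (q - 1) * (n / 2) ≤ (4 * n / q) * (sp V' v1 v2).card :=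
      (mul_le_mul_of_nonneg_left hc.le (by linarith)).trans hG
    have a2 : (4 * n / q) * (sp V' v1 v2).card < (4 * n / q) * (q ^ 2 / 16) :=
      mul_lt_mul_of_pos_left hs (by positivity)
    have a3 : (4 * n / q) * (q ^ 2 / 16) = n * q / 4 := by field_simp; norm_num
    nlinarith
  have hbig : n / 2 ≤ ∑ x ∈ E, ind (¬ P x) := by
    simp only [ind_not, Finset.sum_sub_distrib, Finset.sum_const, nsmul_eq_mul, mul_one]
    rw [sum_ind]; linarith
  rw [← Finset.sum_add_distrib, ← Finset.sum_add_distrib, ← Finset.sum_add_distrib, ← Finset.sum_add_distrib]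
  have hle : ∑ x ∈ E, ind (¬ P x) ≤ ∑ x ∈ E, (ind (¬ (v2 ⬝ᵥ x ≠ v2 ⬝ᵥ y ∧ RR y v2 x ∈ E)) +
      ind (RR y v2 x ∈ E ∧ ¬ (v1 ⬝ᵥ (RR y v2 x) ≠ v1 ⬝ᵥ y ∧ RR y v1 (RR y v2 x) ∈ E)) +
      ind (v1 ⬝ᵥ (RR y v2 x) ≠ v1 ⬝ᵥ y ∧ (RR y v1 (RR y v2 x) ∈ E ∧
        qf (RR y v1 (RR y v2 x) - y) = qf (x - y) ∧ x - RR y v1 (RR y v2 x) ∉ V)) +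
      ind (v1 ⬝ᵥ (RR y v2 x) ≠ v1 ⬝ᵥ y ∧
        (qf (RR y v1 (RR y v2 x) - y) = qf (x - y) ∧ x - RR y v1 (RR y v2 x) ∈ V \ V')) +
      ind (indep v1 v2 ∧ (co y v2 x ≠ 0 ∧
        4 * n / q ≤ ff E (uu y v1 v2 x) (uu y v1 v2 x ⬝ᵥ y)))) := by
    refine Finset.sum_le_sum fun x hx => ?_
    have hqf : qf (RR y v1 (RR y v2 x) - y) = qf (x - y) := by rw [qf_RR y v1 _ h1, qf_RR y v2 _ h2]
    have hco := co_ne hK y v2 x h2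
    set p1 := (v2 ⬝ᵥ x ≠ v2 ⬝ᵥ y ∧ RR y v2 x ∈ E) with hp1
    set p2 := (v1 ⬝ᵥ (RR y v2 x) ≠ v1 ⬝ᵥ y ∧ RR y v1 (RR y v2 x) ∈ E) with hp2
    have z1 := ind_nonneg (¬ p1)
    have z2 := ind_nonneg (RR y v2 x ∈ E ∧ ¬ p2)
    have z3 := ind_nonneg (v1 ⬝ᵥ (RR y v2 x) ≠ v1 ⬝ᵥ y ∧ (RR y v1 (RR y v2 x) ∈ E ∧
        qf (RR y v1 (RR y v2 x) - y) = qf (x - y) ∧ x - RR y v1 (RR y v2 x) ∉ V))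
    have z4 := ind_nonneg (v1 ⬝ᵥ (RR y v2 x) ≠ v1 ⬝ᵥ y ∧
        (qf (RR y v1 (RR y v2 x) - y) = qf (x - y) ∧ x - RR y v1 (RR y v2 x) ∈ V \ V'))
    have z5 := ind_nonneg (indep v1 v2 ∧ (co y v2 x ≠ 0 ∧
        4 * n / q ≤ ff E (uu y v1 v2 x) (uu y v1 v2 x ⬝ᵥ y)))
    have z0 := ind_le_one (¬ P x)
    by_cases k1 : p1
    swap
    · rw [ind_true k1] at *; linarith
    by_cases k2 : p2
    swap
    · rw [ind_true (p := RR y v2 x ∈ E ∧ ¬ p2) ⟨k1.2, k2⟩] at *; linarith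
    by_cases k3 : x - RR y v1 (RR y v2 x) ∈ V
    swap
    · rw [ind_true (p := (v1 ⬝ᵥ (RR y v2 x) ≠ v1 ⬝ᵥ y ∧ (RR y v1 (RR y v2 x) ∈ E ∧
        qf (RR y v1 (RR y v2 x) - y) = qf (x - y) ∧ x - RR y v1 (RR y v2 x) ∉ V))) ⟨k2.1, k2.2, hqf, k3⟩] at *
      linarith
    by_cases k4 : x - RR y v1 (RR y v2 x) ∈ V'
    swap
    · rw [ind_true (p := (v1 ⬝ᵥ (RR y v2 x) ≠ v1 ⬝ᵥ y ∧
        (qf (RR y v1 (RR y v2 x) - y) = qf (x - y) ∧ x - RR y v1 (RR y v2 x) ∈ V \ V')))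
        ⟨k2.1, hqf, Finset.mem_sdiff.2 ⟨k3, k4⟩⟩] at *
      linarith
    by_cases k5 : 4 * n / q ≤ ff E (uu y v1 v2 x) (uu y v1 v2 x ⬝ᵥ y)
    · rw [ind_true (p := (indep v1 v2 ∧ (co y v2 x ≠ 0 ∧
        4 * n / q ≤ ff E (uu y v1 v2 x) (uu y v1 v2 x ⬝ᵥ y)))) ⟨hi, hco.2 k1.1, k5⟩] at *
      linarith
    · rw [ind_false (p := ¬ P x) (not_not.2 ⟨hco.2 k1.1, k4, not_le.1 k5⟩)]
      linarith
  have := mul_le_mul_of_nonneg_left (hbig.trans hle) (show 0 ≤ 2 / n by positivity)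
  have e : 2 / n * (n / 2) = 1 := by field_simp
  rw [e] at this
  exact this

set_option maxHeartbeats 1000000 in
lemma lemC (hK : ringChar K ≠ 2) (E : Finset (ι → K)) (η : ℝ) (h0 : 0 < η) (h1 : η ≤ 1 / 100) (y : ι → K)
    (hb : badS E η y ≤ 40 * η * (E.card : ℝ) ^ 2 / qq K)
    (hr : rich E y ≤ 40 * (qq K - 1) * η ^ 2 * (E.card : ℝ) ^ 2 / qq K ^ 2)
    (hV : (E.card : ℝ) / 2 ≤ (VV E η y).card) (hn : (0 : ℝ) < E.card)
    (hqn : qq K ≤ η * (E.card : ℝ) / 2)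
    (V' : Finset (ι → K)) (hV' : ∀ l : K, l ≠ 0 → ∀ v ∈ V', l • v ∈ V') (hsub : V' ⊆ VV E η y) :
    ∑ v2 ∈ VV E η y, ∑ v1 ∈ VV E η y, ind (((sp V' v1 v2).card : ℝ) < qq K ^ 2 / 16) ≤
      200 * η * ((VV E η y).card : ℝ) ^ 2 + 2 * (VV E η y).card * (VV E η y \ V').card := by
  have hq := qq_gt_one (K := K)
  have hq0 := qq_pos (K := K)
  have hVq : ∀ v ∈ VV E η y, qf v ≠ 0 := fun v hv => (VV_mem.1 hv).1
  have hV0 : ∀ v ∈ VV E η y, v ≠ 0 := by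
    rintro v hv rfl
    apply hVq _ hv; simp [qf]
  have S0 : ∑ v2 ∈ VV E η y, ∑ v1 ∈ VV E η y, ind (¬ indep v1 v2) ≤ (VV E η y).card * qq K := by
    rw [← nsmul_eq_mul, ← Finset.sum_const]
    exact Finset.sum_le_sum fun v2 h2 => dep_count _ v2 (hV0 v2 h2)
  have S1 : ∑ v2 ∈ VV E η y, ∑ v1 ∈ VV E η y, ∑ x ∈ E, ind (¬ (v2 ⬝ᵥ x ≠ v2 ⬝ᵥ y ∧ RR y v2 x ∈ E)) ≤
      (VV E η y).card * ((VV E η y).card * (η * E.card)) := by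
    rw [← nsmul_eq_mul, ← Finset.sum_const]
    refine Finset.sum_le_sum fun v2 h2 => ?_
    rw [← nsmul_eq_mul, ← Finset.sum_const]
    exact Finset.sum_le_sum fun v1 h1 => E1 E η y v2 h2
  have S2 : ∑ v2 ∈ VV E η y, ∑ v1 ∈ VV E η y, ∑ x ∈ E, ind (RR y v2 x ∈ E ∧ ¬ (v1 ⬝ᵥ (RR y v2 x) ≠ v1 ⬝ᵥ y ∧ RR y v1 (RR y v2 x) ∈ E)) ≤
      (VV E η y).card * ((VV E η y).card * (η * E.card)) := by
    rw [← nsmul_eq_mul, ← Finset.sum_const]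
    refine Finset.sum_le_sum fun v2 h2 => ?_
    rw [← nsmul_eq_mul, ← Finset.sum_const]
    exact Finset.sum_le_sum fun v1 h1 => E2 E η y v1 v2 h1 (hVq v2 h2)
  have S3 : ∑ v2 ∈ VV E η y, ∑ v1 ∈ VV E η y, ∑ x ∈ E, ind (v1 ⬝ᵥ (RR y v2 x) ≠ v1 ⬝ᵥ y ∧ (RR y v1 (RR y v2 x) ∈ E ∧
        qf (RR y v1 (RR y v2 x) - y) = qf (x - y) ∧ x - RR y v1 (RR y v2 x) ∉ VV E η y)) ≤
      (VV E η y).card * ((qq K - 1) * badS E η y) := by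
    rw [← nsmul_eq_mul, ← Finset.sum_const]
    exact Finset.sum_le_sum fun v2 h2 => E3 hK E η y v2 (hVq v2 h2)
  have S4 : ∑ v2 ∈ VV E η y, ∑ v1 ∈ VV E η y, ∑ x ∈ E, ind (v1 ⬝ᵥ (RR y v2 x) ≠ v1 ⬝ᵥ y ∧
        (qf (RR y v1 (RR y v2 x) - y) = qf (x - y) ∧ x - RR y v1 (RR y v2 x) ∈ VV E η y \ V')) ≤
      (VV E η y).card * (E.card * (VV E η y \ V').card) := by
    rw [← nsmul_eq_mul, ← Finset.sum_const]
    refine Finset.sum_le_sum fun v2 h2 => E4 hK E (VV E η y) (VV E η y \ V') hVq ?_ ?_ y v2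
    · intro l hl v hv
      rw [Finset.mem_sdiff] at hv ⊢
      refine ⟨VV_scale E η y l hl v hv.1, fun h => hv.2 ?_⟩
      have := hV' l⁻¹ (inv_ne_zero hl) _ h
      rwa [smul_smul, inv_mul_cancel₀ hl, one_smul] at this
    · intro v hv
      exact hVq v (Finset.mem_sdiff.1 hv).1
  have S5 := E5 hK E (VV E η y) hVq y
  have T := Finset.sum_le_sum (s := VV E η y) fun v2 h2 => Finset.sum_le_sum (s := VV E η y) fun v1 h1 =>
    small_pt hK E (VV E η y) V' hV' hn y v1 v2 (hVq v1 h1) (hVq v2 h2) hsub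
  simp only [Finset.sum_add_distrib, ← Finset.mul_sum] at T
  set n : ℝ := (E.card : ℝ) with hnn
  set q := qq K
  set V : ℝ := ((VV E η y).card : ℝ) with hVV
  set U : ℝ := ((VV E η y \ V').card : ℝ)
  have V0 : 0 ≤ V := by positivity
  have b3 : V * ((q - 1) * badS E η y) ≤ n * (80 * η * V ^ 2) := by
    have : (q - 1) * badS E η y ≤ 40 * η * n ^ 2 := by
      have t := mul_le_mul_of_nonneg_left hb (show 0 ≤ q - 1 by linarith)
      refine t.trans ?_
      rw [← mul_div_assoc, div_le_iff₀ hq0]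
      nlinarith [show 0 ≤ 40 * η * n ^ 2 by positivity]
    have t := mul_le_mul_of_nonneg_left this V0
    have t2 : V * (40 * η * n ^ 2) = (40 * η * n * V) * n := by ring
    have t3 : (40 * η * n * V) * n ≤ (40 * η * n * V) * (2 * V) :=
      mul_le_mul_of_nonneg_left (by linarith) (by positivity)
    nlinarith
  have b5 : V * (q * rich E y) ≤ n * (η * V ^ 2) := by
    have : q * rich E y ≤ 40 * η ^ 2 * n ^ 2 := by
      have t := mul_le_mul_of_nonneg_left hr hq0.le
      refine t.trans ?_
      have : q * (40 * (q - 1) * η ^ 2 * n ^ 2 / q ^ 2) = (40 * (q - 1) * η ^ 2 * n ^ 2) / q := by field_simp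
      rw [this, div_le_iff₀ hq0]
      nlinarith [show 0 ≤ 40 * η ^ 2 * n ^ 2 by positivity]
    have t := mul_le_mul_of_nonneg_left this V0
    have t2 : V * (40 * η ^ 2 * n ^ 2) = (40 * η ^ 2 * n * V) * n := by ring
    have t3 : (40 * η ^ 2 * n * V) * n ≤ (40 * η ^ 2 * n * V) * (2 * V) :=
      mul_le_mul_of_nonneg_left (by linarith) (by positivity)
    have t4 : (80 * η) * (η * n * V ^ 2) ≤ 1 * (η * n * V ^ 2) :=
      mul_le_mul_of_nonneg_right (by linarith) (by positivity)
    nlinarith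
  have b0 : V * q ≤ η * V ^ 2 := by
    have : q ≤ η * V := by nlinarith
    nlinarith
  have hm := mul_le_mul_of_nonneg_left
    (add_le_add (add_le_add (add_le_add (add_le_add S1 S2) (S3.trans b3)) S4) (S5.trans b5))
    (show 0 ≤ 2 / n by positivity)
  have e : 2 / n * (V * (V * (η * n)) + V * (V * (η * n)) + n * (80 * η * V ^ 2) + V * (n * U) + n * (η * V ^ 2)) =
    166 * (η * V ^ 2) + 2 * V * U := by field_simp; ring
  rw [e] at hm
  have hpos : 0 ≤ η * V ^ 2 := by positivity
  refine T.trans ((add_le_add (S0.trans b0) hm).trans ?_)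
  linarith

end stageC2
end PD


namespace PD
open Finset
set_option linter.unusedSectionVars false

section stageD
variable {K : Type} [Field K] [Fintype K] [DecidableEq K]
variable {ι : Type} [Fintype ι] [DecidableEq ι]

def ScaleC (V : Finset (ι → K)) : Prop := ∀ l : K, l ≠ 0 → ∀ v ∈ V, l • v ∈ V

noncomputable def Vs (V : Finset (ι → K)) : ℕ → Finset (ι → K)
  | 0 => V
  | j + 1 => V.filter fun v2 => ∑ v1 ∈ V, ind (((sp (Vs V j) v1 v2).card : ℝ) < qq K ^ 2 / 16) ≤ (V.card : ℝ) / 4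

lemma Vs_sub (V : Finset (ι → K)) (j : ℕ) : Vs V j ⊆ V := by
  cases j with
  | zero => exact fun _ h => h
  | succ j => rw [Vs]; exact Finset.filter_subset _ _

lemma sp_scale (V' : Finset (ι → K)) (v1 v2 : ι → K) (l : K) (hl : l ≠ 0) : sp V' v1 (l • v2) = sp V' v1 v2 := by
  ext p
  simp only [sp, Finset.mem_filter]
  refine and_congr_right fun _ => ?_
  constructor
  · rintro ⟨c1, c2, h⟩
    exact ⟨c1, c2 * l, by rw [h, smul_smul]⟩
  · rintro ⟨c1, c2, h⟩
    exact ⟨c1, c2 * l⁻¹, by rw [h, smul_smul, inv_mul_cancel_right₀ hl]⟩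

lemma Vs_scale (V : Finset (ι → K)) (hV : ScaleC V) (j : ℕ) : ScaleC (Vs V j) := by
  cases j with
  | zero => exact hV
  | succ j =>
    intro l hl v hv
    rw [Vs, Finset.mem_filter] at hv ⊢
    refine ⟨hV l hl v hv.1, ?_⟩
    simp only [sp_scale _ _ _ l hl]
    exact hv.2

lemma Vs_bound (V : Finset (ι → K)) (hV : ScaleC V) (hne : V.Nonempty) (η : ℝ)
    (hC : ∀ V' : Finset (ι → K), ScaleC V' → V' ⊆ V →
      ∑ v2 ∈ V, ∑ v1 ∈ V, ind (((sp V' v1 v2).card : ℝ) < qq K ^ 2 / 16) ≤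
      200 * η * (V.card : ℝ) ^ 2 + 2 * V.card * (V \ V').card) (h0 : 0 < η) (j : ℕ) :
    ((V \ Vs V j).card : ℝ) ≤ 115 * (8 ^ j - 1) * η * V.card := by
  have hpos : (0 : ℝ) < V.card := by exact_mod_cast hne.card_pos
  induction j with
  | zero => simp [Vs]
  | succ j ih =>
    have h := hC (Vs V j) (Vs_scale V hV j) (Vs_sub V j)
    have h1 : ((V \ Vs V (j + 1)).card : ℝ) * (V.card / 4) ≤
        ∑ v2 ∈ V, ∑ v1 ∈ V, ind (((sp (Vs V j) v1 v2).card : ℝ) < qq K ^ 2 / 16) := by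
      rw [← nsmul_eq_mul, ← Finset.sum_const]
      refine le_trans (Finset.sum_le_sum fun v2 hv2 => ?_)
        (Finset.sum_le_sum_of_subset_of_nonneg (Finset.sdiff_subset (s := V) (t := Vs V (j + 1)))
          fun _ _ _ => Finset.sum_nonneg fun _ _ => ind_nonneg _)
      rw [Finset.mem_sdiff, Vs, Finset.mem_filter] at hv2
      by_contra hc
      exact hv2.2 ⟨hv2.1, (not_le.1 hc).le⟩
    set A : ℝ := ((V \ Vs V (j + 1)).card : ℝ)
    set B : ℝ := ((V \ Vs V j).card : ℝ)
    set v : ℝ := (V.card : ℝ)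
    have h2 : A * v ≤ (800 * η * v + 8 * B) * v := by nlinarith
    have h3 := le_of_mul_le_mul_right h2 hpos
    have : 0 < η * v := by positivity
    rw [pow_succ]
    nlinarith

def Clo (W : Finset (ι → K)) : Prop := ∀ a ∈ W, ∀ b ∈ W, ∀ s t : K, s • a + t • b ∈ W

lemma stepD (V : Finset (ι → K)) (i : ℕ) (hne : V.Nonempty) (hq32 : 32 ≤ qq K)
    (W : Finset (ι → K)) (hW : Clo W) (hsm : 4 * (W.card : ℝ) < V.card) :
    ∃ W' : Finset (ι → K), Clo W' ∧ (W'.card : ℝ) ≤ qq K * W.card ∧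
      ((W ∩ Vs V (i + 1)).card : ℝ) * (qq K / 64) ≤ (W' ∩ Vs V i).card := by
  have hq0 := qq_pos (K := K)
  have hpos : (0 : ℝ) < V.card := by exact_mod_cast hne.card_pos
  set X := W ∩ Vs V (i + 1) with hX
  by_cases hXe : X = ∅
  · refine ⟨W, hW, ?_, ?_⟩
    · nlinarith [show (0 : ℝ) ≤ W.card by positivity]
    · rw [hXe]; simp
  have hX0 : (0 : ℝ) < X.card := by exact_mod_cast (Finset.nonempty_iff_ne_empty.2 hXe).card_pos
  have hsum : ∑ v ∈ V \ W, ∑ u ∈ X, ind (((sp (Vs V i) v u).card : ℝ) < qq K ^ 2 / 16) ≤ X.card * (V.card / 4) := by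
    rw [Finset.sum_comm, ← nsmul_eq_mul, ← Finset.sum_const]
    refine Finset.sum_le_sum fun u hu => ?_
    have hu' := (Finset.mem_inter.1 hu).2
    rw [Vs, Finset.mem_filter] at hu'
    exact le_trans (Finset.sum_le_sum_of_subset_of_nonneg (Finset.sdiff_subset) fun _ _ _ => ind_nonneg _) hu'.2
  have hVW : (V.card : ℝ) * (3 / 4) ≤ (V \ W).card := by
    have : (V.card : ℝ) ≤ (V \ W).card + W.card := by
      have := Finset.card_le_card_sdiff_add_card (s := V) (t := W)
      exact_mod_cast this
    linarith
  obtain ⟨v, hv, hvX⟩ : ∃ v ∈ V \ W, ∑ u ∈ X, ind (((sp (Vs V i) v u).card : ℝ) < qq K ^ 2 / 16) ≤ X.card / 2 := by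
    by_contra hcon
    push Not at hcon
    have := Finset.sum_le_sum fun v hv => (hcon v hv).le
    rw [Finset.sum_const, nsmul_eq_mul] at this
    nlinarith [mul_pos hX0 hpos]
  have hvW : v ∉ W := (Finset.mem_sdiff.1 hv).2
  let W' : Finset (ι → K) := (W ×ˢ (univ : Finset K)).image fun p => p.1 + p.2 • v
  have hW' : ∀ p, p ∈ W' ↔ ∃ w ∈ W, ∃ c : K, p = w + c • v := by
    intro p
    simp only [W', Finset.mem_image, Finset.mem_product, Finset.mem_univ, and_true, Prod.exists]
    constructor
    · rintro ⟨w, c, hw, rfl⟩; exact ⟨w, hw, c, rfl⟩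
    · rintro ⟨w, hw, c, rfl⟩; exact ⟨w, c, hw, rfl⟩
  refine ⟨W', ?_, ?_, ?_⟩
  · intro a ha b hb s t
    obtain ⟨w, hw, c, rfl⟩ := (hW' a).1 ha
    obtain ⟨w2, hw2, c2, rfl⟩ := (hW' b).1 hb
    rw [hW']
    refine ⟨s • w + t • w2, hW w hw w2 hw2 s t, s * c + t * c2, ?_⟩
    simp only [smul_add, add_smul, smul_smul]
    abel
  · have : W'.card ≤ (W ×ˢ (univ : Finset K)).card := Finset.card_image_le
    rw [Finset.card_product, Finset.card_univ] at this
    rw [mul_comm]; unfold qq; exact_mod_cast this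
  let Z : (ι → K) → Finset (ι → K) := fun u => (Vs V i).filter fun p => ∃ c1 c2 : K, c2 ≠ 0 ∧ p = c1 • v + c2 • u
  let Y := X.filter fun u => ¬ (((sp (Vs V i) v u).card : ℝ) < qq K ^ 2 / 16)
  have hY : (X.card : ℝ) / 2 ≤ Y.card := by
    have e : (Y.card : ℝ) = ∑ u ∈ X, (1 - ind (((sp (Vs V i) v u).card : ℝ) < qq K ^ 2 / 16)) := by
      simp only [← ind_not]
      rw [sum_ind]
    rw [e, Finset.sum_sub_distrib]
    simp only [Finset.sum_const, nsmul_eq_mul, mul_one]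
    linarith
  have hZ : ∀ u ∈ Y, qq K ^ 2 / 32 ≤ ((Z u).card : ℝ) := by
    intro u hu
    have hu2 := not_lt.1 (Finset.mem_filter.1 hu).2
    have hsub : sp (Vs V i) v u ⊆ Z u ∪ (univ : Finset K).image fun c => c • v := by
      intro p hp
      obtain ⟨hp1, c1, c2, hp2⟩ := Finset.mem_filter.1 hp
      rw [Finset.mem_union]
      by_cases hc : c2 = 0
      · right
        simp only [Finset.mem_image, Finset.mem_univ, true_and]
        exact ⟨c1, by rw [hp2, hc, zero_smul, add_zero]⟩
      · left
        exact Finset.mem_filter.2 ⟨hp1, c1, c2, hc, hp2⟩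
    have h1 := (Finset.card_le_card hsub).trans (Finset.card_union_le _ _)
    have h2 : ((univ : Finset K).image fun c => c • v).card ≤ Fintype.card K := by
      rw [← Finset.card_univ]; exact Finset.card_image_le
    have h3 : ((sp (Vs V i) v u).card : ℝ) ≤ (Z u).card + qq K := by
      unfold qq; exact_mod_cast h1.trans (Nat.add_le_add_left h2 _)
    nlinarith
  have hdc : ∑ u ∈ Y, ((Z u).card : ℝ) ≤ (W' ∩ Vs V i).card * qq K := by
    have e : ∀ u ∈ Y, ((Z u).card : ℝ) = ∑ p ∈ W' ∩ Vs V i, ind (p ∈ Z u) := by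
      intro u hu
      rw [sum_ind]
      congr 2
      ext p
      simp only [Finset.mem_filter, Finset.mem_inter]
      refine ⟨fun h => ⟨⟨?_, (Finset.mem_filter.1 h).1⟩, h⟩, fun h => h.2⟩
      obtain ⟨-, c1, c2, -, hp⟩ := Finset.mem_filter.1 h
      rw [hW']
      have huW : u ∈ W := (Finset.mem_inter.1 (Finset.mem_filter.1 hu).1).1
      refine ⟨c2 • u, ?_, c1, by rw [hp, add_comm]⟩
      simpa using hW u huW u huW c2 0
    rw [Finset.sum_congr rfl e, Finset.sum_comm, ← nsmul_eq_mul, ← Finset.sum_const]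
    refine Finset.sum_le_sum fun p hp => ?_
    rw [sum_ind]
    by_cases hne : (Y.filter fun u => p ∈ Z u).Nonempty
    swap
    · rw [Finset.not_nonempty_iff_eq_empty.1 hne]; simp [hq0.le]
    obtain ⟨u0, hu0⟩ := hne
    obtain ⟨hu0Y, hu0Z⟩ := Finset.mem_filter.1 hu0
    obtain ⟨-, a1, a2, ha2, hpa⟩ := Finset.mem_filter.1 hu0Z
    have hu0W : u0 ∈ W := (Finset.mem_inter.1 (Finset.mem_filter.1 hu0Y).1).1
    have hsub : (Y.filter fun u => p ∈ Z u) ⊆ (univ : Finset K).image fun c => c • u0 := by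
      intro u hu
      obtain ⟨huY, huZ⟩ := Finset.mem_filter.1 hu
      obtain ⟨-, c1, c2, hc2, hpc⟩ := Finset.mem_filter.1 huZ
      have huW : u ∈ W := (Finset.mem_inter.1 (Finset.mem_filter.1 huY).1).1
      have heq : (a1 - c1) • v = c2 • u + (-a2) • u0 := by
        rw [hpa] at hpc
        rw [sub_smul, neg_smul, sub_eq_iff_eq_add, add_right_comm, ← sub_eq_add_neg, eq_sub_iff_add_eq, hpc]
        abel
      have hmem : (a1 - c1) • v ∈ W := by rw [heq]; exact hW u huW u0 hu0W _ _
      have hac : a1 - c1 = 0 := by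
        by_contra hne
        apply hvW
        have := hW _ hmem _ hmem (a1 - c1)⁻¹ 0
        rwa [zero_smul, add_zero, smul_smul, inv_mul_cancel₀ hne, one_smul] at this
      rw [hac, zero_smul, neg_smul] at heq
      have heq2 : c2 • u = a2 • u0 := by
        rw [← sub_eq_add_neg] at heq
        exact (sub_eq_zero.1 heq.symm)
      simp only [Finset.mem_image, Finset.mem_univ, true_and]
      refine ⟨c2⁻¹ * a2, ?_⟩
      rw [mul_smul, ← heq2, smul_smul, inv_mul_cancel₀ hc2, one_smul]
    have h2 : ((univ : Finset K).image fun c => c • u0).card ≤ Fintype.card K := by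
      rw [← Finset.card_univ]; exact Finset.card_image_le
    unfold qq
    exact_mod_cast (Finset.card_le_card hsub).trans h2
  have hlow : (Y.card : ℝ) * (qq K ^ 2 / 32) ≤ ∑ u ∈ Y, ((Z u).card : ℝ) := by
    rw [← nsmul_eq_mul, ← Finset.sum_const]
    exact Finset.sum_le_sum hZ
  have h5 : (X.card : ℝ) / 2 * (qq K ^ 2 / 32) ≤ Y.card * (qq K ^ 2 / 32) :=
    mul_le_mul_of_nonneg_right hY (by positivity)
  have h6 : ((X.card : ℝ) * (qq K / 64)) * qq K ≤ (W' ∩ Vs V i).card * qq K := by nlinarith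
  exact le_of_mul_le_mul_right h6 hq0

lemma stageDmain (V : Finset (ι → K)) (hV : ScaleC V) (hne : V.Nonempty) (hz : (0 : ι → K) ∉ V) (η : ℝ)
    (hC : ∀ V' : Finset (ι → K), ScaleC V' → V' ⊆ V →
      ∑ v2 ∈ V, ∑ v1 ∈ V, ind (((sp V' v1 v2).card : ℝ) < qq K ^ 2 / 16) ≤
      200 * η * (V.card : ℝ) ^ 2 + 2 * V.card * (V \ V').card) (h0 : 0 < η)
    (hη : η * (1000 * 8 ^ (Fintype.card ι)) ≤ 1) (hq32 : 32 ≤ qq K) (hd : 1 ≤ Fintype.card ι) :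
    ∃ j ≤ Fintype.card ι, (qq K / 64) ^ j ≤ V.card ∧ (V.card : ℝ) ≤ 4 * qq K ^ j := by
  have hq0 := qq_pos (K := K)
  have hpos : (0 : ℝ) < V.card := by exact_mod_cast hne.card_pos
  set d := Fintype.card ι with hdd
  by_contra hcon
  push Not at hcon
  have claim : ∀ j i, i + (j + 1) = d + 1 → j + 1 ≤ d → ∃ W : Finset (ι → K), Clo W ∧ (W.card : ℝ) ≤ qq K ^ (j + 1) ∧
      (qq K / 64) ^ (j + 1) ≤ (W ∩ Vs V i).card := by
    intro j
    induction j with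
    | zero =>
      intro i hi _
      have hi : i = d := by omega
      subst hi
      have hb := Vs_bound V hV hne η hC h0 d
      have hne2 : (Vs V d).Nonempty := by
        by_contra hemp
        rw [Finset.not_nonempty_iff_eq_empty.1 hemp, Finset.sdiff_empty] at hb
        have : 115 * (8 ^ d - 1) * η < 1 := by nlinarith [pow_pos (show (0:ℝ) < 8 by norm_num) d]
        nlinarith
      obtain ⟨v0, hv0⟩ := hne2
      have hv00 : v0 ≠ 0 := by rintro rfl; exact hz (Vs_sub V d hv0)
      refine ⟨(univ : Finset K).image fun c => c • v0, ?_, ?_, ?_⟩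
      · intro a ha b hb s t
        simp only [Finset.mem_image, Finset.mem_univ, true_and] at ha hb ⊢
        obtain ⟨c, rfl⟩ := ha
        obtain ⟨c', rfl⟩ := hb
        exact ⟨s * c + t * c', by rw [add_smul, mul_smul, mul_smul]⟩
      · rw [zero_add, pow_one, qq, ← Finset.card_univ]
        exact_mod_cast Finset.card_image_le
      · have : ((univ.erase (0 : K)).card : ℝ) ≤ (((univ : Finset K).image fun c => c • v0) ∩ Vs V d).card := by
          norm_cast
          apply Finset.card_le_card_of_injOn (fun c => c • v0)
          · intro c hc
            have hc : c ≠ 0 := (Finset.mem_erase.1 hc).1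
            simp only [Finset.coe_inter, Set.mem_inter_iff, Finset.mem_coe]
            exact ⟨Finset.mem_image_of_mem _ (Finset.mem_univ c), Vs_scale V hV d c hc v0 hv0⟩
          · intro c _ c' _ h
            exact smul_left_injective K hv00 h
        rw [card_erase_K] at this
        rw [zero_add, pow_one]
        linarith
    | succ j ih =>
      intro i hi hjd
      obtain ⟨W, hW, hWc, hWV⟩ := ih (i + 1) (by omega) (by omega)
      have hVbig : (qq K / 64) ^ (j + 1) ≤ V.card := by
        refine hWV.trans ?_
        exact_mod_cast Finset.card_le_card (Finset.inter_subset_right.trans (Vs_sub V _))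
      have hlt := hcon (j + 1) (by omega) hVbig
      obtain ⟨W', h1, h2, h3⟩ := stepD V i hne hq32 W hW (by linarith)
      refine ⟨W', h1, ?_, ?_⟩
      · rw [pow_succ, mul_comm]
        exact h2.trans (mul_le_mul_of_nonneg_left hWc hq0.le)
      · rw [pow_succ]
        exact (mul_le_mul_of_nonneg_right hWV (by positivity)).trans h3
  obtain ⟨e, he⟩ : ∃ e, d = e + 1 := ⟨d - 1, by omega⟩
  obtain ⟨W, -, -, hWV⟩ := claim e 1 (by omega) (by omega)
  rw [← he] at hWV
  have hVbig : (qq K / 64) ^ d ≤ V.card := by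
    refine hWV.trans ?_
    exact_mod_cast Finset.card_le_card (Finset.inter_subset_right.trans (Vs_sub V _))
  have hlt := hcon d le_rfl hVbig
  have : (V.card : ℝ) ≤ qq K ^ d := by
    rw [hdd, ← card_V]; exact_mod_cast Finset.card_le_univ V
  have : 0 < qq K ^ d := by positivity
  linarith

end stageD
end PD


namespace PD
open Finset
set_option linter.unusedSectionVars false

section final
variable {K : Type} [Field K] [Fintype K] [DecidableEq K]
variable {ι : Type} [Fintype ι] [DecidableEq ι]

set_option maxHeartbeats 2000000 in
lemma even_big (hK : ringChar K ≠ 2) (k : ℕ) (hk1 : 1 ≤ k) (hk : Fintype.card ι = 2 * k) (η : ℝ)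
    (hη : η = 1 / (1000 * 8 ^ (2 * k)))
    (hq1 : 289 ≤ qq K * (η ^ 2 / 4) ^ 2) (hq2 : 400 * 64 ^ (2 * (2 * k)) < qq K)
    (E : Finset (ι → K)) (hE : AllBad E) :
    (1 + η ^ 2 / 2) * (E.card : ℝ) ^ 2 < qq K ^ (2 * k + 1) := by
  by_contra hcon
  have hcon := not_lt.1 hcon
  have h8 : (1 : ℝ) ≤ 8 ^ (2 * k) := one_le_pow₀ (by norm_num)
  have h0 : 0 < η := by rw [hη]; positivity
  have h1 : η ≤ 1 / 1000 := by
    rw [hη, div_le_div_iff₀ (by positivity) (by norm_num)]; linarith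
  have hη3 : η * (1000 * 8 ^ (Fintype.card ι)) ≤ 1 := by
    rw [hη, hk]; apply le_of_eq; field_simp
  have hq := qq_gt_one (K := K)
  have hq0 := qq_pos (K := K)
  have hup := card_upper hK E hE
  rw [hk] at hup
  have h64 : (1 : ℝ) ≤ 64 ^ (2 * (2 * k)) := one_le_pow₀ (by norm_num)
  have hη2 : η ^ 2 ≤ 1 / 1000 := by nlinarith
  have hn1 : qq K * qq K ^ (2 * k) ≤ (1 + η ^ 2 / 2) * (E.card : ℝ) ^ 2 := by
    rw [← pow_succ']; exact hcon
  have hn2 : qq K * qq K ^ (2 * k) ≤ 2 * (E.card : ℝ) ^ 2 := by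
    refine hn1.trans (mul_le_mul_of_nonneg_right (by linarith) (by positivity))
  have hT := stageA hK k hk E hE hn2 (η ^ 2 / 4) (by positivity) (by linarith) hq1
  have hn0 : (0 : ℝ) < E.card := by
    have : (0 : ℝ) < qq K * qq K ^ (2 * k) := by positivity
    by_contra hc
    have : (E.card : ℝ) = 0 := le_antisymm (not_lt.1 hc) (by positivity)
    rw [this] at hn2; linarith
  have hne : E.Nonempty := Finset.card_pos.1 (by exact_mod_cast hn0)
  rw [← hk] at hn1
  obtain ⟨y, hy, hb, hr, hV1, hV2⟩ := pin hK E hE hne η h0 (by linarith) hT hn1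
  rw [hk] at hn1
  have hqn : qq K ≤ η * (E.card : ℝ) / 2 := by
    have hq3 : qq K ^ 2 ≤ qq K ^ (2 * k) := pow_le_pow_right₀ hq.le (by omega)
    have h8q : 8 ≤ η ^ 2 * qq K := by
      have : qq K * (η ^ 2 / 4) ^ 2 = (η ^ 2 * qq K) * (η ^ 2 / 16) := by ring
      rw [this] at hq1
      have hp : 0 ≤ η ^ 2 * qq K := by positivity
      nlinarith
    have : qq K ^ 2 ≤ (η * (E.card : ℝ) / 2) ^ 2 := by
      have a : qq K * qq K ^ 2 ≤ 2 * (E.card : ℝ) ^ 2 := (mul_le_mul_of_nonneg_left hq3 hq0.le).trans hn2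
      have b : 8 * qq K ^ 2 ≤ (η ^ 2 * qq K) * qq K ^ 2 := mul_le_mul_of_nonneg_right h8q (by positivity)
      have c := mul_le_mul_of_nonneg_left a (show 0 ≤ η ^ 2 by positivity)
      nlinarith
    exact (pow_le_pow_iff_left₀ hq0.le (by positivity) (by norm_num)).1 this
  have hVne : (VV E η y).Nonempty := by
    rw [← Finset.card_pos]
    have : (0 : ℝ) < (VV E η y).card := by linarith
    exact_mod_cast this
  obtain ⟨j, hj, hj1, hj2⟩ := stageDmain (VV E η y) (fun l hl v hv => VV_scale E η y l hl v hv) hVne (by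
      intro h
      apply (VV_mem.1 h).1; simp [qf]) η
    (fun V' hV' hsub => lemC hK E η h0 (by linarith) y hb hr hV1 hn0 hqn V' hV' hsub) h0 hη3 (by linarith) (by omega)
  rw [hk] at hj
  set n : ℝ := (E.card : ℝ)
  set v : ℝ := ((VV E η y).card : ℝ)
  set q := qq K
  have hv0 : 0 < v := by linarith
  have A1 : q * q ^ (2 * k) ≤ 128 * q ^ (2 * j) := by
    have a : n ^ 2 ≤ 4 * v ^ 2 := by nlinarith
    have b : v ^ 2 ≤ (4 * q ^ j) ^ 2 := pow_le_pow_left₀ hv0.le hj2 2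
    have c : (4 * q ^ j) ^ 2 = 16 * q ^ (2 * j) := by ring
    linarith
  have A2 : q ^ (2 * j) ≤ 64 ^ (2 * (2 * k)) * (400 * (q * q ^ (2 * k))) := by
    have a : ((q / 64) ^ j) ^ 2 ≤ v ^ 2 := pow_le_pow_left₀ (by positivity) hj1 2
    have b : v ^ 2 ≤ 400 * n ^ 2 := by nlinarith
    have c : q ^ (2 * k) * (q - 1) ≤ q * q ^ (2 * k) := by
      have : 0 < q ^ (2 * k) := by positivity
      nlinarith
    have e : ((q / 64) ^ j) ^ 2 = q ^ (2 * j) / 64 ^ (2 * j) := by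
      rw [← pow_mul, div_pow, mul_comm j 2]
    rw [e, div_le_iff₀ (by positivity)] at a
    have f : (64 : ℝ) ^ (2 * j) ≤ 64 ^ (2 * (2 * k)) := pow_le_pow_right₀ (by norm_num) (by omega)
    have g : v ^ 2 * 64 ^ (2 * j) ≤ (400 * (q * q ^ (2 * k))) * 64 ^ (2 * (2 * k)) :=
      mul_le_mul (by linarith) f (by positivity) (by positivity)
    linarith
  rcases Nat.lt_or_ge k j with hjk | hjk
  · have e : q ^ (2 * k + 2) ≤ q ^ (2 * j) := pow_le_pow_right₀ hq.le (by omega)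
    have e2 : q ^ (2 * k + 2) = q * (q * q ^ (2 * k)) := by ring
    have hp : 0 < q * q ^ (2 * k) := by positivity
    have : q * (q * q ^ (2 * k)) ≤ (400 * 64 ^ (2 * (2 * k))) * (q * q ^ (2 * k)) := by
      rw [← e2]; refine e.trans (A2.trans (le_of_eq (by ring)))
    have := le_of_mul_le_mul_right this hp
    linarith
  · have e : q ^ (2 * j) ≤ q ^ (2 * k) := pow_le_pow_right₀ hq.le (by omega)
    have hp : 0 < q ^ (2 * k) := by positivity
    have : q * q ^ (2 * k) ≤ 128 * q ^ (2 * k) := by linarith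
    have := le_of_mul_le_mul_right this hp
    linarith

lemma odd_bound (hK : ringChar K ≠ 2) (k : ℕ) (hk : Fintype.card ι = 2 * k + 1)
    (E B : Finset (ι → K)) (hBE : B ⊆ E)
    (hB : ∀ y ∈ B, 2 * (E.image (fun x => qf (x - y))).card ≤ Fintype.card K)
    (hE : qq K ^ (k + 1) ≤ (E.card : ℝ)) : (B.card : ℝ) ≤ E.card / 2 := by
  have h := odd_main hK k hk E B hBE hB
  change (E.card : ℝ) * (B.card : ℝ) ^ 2 ≤ B.card * qq K ^ (2 * k + 1) +
    B.card * (B.card - 1) * (qq K ^ k * (qq K - 2)) at h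
  have hq := qq_gt_one (K := K)
  have hq2 : 2 ≤ qq K := by
    unfold qq at hq ⊢
    have : 1 < Fintype.card K := by exact_mod_cast hq
    exact_mod_cast this
  by_contra hc
  have hc := not_le.1 hc
  have hb0 : (0 : ℝ) < B.card := lt_of_le_of_lt (by positivity) hc
  set q := qq K
  set e : ℝ := (E.card : ℝ)
  set b : ℝ := (B.card : ℝ)
  have hQ : 0 < q ^ k := by positivity
  have e1 : q ^ (2 * k + 1) = q * q ^ k * q ^ k := by ring
  have e2 : q ^ (k + 1) = q * q ^ k := by ring
  rw [e1] at h
  rw [e2] at hE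
  set Q := q ^ k
  have h' : b * (e * b) ≤ b * (q * Q * Q + (b - 1) * (Q * (q - 2))) := by nlinarith
  have h2 := le_of_mul_le_mul_left h' hb0
  have h3 : b * (e - q * Q + 2 * Q) ≤ q * Q * Q := by nlinarith [mul_nonneg hQ.le (show 0 ≤ q - 2 by linarith)]
  have h4 : e / 2 * (e - q * Q + 2 * Q) < b * (e - q * Q + 2 * Q) :=
    mul_lt_mul_of_pos_right hc (by linarith)
  have h5 : q * Q * Q ≤ e / 2 * (e - q * Q + 2 * Q) := by
    have : (q * Q) / 2 * (2 * Q) ≤ e / 2 * (e - q * Q + 2 * Q) := by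
      apply mul_le_mul <;> first | linarith | positivity | (apply div_nonneg <;> linarith [mul_pos (show 0 < q by linarith) hQ])
    linarith
  linarith

lemma assemble (d : ℕ) (c : ℝ)
    (H : ∀ (K : Type) [Field K] [Fintype K] [DecidableEq K], ringChar K ≠ 2 → ∀ E B : Finset (Fin d → K),
      qq K ^ (d + 1) ≤ (E.card : ℝ) ^ 2 → B ⊆ E →
      (∀ y ∈ B, 2 * (E.image (fun x => qf (x - y))).card ≤ Fintype.card K) →
      (B.card : ℝ) ≤ (1 - c) * E.card) :
      ∀ (K : Type) [Field K] [Fintype K] [DecidableEq K],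
        ringChar K ≠ 2 →
        ∀ E : Finset (Fin d → K),
          (Fintype.card K : ℝ) ^ (((d : ℝ) + 1) / 2) ≤ (E.card : ℝ) →
          ∃ E' ⊆ E, c * (E.card : ℝ) ≤ (E'.card : ℝ) ∧
            ∀ y ∈ E',
              (Fintype.card K : ℝ) / 2 <
                ((E.image (fun x => ∑ j, (x j - y j) ^ 2)).card : ℝ) := by
  intro K _ _ _ hK E hE
  have hqe : ∀ y : Fin d → K, (fun x : Fin d → K => ∑ j, (x j - y j) ^ 2) = fun x => qf (x - y) := by
    intro y; funext x
    simp only [qf, dotProduct, Pi.sub_apply, sq]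
  have hsq : qq K ^ (d + 1) ≤ (E.card : ℝ) ^ 2 := by
    have h0 : (0 : ℝ) ≤ (Fintype.card K : ℝ) := by positivity
    have := pow_le_pow_left₀ (Real.rpow_nonneg h0 _) hE 2
    rw [← Real.rpow_natCast (_ ^ _) 2, ← Real.rpow_mul h0] at this
    have e : (((d : ℝ) + 1) / 2 * ((2 : ℕ) : ℝ)) = ((d + 1 : ℕ) : ℝ) := by push_cast; ring
    rw [e, Real.rpow_natCast] at this
    exact this
  let B := E.filter fun y => 2 * (E.image (fun x => qf (x - y))).card ≤ Fintype.card K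
  have hB := H K hK E B hsq (Finset.filter_subset _ _) (fun y hy => (Finset.mem_filter.1 hy).2)
  refine ⟨E \ B, Finset.sdiff_subset, ?_, ?_⟩
  · have : (E.card : ℝ) = (E \ B).card + B.card := by
      have := Finset.card_sdiff_add_card_eq_card (Finset.filter_subset (fun y => 2 * (E.image (fun x => qf (x - y))).card ≤ Fintype.card K) E)
      exact_mod_cast this.symm
    linarith
  · intro y hy
    rw [Finset.mem_sdiff, Finset.mem_filter] at hy
    have h1 : ¬ (2 * (E.image (fun x => qf (x - y))).card ≤ Fintype.card K) := fun h => hy.2 ⟨hy.1, h⟩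
    rw [hqe y, div_lt_iff₀ (by norm_num), mul_comm]
    exact_mod_cast not_le.1 h1

lemma bad_mono (E B : Finset (ι → K)) (hBE : B ⊆ E)
    (hB : ∀ y ∈ B, 2 * (E.image (fun x => qf (x - y))).card ≤ Fintype.card K) : AllBad B := by
  intro y hy
  refine le_trans ?_ (hB y hy)
  exact Nat.mul_le_mul_left _ (Finset.card_le_card (Finset.image_subset_image hBE))

lemma main_odd (k : ℕ) : ∀ (K : Type) [Field K] [Fintype K] [DecidableEq K], ringChar K ≠ 2 →
    ∀ E B : Finset (Fin (2 * k + 1) → K),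
      qq K ^ ((2 * k + 1) + 1) ≤ (E.card : ℝ) ^ 2 → B ⊆ E →
      (∀ y ∈ B, 2 * (E.image (fun x => qf (x - y))).card ≤ Fintype.card K) →
      (B.card : ℝ) ≤ (1 - 1 / 2) * E.card := by
  intro K _ _ _ hK E B hE hBE hB
  have hq0 := qq_pos (K := K)
  have := odd_bound hK k (by simp) E B hBE hB (by
    have e : qq K ^ ((2 * k + 1) + 1) = (qq K ^ (k + 1)) ^ 2 := by ring
    rw [e] at hE
    exact (pow_le_pow_iff_left₀ (by positivity) (by positivity) (by norm_num)).1 hE)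
  linarith

lemma main_even (k : ℕ) (hk1 : 1 ≤ k) : ∃ c : ℝ, 0 < c ∧
    ∀ (K : Type) [Field K] [Fintype K] [DecidableEq K], ringChar K ≠ 2 →
    ∀ E B : Finset (Fin (2 * k) → K),
      qq K ^ (2 * k + 1) ≤ (E.card : ℝ) ^ 2 → B ⊆ E →
      (∀ y ∈ B, 2 * (E.image (fun x => qf (x - y))).card ≤ Fintype.card K) →
      (B.card : ℝ) ≤ (1 - c) * E.card := by
  set η : ℝ := 1 / (1000 * 8 ^ (2 * k)) with hη
  have h8 : (1 : ℝ) ≤ 8 ^ (2 * k) := one_le_pow₀ (by norm_num)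
  have h0 : 0 < η := by rw [hη]; positivity
  have h1 : η ≤ 1 / 1000 := by
    rw [hη, div_le_div_iff₀ (by positivity) (by norm_num)]; linarith
  set q0 : ℝ := 289 / (η ^ 2 / 4) ^ 2 + 400 * 64 ^ (2 * (2 * k)) with hq0
  have hq00 : 0 < q0 := by positivity
  refine ⟨min (η ^ 2 / 8) (1 / q0 ^ (2 * k)), lt_min (by positivity) (by positivity), ?_⟩
  intro K _ _ _ hK E B hE hBE hB
  have hbad := bad_mono E B hBE hB
  have hq := qq_gt_one (K := K)
  have hqp := qq_pos (K := K)
  have hEpos : (0 : ℝ) < E.card := by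
    have : (0 : ℝ) < qq K ^ (2 * k + 1) := by positivity
    by_contra hc
    have : (E.card : ℝ) = 0 := le_antisymm (not_lt.1 hc) (by positivity)
    rw [this] at hE; norm_num at hE; linarith
  rcases lt_or_ge q0 (qq K) with hlt | hge
  · have hs := even_big hK k hk1 (by simp) η hη (by
      rw [← div_le_iff₀ (by positivity)]
      have : (0 : ℝ) < 400 * 64 ^ (2 * (2 * k)) := by positivity
      linarith) (by
      have : 0 < 289 / (η ^ 2 / 4) ^ 2 := by positivity
      linarith) B hbad
    have hc1 := min_le_left (η ^ 2 / 8) (1 / q0 ^ (2 * k))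
    have : (B.card : ℝ) ≤ (1 - η ^ 2 / 8) * E.card := by
      by_contra hc
      have hc := not_le.1 hc
      have hη2 : η ^ 2 ≤ 1 / 1000 := by nlinarith
      have a : ((1 - η ^ 2 / 8) * E.card) ^ 2 ≤ (B.card : ℝ) ^ 2 :=
        pow_le_pow_left₀ (mul_nonneg (by linarith) hEpos.le) hc.le 2
      have b : (1 : ℝ) ≤ (1 + η ^ 2 / 2) * (1 - η ^ 2 / 8) ^ 2 := by
        have : 0 < η ^ 2 := by positivity
        generalize η ^ 2 = t at *
        nlinarith [mul_pos this this, mul_pos (mul_pos this this) this]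
      have c : (1 + η ^ 2 / 2) * ((1 - η ^ 2 / 8) * E.card) ^ 2 ≤ (1 + η ^ 2 / 2) * (B.card : ℝ) ^ 2 :=
        mul_le_mul_of_nonneg_left a (by positivity)
      have dd : (E.card : ℝ) ^ 2 ≤ (1 + η ^ 2 / 2) * ((1 - η ^ 2 / 8) * E.card) ^ 2 := by
        rw [mul_pow, ← mul_assoc]
        exact le_mul_of_one_le_left (by positivity) b
      linarith
    refine this.trans (mul_le_mul_of_nonneg_right (by linarith) hEpos.le)
  · have hup := card_upper hK B hbad
    rw [Fintype.card_fin] at hup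
    have hlt : (B.card : ℝ) ^ 2 < (E.card : ℝ) ^ 2 := by
      refine lt_of_lt_of_le ?_ hE
      rw [pow_succ (qq K)]
      have : 0 < qq K ^ (2 * k) := by positivity
      nlinarith
    have hlt2 : (B.card : ℝ) < E.card := lt_of_pow_lt_pow_left₀ 2 (by positivity) hlt
    have hlt3 : (B.card : ℝ) + 1 ≤ E.card := by
      have : B.card < E.card := by exact_mod_cast hlt2
      exact_mod_cast this
    have hEle : (E.card : ℝ) ≤ q0 ^ (2 * k) := by
      have a : (E.card : ℝ) ≤ qq K ^ (2 * k) := by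
        have := card_V (K := K) (ι := Fin (2 * k))
        rw [Fintype.card_fin] at this
        rw [← this]; exact_mod_cast Finset.card_le_univ E
      exact a.trans (pow_le_pow_left₀ hqp.le hge _)
    have hc2 := min_le_right (η ^ 2 / 8) (1 / q0 ^ (2 * k))
    have : min (η ^ 2 / 8) (1 / q0 ^ (2 * k)) * (E.card : ℝ) ≤ 1 := by
      refine (mul_le_mul_of_nonneg_right hc2 hEpos.le).trans ?_
      rw [div_mul_eq_mul_div, one_mul, div_le_one (by positivity)]
      exact hEle
    linarith

end final
end PD

theorem stmt0 (d : ℕ) (hd : 2 ≤ d) :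
    ∃ c : ℝ, 0 < c ∧
      ∀ (K : Type) [Field K] [Fintype K] [DecidableEq K],
        ringChar K ≠ 2 →
        ∀ E : Finset (Fin d → K),
          (Fintype.card K : ℝ) ^ (((d : ℝ) + 1) / 2) ≤ (E.card : ℝ) →
          ∃ E' ⊆ E, c * (E.card : ℝ) ≤ (E'.card : ℝ) ∧
            ∀ y ∈ E',
              (Fintype.card K : ℝ) / 2 <
                ((E.image (fun x => ∑ j, (x j - y j) ^ 2)).card : ℝ) := by
  rcases Nat.even_or_odd' d with ⟨k, rfl | rfl⟩
  · obtain ⟨c, hc, H⟩ := PD.main_even k (by omega)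
    exact ⟨c, hc, PD.assemble (2 * k) c H⟩
  · exact ⟨1 / 2, by norm_num, PD.assemble (2 * k + 1) (1 / 2) (PD.main_odd k)⟩
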